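/- arXiv:1405.5622 — 2 statements merged into one kernel-verified Lean document; each statement's English description precedes it below -/
import Mathlib

section
/- If G is a subcubic graph on n vertices no connected component of which is isomorphic to K_{3,3}, then γ'_R(G) ≤ (4/5)·n. -/
open Finset SimpleGraph

/-- An edge Roman dominating function: values in {0,1,2} on edges (0 elsewhere),
and every edge with value 0 is adjacent to a distinct edge with value 2
sharing an endpoint with it. -/
def EdgeRDF {V : Type*} (G : SimpleGraph V) (f : Sym2 V → ℕ) : Prop :=
  (∀ e, f e ≤ 2) ∧ (∀ e, e ∉ G.edgeSet → f e = 0) ∧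
  (∀ e ∈ G.edgeSet, f e = 0 →
    ∃ e' ∈ G.edgeSet, f e' = 2 ∧ e' ≠ e ∧ ∃ v, v ∈ e ∧ v ∈ e')

/-- The edge Roman domination number: the minimum weight of an
edge Roman dominating function. -/
noncomputable def edgeRomanNumber (V : Type*) [Fintype V] [DecidableEq V]
    (G : SimpleGraph V) : ℕ :=
  sInf {w | ∃ f : Sym2 V → ℕ, EdgeRDF G f ∧ w = ∑ e : Sym2 V, f e}


section Dominating

variable {V : Type*} {G : SimpleGraph V}

/-- `f` is an edge Roman dominating function of the subgraph of `G` induced by `S`. -/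
def EdgeRDFOn (G : SimpleGraph V) (S : Finset V) (f : Sym2 V → ℕ) : Prop :=
  (∀ e, f e ≤ 2) ∧ (∀ e, f e ≠ 0 → e ∈ G.edgeSet ∧ ∀ v ∈ e, v ∈ S) ∧
  (∀ e ∈ G.edgeSet, (∀ v ∈ e, v ∈ S) → f e = 0 →
    ∃ e' ∈ G.edgeSet, f e' = 2 ∧ e' ≠ e ∧ ∃ v, v ∈ e ∧ v ∈ e')

lemma EdgeRDFOn.mono [DecidableEq V] {S S' : Finset V} {f : Sym2 V → ℕ} (hf : EdgeRDFOn G S' f)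
    (hS : S' ⊆ S)
    (h : ∀ v ∈ S, v ∉ S' → ∀ w ∈ S, ¬ G.Adj v w) : EdgeRDFOn G S f := by
  obtain ⟨h1, h2, h3⟩ := hf
  refine ⟨h1, fun e he => ⟨(h2 e he).1, fun v hv => hS ((h2 e he).2 v hv)⟩, fun e he hes h0 => ?_⟩
  induction e with | _ x y
  rw [mem_edgeSet] at he
  have hx : x ∈ S := hes x (by simp)
  have hy : y ∈ S := hes y (by simp)
  refine h3 _ he (fun v hv => ?_) h0
  rcases Sym2.mem_iff.1 hv with rfl | rfl
  · by_contra hn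
    exact h _ hx hn _ hy he
  · by_contra hn
    exact h _ hy hn _ hx he.symm

lemma EdgeRDFOn.update_two [DecidableEq V] {S : Finset V} {x y : V} {f : Sym2 V → ℕ}
    (hf : EdgeRDFOn G (S \ {x, y}) f) (hx : x ∈ S) (hy : y ∈ S) (hxy : G.Adj x y) :
    EdgeRDFOn G S (Function.update f s(x, y) 2) := by
  obtain ⟨h1, h2, h3⟩ := hf
  refine ⟨fun e => ?_, fun e he => ?_, fun e he hes h0 => ?_⟩
  · rcases eq_or_ne e s(x, y) with rfl | hne
    · simp
    · simpa [Function.update_of_ne hne] using h1 e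
  · rcases eq_or_ne e s(x, y) with rfl | hne
    · simp [hxy, hx, hy]
    · rw [Function.update_of_ne hne] at he
      exact ⟨(h2 e he).1, fun v hv => (Finset.mem_sdiff.1 ((h2 e he).2 v hv)).1⟩
  · have hne : e ≠ s(x, y) := by rintro rfl; simp at h0
    rw [Function.update_of_ne hne] at h0
    by_cases hv : ∃ v ∈ e, v = x ∨ v = y
    · obtain ⟨v, hve, hv⟩ := hv
      exact ⟨s(x, y), hxy, by simp, hne.symm, v, hve, by simpa using hv⟩
    · push Not at hv
      obtain ⟨e', he', h2', hne', v, hve, hve'⟩ := h3 e he (fun v hve => by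
        simpa [hes v hve] using hv v hve) h0
      refine ⟨e', he', ?_, hne', v, hve, hve'⟩
      rw [Function.update_of_ne ?_]
      · exact h2'
      · rintro rfl
        simpa using (h2 _ (by rw [h2']; simp)).2 x (by simp)

lemma EdgeRDFOn.update_one [DecidableEq V] {S : Finset V} {x y : V} {f : Sym2 V → ℕ}
    (hf : EdgeRDFOn G (S \ {x, y}) f) (hx : x ∈ S) (hy : y ∈ S) (hxy : G.Adj x y)
    (hxn : ∀ z ∈ S, G.Adj x z → z = y) (hyn : ∀ z ∈ S, G.Adj y z → z = x) :
    EdgeRDFOn G S (Function.update f s(x, y) 1) := by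
  obtain ⟨h1, h2, h3⟩ := hf
  refine ⟨fun e => ?_, fun e he => ?_, fun e he hes h0 => ?_⟩
  · rcases eq_or_ne e s(x, y) with rfl | hne
    · simp
    · simpa [Function.update_of_ne hne] using h1 e
  · rcases eq_or_ne e s(x, y) with rfl | hne
    · simp [hxy, hx, hy]
    · rw [Function.update_of_ne hne] at he
      exact ⟨(h2 e he).1, fun v hv => (Finset.mem_sdiff.1 ((h2 e he).2 v hv)).1⟩
  · have hne : e ≠ s(x, y) := by rintro rfl; simp at h0
    rw [Function.update_of_ne hne] at h0
    have hv : ∀ v ∈ e, v ≠ x ∧ v ≠ y := by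
      induction e with | _ a b
      rw [mem_edgeSet] at he
      have ha := hes a (by simp)
      have hb := hes b (by simp)
      intro v hv
      rcases Sym2.mem_iff.1 hv with rfl | rfl
      · constructor <;> rintro rfl
        · exact hne (by rw [hxn b hb he])
        · exact hne (by rw [hyn b hb he, Sym2.eq_swap])
      · constructor <;> rintro rfl
        · exact hne (by rw [hxn a ha he.symm, Sym2.eq_swap])
        · exact hne (by rw [hyn a ha he.symm])
    obtain ⟨e', he', h2', hne', v, hve, hve'⟩ := h3 e he (fun v hve => by
      simpa [hes v hve] using hv v hve) h0
    refine ⟨e', he', ?_, hne', v, hve, hve'⟩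
    rw [Function.update_of_ne ?_]
    · exact h2'
    · rintro rfl
      simpa using (h2 _ (by rw [h2']; simp)).2 x (by simp)

lemma card_sdiff_pair_add_two [DecidableEq V] {S : Finset V} {x y : V} (hx : x ∈ S) (hy : y ∈ S) (hxy : x ≠ y) :
    (#(S \ {x, y}) : ℤ) + 2 = #S := by
  have h : ({x, y} : Finset V) ⊆ S := by simp [Finset.insert_subset_iff, hx, hy]
  have := Finset.card_sdiff_add_card_eq_card h
  rw [Finset.card_pair hxy] at this
  exact_mod_cast this

variable [Fintype V]

/-- The subgraph of `G` induced by `S` has an edge Roman dominating function whose weight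
exceeds `4/5 * |S|` by at most `t / 5`. -/
def ExcessLE (G : SimpleGraph V) (S : Finset V) (t : ℤ) : Prop :=
  ∃ f : Sym2 V → ℕ, EdgeRDFOn G S f ∧ 5 * ((∑ e, f e : ℕ) : ℤ) ≤ 4 * (#S : ℤ) + t

lemma ExcessLE.mono {S : Finset V} {t t' : ℤ} (h : ExcessLE G S t) (ht : t ≤ t') :
    ExcessLE G S t' := by
  obtain ⟨f, hf, hw⟩ := h
  exact ⟨f, hf, by linarith⟩

lemma excessLE_empty : ExcessLE G ∅ 0 := by
  refine ⟨0, ⟨by simp, by simp, fun e _ hes _ => ?_⟩, by simp⟩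
  induction e with | _ x y
  exact absurd (hes x (by simp)) (by simp)

variable [DecidableEq V]

lemma ExcessLE.of_isolated {S : Finset V} {v : V} {t : ℤ} (h : ExcessLE G (S.erase v) t)
    (hv : v ∈ S) (hiso : ∀ w ∈ S, ¬ G.Adj v w) : ExcessLE G S (t - 4) := by
  obtain ⟨f, hf, hw⟩ := h
  refine ⟨f, hf.mono (Finset.erase_subset _ _) fun w hw hwv => ?_, ?_⟩
  · obtain rfl : w = v := by
      by_contra hne
      exact hwv (by simp [hne, hw])
    exact hiso
  · have := Finset.card_erase_add_one hv
    have : (#(S.erase v) : ℤ) + 1 = #S := by exact_mod_cast this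
    linarith

lemma EdgeRDFOn.sum_update {S : Finset V} {x y : V} {f : Sym2 V → ℕ}
    (hf : EdgeRDFOn G (S \ {x, y}) f) (c : ℕ) :
    ∑ e, Function.update f s(x, y) c e = c + ∑ e, f e := by
  have h0 : f s(x, y) = 0 := by
    by_contra h
    simpa using (hf.2.1 _ h).2 x (by simp)
  rw [Finset.sum_update_of_mem (Finset.mem_univ _),
    ← Finset.sum_sdiff (Finset.subset_univ {s(x, y)})]
  simp [h0]

lemma ExcessLE.of_edge {S : Finset V} {x y : V} {t : ℤ} (h : ExcessLE G (S \ {x, y}) t)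
    (hx : x ∈ S) (hy : y ∈ S) (hxy : G.Adj x y) : ExcessLE G S (t + 2) := by
  obtain ⟨f, hf, hw⟩ := h
  refine ⟨_, hf.update_two hx hy hxy, ?_⟩
  rw [hf.sum_update]
  have := card_sdiff_pair_add_two hx hy hxy.ne
  push_cast at hw ⊢
  linarith

lemma ExcessLE.of_isolated_edge {S : Finset V} {x y : V} {t : ℤ} (h : ExcessLE G (S \ {x, y}) t)
    (hx : x ∈ S) (hy : y ∈ S) (hxy : G.Adj x y)
    (hxn : ∀ z ∈ S, G.Adj x z → z = y) (hyn : ∀ z ∈ S, G.Adj y z → z = x) :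
    ExcessLE G S (t - 3) := by
  obtain ⟨f, hf, hw⟩ := h
  refine ⟨_, hf.update_one hx hy hxy hxn hyn, ?_⟩
  rw [hf.sum_update]
  have := card_sdiff_pair_add_two hx hy hxy.ne
  push_cast at hw ⊢
  linarith

/-- Removing a matching of size `k`. -/
lemma ExcessLE.of_matching {S : Finset V} {k : ℕ} {t : ℤ} {x y : ℕ → V}
    (hx : ∀ i < k, x i ∈ S) (hy : ∀ i < k, y i ∈ S) (hxy : ∀ i < k, G.Adj (x i) (y i))
    (hxx : ∀ i < k, ∀ j < k, x i = x j → i = j) (hyy : ∀ i < k, ∀ j < k, y i = y j → i = j)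
    (hne : ∀ i < k, ∀ j < k, x i ≠ y j)
    (h : ExcessLE G {v ∈ S | ∀ i < k, v ≠ x i ∧ v ≠ y i} t) : ExcessLE G S (t + 2 * k) := by
  induction k generalizing t with
  | zero => simpa using h
  | succ k ih =>
    have key : ExcessLE G {v ∈ S | ∀ i < k, v ≠ x i ∧ v ≠ y i} (t + 2) := by
      refine ExcessLE.of_edge (x := x k) (y := y k) ?_ ?_ ?_ (hxy k (by omega))
      · convert h using 1
        ext v
        simp only [Finset.mem_sdiff, Finset.mem_filter, Finset.mem_insert, Finset.mem_singleton,
          Nat.forall_lt_succ_right]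
        tauto
      · refine Finset.mem_filter.2 ⟨hx k (by omega), fun i hi => ⟨fun h => ?_, ?_⟩⟩
        · have := hxx k (by omega) i (by omega) h
          omega
        · exact hne k (by omega) i (by omega)
      · refine Finset.mem_filter.2 ⟨hy k (by omega), fun i hi => ⟨?_, fun h => ?_⟩⟩
        · exact (hne i (by omega) k (by omega)).symm
        · have := hyy k (by omega) i (by omega) h
          omega
    have := ih (fun i hi => hx i (by omega)) (fun i hi => hy i (by omega))
      (fun i hi => hxy i (by omega)) (fun i hi j hj => hxx i (by omega) j (by omega))
      (fun i hi j hj => hyy i (by omega) j (by omega))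
      (fun i hi j hj => hne i (by omega) j (by omega)) key
    convert this using 1
    push_cast
    ring

/-- Each vertex of an independent set of `k` vertices of degree at most one, no two of which have
a common neighbour, improves the bound by `2 / 5`. -/
lemma ExcessLE.of_pendant {S : Finset V} (h : ∀ S' ⊆ S, ExcessLE G S' 0) {k : ℕ} {t c : ℕ → V}
    (ht : ∀ i < k, t i ∈ S) (htt : ∀ i < k, ∀ j < k, t i = t j → i = j)
    (hc : ∀ i < k, ∀ z ∈ S, G.Adj (t i) z → z = c i)
    (hcc : ∀ i < k, ∀ j < k, c i = c j → i = j)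
    (hct : ∀ i < k, ∀ j < k, c i ≠ t j) : ExcessLE G S (-(2 * k)) := by
  induction k generalizing S with
  | zero => simpa using h S subset_rfl
  | succ k ih =>
    have rec_ : ∀ S' ⊆ S, (∀ i < k, t i ∈ S') → ExcessLE G S' (-(2 * k)) := fun S' hS' hm =>
      ih (fun S'' hS'' => h S'' (hS''.trans hS')) hm
        (fun i hi j hj => htt i (by omega) j (by omega))
        (fun i hi z hz => hc i (by omega) z (hS' hz))
        (fun i hi j hj => hcc i (by omega) j (by omega))
        (fun i hi j hj => hct i (by omega) j (by omega))
    have htk : t k ∈ S := ht k (by omega)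
    have hne : ∀ i < k, t i ≠ t k := fun i hi h => by
      have := htt i (by omega) k (by omega) h
      omega
    by_cases hadj : c k ∈ S ∧ G.Adj (t k) (c k)
    · obtain ⟨hckS, hadj⟩ := hadj
      by_cases hy : ∃ y ∈ S, G.Adj (c k) y ∧ y ≠ t k
      · obtain ⟨y, hyS, hcy, hyt⟩ := hy
        have hyi : ∀ i < k, t i ≠ y := by
          rintro i hi rfl
          have h1 := hc i (by omega) _ hckS hcy.symm
          have := hcc k (by omega) i (by omega) h1
          omega
        have h1 := rec_ ((S \ {c k, y}).erase (t k))
          ((Finset.erase_subset _ _).trans Finset.sdiff_subset) (fun i hi => by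
            simp [hne i hi, ht i (by omega), (hct k (by omega) i (by omega)).symm, hyi i hi])
        have h2 := h1.of_isolated (by
          simp [htk, hadj.ne, hyt.symm]) (fun w hw haw => by
            simp only [Finset.mem_sdiff, Finset.mem_insert, not_or] at hw
            exact hw.2.1 (hc k (by omega) w hw.1 haw))
        refine (h2.of_edge hckS hyS hcy).mono ?_
        push_cast
        linarith
      · push Not at hy
        refine (ExcessLE.of_isolated_edge (rec_ (S \ {t k, c k}) Finset.sdiff_subset
          (fun i hi => ?_)) htk hckS hadj (hc k (by omega)) hy).mono ?_
        · simp [hne i hi, ht i (by omega), (hct k (by omega) i (by omega)).symm]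
        · push_cast
          linarith
    · refine (ExcessLE.of_isolated (rec_ (S.erase (t k)) (Finset.erase_subset _ _)
          (fun i hi => ?_)) htk (fun w hw haw => ?_)).mono ?_
      · simp [hne i hi, ht i (by omega)]
      · obtain rfl := hc k (by omega) w hw haw
        exact hadj ⟨hw, haw⟩
      · push_cast
        linarith

end Dominating

section Reduction

variable {V : Type*} [Fintype V] [DecidableEq V] {G : SimpleGraph V}

lemma eq_or_eq_or_eq_of_adj [DecidableRel G.Adj] (hdeg : ∀ v, G.degree v ≤ 3) {v a b c z : V}
    (ha : G.Adj v a) (hb : G.Adj v b) (hc : G.Adj v c) (hab : a ≠ b) (hac : a ≠ c) (hbc : b ≠ c)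
    (hz : G.Adj v z) : z = a ∨ z = b ∨ z = c := by
  have hsub : ({a, b, c} : Finset V) ⊆ G.neighborFinset v := by
    simp [Finset.insert_subset_iff, ha, hb, hc]
  have heq := Finset.eq_of_subset_of_card_le hsub (by
    rw [card_neighborFinset_eq_degree, Finset.card_eq_three.2 ⟨a, b, c, hab, hac, hbc, rfl⟩]
    exact hdeg v)
  have : z ∈ ({a, b, c} : Finset V) := by simp [heq, hz]
  simpa using this

lemma ExcessLE.of_pendant_vertex {S : Finset V} (h : ∀ S' ⊆ S, ExcessLE G S' 0) {v : V}
    (hv : v ∈ S) (hvn : ∀ z ∈ S, ∀ z' ∈ S, G.Adj v z → G.Adj v z' → z = z') :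
    ExcessLE G S (-2) := by
  by_cases hz : ∃ z ∈ S, G.Adj v z
  · obtain ⟨z, hzS, hvz⟩ := hz
    have := ExcessLE.of_pendant h (k := 1) (t := fun _ => v) (c := fun _ => z)
      (by simpa using hv) (by simp) (fun _ _ z' hz' hvz' => hvn z' hz' z hzS hvz' hvz)
      (by simp) (by simp [hvz.ne.symm])
    simpa using this
  · push Not at hz
    exact ((h _ (Finset.erase_subset v S)).of_isolated hv hz).mono (by norm_num)

lemma excessLE_of_degree_le_two {S : Finset V} (ih : ∀ S' ⊂ S, ExcessLE G S' 0) {v a b : V}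
    (hv : v ∈ S) (hvn : ∀ z ∈ S, G.Adj v z → z = a ∨ z = b) : ExcessLE G S 0 := by
  have sub : ∀ x ∈ S, ∀ y, ∀ S' ⊆ S \ {x, y}, ExcessLE G S' 0 := fun x hx y S' hS' =>
    ih S' ((Finset.ssubset_iff_of_subset (hS'.trans Finset.sdiff_subset)).2
      ⟨x, hx, fun hxS' => by simpa using hS' hxS'⟩)
  by_cases hz : ∃ z ∈ S, G.Adj v z
  · obtain ⟨z, hzS, hvz⟩ := hz
    by_cases hy : ∃ y ∈ S, G.Adj z y ∧ y ≠ v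
    · obtain ⟨y, hyS, hzy, hyv⟩ := hy
      refine (((ExcessLE.of_pendant_vertex (sub z hzS y) (v := v) ?_ ?_).of_edge hzS hyS hzy).mono
        (by norm_num))
      · simp [hv, hvz.ne, hyv.symm]
      · intro z1 hz1 z2 hz2 h1 h2
        simp only [Finset.mem_sdiff, Finset.mem_insert, Finset.mem_singleton, not_or] at hz1 hz2
        have := hvn z hzS hvz
        have := hvn z1 hz1.1 h1
        have := hvn z2 hz2.1 h2
        grind
    · push Not at hy
      by_cases hb : ∃ b ∈ S, G.Adj v b ∧ b ≠ z
      · obtain ⟨b, hbS, hvb, hbz⟩ := hb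
        refine (((ExcessLE.of_pendant_vertex (sub v hv b) (v := z) ?_ ?_).of_edge hv hbS hvb).mono
          (by norm_num))
        · simp [hzS, hvz.ne.symm, hbz.symm]
        · intro z1 hz1 z2 hz2 h1 h2
          rw [hy z1 (Finset.mem_sdiff.1 hz1).1 h1, hy z2 (Finset.mem_sdiff.1 hz2).1 h2]
      · push Not at hb
        exact ((sub v hv z _ subset_rfl).of_isolated_edge hv hzS hvz hb hy).mono (by norm_num)
  · push Not at hz
    exact ((ih _ (Finset.erase_ssubset hv)).of_isolated hv hz).mono (by norm_num)

variable [DecidableRel G.Adj]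

lemma excessLE_of_triangle (hdeg : ∀ v, G.degree v ≤ 3) {S : Finset V}
    (ih : ∀ S' ⊂ S, ExcessLE G S' 0) {v a b : V} (hv : v ∈ S) (ha : a ∈ S) (hb : b ∈ S)
    (hva : G.Adj v a) (hvb : G.Adj v b) (hab : G.Adj a b) : ExcessLE G S 0 := by
  have sub : ∀ S' ⊆ S \ {a, b}, ExcessLE G S' 0 := fun S' hS' =>
    ih S' ((Finset.ssubset_iff_of_subset (hS'.trans Finset.sdiff_subset)).2
      ⟨a, ha, fun hxS' => by simpa using hS' hxS'⟩)
  refine ((ExcessLE.of_pendant_vertex sub (v := v) ?_ ?_).of_edge ha hb hab).mono (by norm_num)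
  · simp [hv, hva.ne, hvb.ne]
  · intro z hz z' hz' h h'
    simp only [Finset.mem_sdiff, Finset.mem_insert, Finset.mem_singleton, not_or] at hz hz'
    have := eq_or_eq_or_eq_of_adj hdeg hva hvb h hab.ne (Ne.symm hz.2.1) (Ne.symm hz.2.2) h'
    tauto

/-- The case of a `K_{3,3}` minus the edge `cw`, with parts `{u, v, w}` and `{a, b, c}`. -/
lemma excessLE_of_completeBipartite_delete_edge (hdeg : ∀ v, G.degree v ≤ 3) {S : Finset V}
    (ih : ∀ S' ⊂ S, ExcessLE G S' 0)
    (hcub : ∀ v ∈ S, ∀ a b, ∃ z ∈ S, G.Adj v z ∧ z ≠ a ∧ z ≠ b)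
    (htri : ∀ x ∈ S, ∀ y ∈ S, ∀ z ∈ S, G.Adj x y → G.Adj x z → ¬ G.Adj y z)
    {u v w a b c : V} (hu : u ∈ S) (hv : v ∈ S) (hw : w ∈ S) (ha : a ∈ S) (hb : b ∈ S) (hc : c ∈ S)
    (huv : u ≠ v) (hab : a ≠ b) (hac : a ≠ c) (hbc : b ≠ c) (hwu : w ≠ u) (hwv : w ≠ v)
    (hua : G.Adj u a) (hub : G.Adj u b) (huc : G.Adj u c)
    (hva : G.Adj v a) (hvb : G.Adj v b) (hvc : G.Adj v c)
    (hwa : G.Adj w a) (hwb : G.Adj w b) (hwc : ¬ G.Adj w c) : ExcessLE G S 0 := by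
  obtain ⟨e, he, hce, heu, hev⟩ := hcub c hc u v
  have hew : e ≠ w := by rintro rfl; exact hwc hce.symm
  have hea : e ≠ a := by rintro rfl; exact htri u hu c hc e he huc hua hce
  have heb : e ≠ b := by rintro rfl; exact htri u hu c hc e he huc hub hce
  obtain ⟨d, hd, hed, hdc, hdw⟩ := hcub e he c w
  have hdu : d ≠ u := by
    rintro rfl
    have := eq_or_eq_or_eq_of_adj hdeg hua hub huc hab hac hbc hed.symm
    have := hce.ne
    grind
  have hdv : d ≠ v := by
    rintro rfl
    have := eq_or_eq_or_eq_of_adj hdeg hva hvb hvc hab hac hbc hed.symm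
    have := hce.ne
    grind
  have hda : d ≠ a := by
    rintro rfl
    have := eq_or_eq_or_eq_of_adj hdeg hua.symm hva.symm hwa.symm huv hwu.symm hwv.symm hed.symm
    grind
  have hdb : d ≠ b := by
    rintro rfl
    have := eq_or_eq_or_eq_of_adj hdeg hub.symm hvb.symm hwb.symm huv hwu.symm hwv.symm hed.symm
    grind
  have hcw : c ≠ w := by rintro rfl; exact htri u hu c hc a ha huc hua hwa
  have hub' := hub.ne
  have huc' := huc.ne
  have hva' := hva.ne
  have hvc' := hvc.ne
  have hce' := hce.ne
  have hwa' := hwa.ne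
  have hwb' := hwb.ne
  have sub : ∀ S' ⊆ ((S \ {u, a}) \ {v, b}) \ {e, d}, ExcessLE G S' 0 := fun S' hS' =>
    ih S' ((Finset.ssubset_iff_of_subset (fun z hz => by
      have := hS' hz
      simp only [Finset.mem_sdiff] at this
      tauto)).2 ⟨u, hu, fun hxS' => by simpa using hS' hxS'⟩)
  have h1 : ExcessLE G ((((S \ {u, a}) \ {v, b}) \ {e, d}).erase c) (-2) := by
    refine ExcessLE.of_pendant_vertex (fun S' hS' => sub S' (hS'.trans (Finset.erase_subset _ _)))
      (v := w) ?_ ?_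
    · simp [hw, hwu, hwv, hwa', hwb', hcw.symm, hew.symm, hdw.symm]
    · intro z hz z' hz' h h'
      simp only [Finset.mem_sdiff, Finset.mem_insert, Finset.mem_singleton, not_or,
        Finset.mem_erase] at hz hz'
      have := eq_or_eq_or_eq_of_adj hdeg hwa hwb h hab (by grind) (by grind) h'
      grind
  have h2 := h1.of_isolated (v := c) (by
    simp [hc, huc'.symm, hac.symm, hvc'.symm, hbc.symm, hce', hdc.symm]) (fun z hz h => by
      have := eq_or_eq_or_eq_of_adj hdeg huc.symm hvc.symm hce huv heu.symm hev.symm h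
      simp only [Finset.mem_sdiff, Finset.mem_insert, Finset.mem_singleton, not_or] at hz
      grind)
  have h3 := h2.of_edge (by simp [he, heu, hev, hea, heb]) (by simp [hd, hdu, hdv, hda, hdb]) hed
  have h4 := h3.of_edge (by simp [hv, huv.symm, hva']) (by simp [hb, hub'.symm, hab.symm]) hvb
  exact (h4.of_edge hu ha hua).mono (by norm_num)

lemma excessLE_of_completeBipartite_two_three (hdeg : ∀ v, G.degree v ≤ 3)
    (hK : ∀ p q : Fin 3 → V, p.Injective → q.Injective → ∃ i j, ¬ G.Adj (p i) (q j))
    {S : Finset V} (ih : ∀ S' ⊂ S, ExcessLE G S' 0)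
    (hcub : ∀ v ∈ S, ∀ a b, ∃ z ∈ S, G.Adj v z ∧ z ≠ a ∧ z ≠ b)
    (htri : ∀ x ∈ S, ∀ y ∈ S, ∀ z ∈ S, G.Adj x y → G.Adj x z → ¬ G.Adj y z)
    {u v a b c : V} (hu : u ∈ S) (hv : v ∈ S) (ha : a ∈ S) (hb : b ∈ S) (hc : c ∈ S)
    (huv : u ≠ v) (hab : a ≠ b) (hac : a ≠ c) (hbc : b ≠ c)
    (hua : G.Adj u a) (hub : G.Adj u b) (huc : G.Adj u c)
    (hva : G.Adj v a) (hvb : G.Adj v b) (hvc : G.Adj v c) : ExcessLE G S 0 := by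
  obtain ⟨a', ha', haa, hau, hav⟩ := hcub a ha u v
  obtain ⟨b', hb', hbb, hbu, hbv⟩ := hcub b hb u v
  obtain ⟨c', hc', hcc, hcu, hcv⟩ := hcub c hc u v
  have inj : ∀ {x y z : V}, x ≠ y → x ≠ z → y ≠ z → Function.Injective ![x, y, z] := by
    intro x y z hxy hxz hyz i j hij
    fin_cases i <;> fin_cases j <;> simp_all
  have hK' : ∀ w, w ≠ u → w ≠ v → ¬ (G.Adj w a ∧ G.Adj w b ∧ G.Adj w c) := by
    rintro w hwu hwv ⟨hwa, hwb, hwc⟩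
    obtain ⟨i, j, hij⟩ := hK ![u, v, w] ![a, b, c] (inj huv hwu.symm hwv.symm) (inj hab hac hbc)
    fin_cases i <;> fin_cases j <;> simp_all
  by_cases h1 : a' = b'
  · subst h1
    exact excessLE_of_completeBipartite_delete_edge hdeg ih hcub htri hu hv ha' ha hb hc huv
      hab hac hbc hau hav hua hub huc hva hvb hvc haa.symm hbb.symm
      (fun h => hK' a' hau hav ⟨haa.symm, hbb.symm, h⟩)
  by_cases h2 : a' = c'
  · subst h2
    exact excessLE_of_completeBipartite_delete_edge hdeg ih hcub htri hu hv ha' ha hc hb huv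
      hac hab hbc.symm hau hav hua huc hub hva hvc hvb haa.symm hcc.symm
      (fun h => hK' a' hau hav ⟨haa.symm, h, hcc.symm⟩)
  by_cases h3 : b' = c'
  · subst h3
    exact excessLE_of_completeBipartite_delete_edge hdeg ih hcub htri hu hv hb' hb hc ha huv
      hbc hab.symm hac.symm hbu hbv hub huc hua hvb hvc hva hbb.symm hcc.symm
      (fun h => hK' b' hbu hbv ⟨h, hbb.symm, hcc.symm⟩)
  have hnab := htri u hu a ha b hb hua hub
  have hnac := htri u hu a ha c hc hua huc
  have hnbc := htri u hu b hb c hc hub huc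
  have hab' : b' ≠ a := by rintro rfl; exact hnab hbb.symm
  have hac' : c' ≠ a := by rintro rfl; exact hnac hcc.symm
  have hba' : a' ≠ b := by rintro rfl; exact hnab haa
  have hbc' : c' ≠ b := by rintro rfl; exact hnbc hcc.symm
  have hca' : a' ≠ c := by rintro rfl; exact hnac haa
  have hcb' : b' ≠ c := by rintro rfl; exact hnbc hbb
  have h0 : ExcessLE G (((((S \ {a, a'}) \ {b, b'}) \ {c, c'}).erase v).erase u) 0 := by
    refine ih _ ((Finset.ssubset_iff_of_subset (fun z hz => ?_)).2 ⟨u, hu, by simp⟩)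
    simp only [Finset.mem_sdiff, Finset.mem_erase] at hz
    tauto
  have h1 := h0.of_isolated (by
      simp [hu, huv, hua.ne, hub.ne, huc.ne, hau.symm, hbu.symm, hcu.symm]) (fun z hz h => by
    have := eq_or_eq_or_eq_of_adj hdeg hua hub huc hab hac hbc h
    simp only [Finset.mem_sdiff, Finset.mem_insert, Finset.mem_singleton, not_or,
      Finset.mem_erase] at hz
    grind)
  have h2 := h1.of_isolated (by
      simp [hv, hva.ne, hvb.ne, hvc.ne, hav.symm, hbv.symm, hcv.symm]) (fun z hz h => by
    have := eq_or_eq_or_eq_of_adj hdeg hva hvb hvc hab hac hbc h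
    simp only [Finset.mem_sdiff, Finset.mem_insert, Finset.mem_singleton, not_or] at hz
    grind)
  have h3 := h2.of_edge (by simp_all [Ne.symm]) (by simp_all [Ne.symm, eq_comm]) hcc
  have h4 := h3.of_edge (by simp_all [Ne.symm]) (by simp_all [Ne.symm, eq_comm]) hbb
  exact (h4.of_edge ha ha' haa).mono (by norm_num)

end Reduction

section Cycle

variable {V : Type*} {G : SimpleGraph V}

/-- `p 0, …, p (n - 1)` is a cycle of `G` with all vertices in `S`. -/
structure IsCycleOn (G : SimpleGraph V) (S : Finset V) (n : ℕ) (p : ℕ → V) : Prop where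
  three_le : 3 ≤ n
  mem : ∀ i < n, p i ∈ S
  adj : ∀ i, i + 1 < n → G.Adj (p i) (p (i + 1))
  adj_zero : G.Adj (p (n - 1)) (p 0)
  inj : ∀ i < n, ∀ j < n, p i = p j → i = j

/-- `p 0, …, p n` is a path of `G` with all vertices in `S`. -/
structure IsPathOn (G : SimpleGraph V) (S : Finset V) (n : ℕ) (p : ℕ → V) : Prop where
  mem : ∀ i ≤ n, p i ∈ S
  adj : ∀ i < n, G.Adj (p i) (p (i + 1))
  inj : ∀ i ≤ n, ∀ j ≤ n, p i = p j → i = j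

lemma IsPathOn.lt_card {S : Finset V} {n : ℕ} {p : ℕ → V} (h : IsPathOn G S n p) : n < #S := by
  have := Finset.card_le_card_of_injOn (s := Finset.range (n + 1)) (t := S) p
    (fun i hi => h.mem i (by simp at hi; omega))
    (fun i hi j hj => h.inj i (by simp at hi; omega) j (by simp at hj; omega))
  simpa using this

lemma exists_isCycleOn {S : Finset V} (hne : S.Nonempty)
    (hcub : ∀ v ∈ S, ∀ a b, ∃ z ∈ S, G.Adj v z ∧ z ≠ a ∧ z ≠ b) : ∃ n p, IsCycleOn G S n p := by
  obtain ⟨v, hv⟩ := hne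
  obtain ⟨n, ⟨p, hp⟩, hmax⟩ : ∃ n, (∃ p, IsPathOn G S n p) ∧ ¬ ∃ p, IsPathOn G S (n + 1) p := by
    by_contra! hcon
    have : ∀ n, ∃ p, IsPathOn G S n p := by
      intro n
      induction n with
      | zero => exact ⟨fun _ => v, ⟨fun _ _ => hv, by simp, by intros; omega⟩⟩
      | succ n ih => exact hcon n ih
    obtain ⟨p, hp⟩ := this #S
    exact hp.lt_card.false
  obtain ⟨z, hz, hpz, hz1, -⟩ := hcub (p n) (hp.mem n le_rfl) (p (n - 1)) (p n)
  obtain ⟨j, hj, rfl⟩ : ∃ j ≤ n, p j = z := by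
    by_contra! hcon
    refine hmax ⟨fun i => if i ≤ n then p i else z, ⟨fun i hi => ?_, fun i hi => ?_, ?_⟩⟩
    · split_ifs with h
      exacts [hp.mem i h, hz]
    · rcases (Nat.lt_succ_iff.1 hi).lt_or_eq with h | rfl
      · rw [if_pos h.le, if_pos (by omega)]
        exact hp.adj i h
      · simpa using hpz
    · intro i hi j hj hij
      split_ifs at hij with h1 h2 h2
      · exact hp.inj i h1 j h2 hij
      · exact absurd hij (hcon i h1)
      · exact absurd hij.symm (hcon j h2)
      · omega
  have hjn : j ≠ n := by rintro rfl; exact hpz.ne rfl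
  have hjn' : j ≠ n - 1 := by rintro rfl; exact hz1 rfl
  refine ⟨n - j + 1, fun i => p (j + i), by omega, fun i hi => hp.mem _ (by omega),
    fun i hi => hp.adj (j + i) (by omega), ?_, fun i hi i' hi' h => ?_⟩
  · have : j + (n - j + 1 - 1) = n := by omega
    simpa only [this, add_zero] using hpz
  · have := hp.inj _ (by omega) _ (by omega) h
    omega

lemma IsCycleOn.exists_four {S : Finset V} {a b c d : V} (ha : a ∈ S) (hb : b ∈ S) (hc : c ∈ S)
    (hd : d ∈ S) (hab : G.Adj a b) (hbc : G.Adj b c) (hcd : G.Adj c d) (hda : G.Adj d a)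
    (hac : a ≠ c) (hbd : b ≠ d) : ∃ p, IsCycleOn G S 4 p := by
  have h1 := hab.ne
  have h2 := hbc.ne
  have h3 := hcd.ne
  have h4 := hda.ne
  refine ⟨fun i => if i = 0 then a else if i = 1 then b else if i = 2 then c else d,
    by norm_num, fun i hi => ?_, fun i hi => ?_, by simpa using hda, fun i hi j hj => ?_⟩
  · interval_cases i <;> simp_all
  · have : i < 3 := by omega
    interval_cases i <;> simp_all
  · interval_cases i <;> interval_cases j <;> simp_all [eq_comm]

lemma IsCycleOn.eq_of_adj {S : Finset V} {n : ℕ} {p : ℕ → V} (hp : IsCycleOn G S n p)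
    (hmin : ∀ m q, IsCycleOn G S m q → n ≤ m) {i j : ℕ} (hij : i < j) (hj : j < n)
    (hadj : G.Adj (p i) (p j)) : j = i + 1 ∨ i = 0 ∧ j = n - 1 := by
  by_contra hcon
  have := hmin (j - i + 1) (fun m => p (i + m)) ⟨by omega, fun m hm => hp.mem _ (by omega),
    fun m hm => hp.adj (i + m) (by omega), by
      have : i + (j - i + 1 - 1) = j := by omega
      simpa only [this, add_zero] using hadj.symm, fun m hm m' hm' h => by
      have := hp.inj _ (by omega) _ (by omega) h
      omega⟩
  omega

lemma IsCycleOn.le_of_common_neighbor {S : Finset V} {n : ℕ} {p : ℕ → V}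
    (hp : IsCycleOn G S n p) (hmin : ∀ m q, IsCycleOn G S m q → n ≤ m) {i j : ℕ} (hij : i < j)
    (hj : j < n) {w : V} (hw : w ∈ S) (hwp : ∀ m < n, p m ≠ w) (hi' : G.Adj (p i) w)
    (hj' : G.Adj (p j) w) : n ≤ j - i + 2 := by
  refine hmin (j - i + 2) (fun m => if m ≤ j - i then p (i + m) else w)
    ⟨by omega, fun m hm => ?_, fun m hm => ?_, ?_, fun m hm m' hm' h => ?_⟩
  · split_ifs
    exacts [hp.mem _ (by omega), hw]
  · rw [if_pos (by omega)]
    split_ifs with h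
    · exact hp.adj (i + m) (by omega)
    · have : i + m = j := by omega
      rwa [this]
  · simpa using hi'.symm
  · split_ifs at h with h1 h2 h2
    · have := hp.inj _ (by omega) _ (by omega) h
      omega
    · exact absurd h (hwp _ (by omega))
    · exact absurd h.symm (hwp _ (by omega))
    · omega

variable [Fintype V] [DecidableEq V] [DecidableRel G.Adj]

/-- The case of a cycle `p` whose vertices have pairwise distinct neighbours `w i` outside `p`. -/
lemma IsCycleOn.excessLE (hdeg : ∀ v, G.degree v ≤ 3) {S : Finset V}
    (ih : ∀ S' ⊂ S, ExcessLE G S' 0) {n : ℕ} {p w : ℕ → V} (hp : IsCycleOn G S n p)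
    (hwS : ∀ i < n, w i ∈ S) (hpw : ∀ i < n, G.Adj (p i) (w i))
    (hwp : ∀ i < n, ∀ j < n, p j ≠ w i) (hww : ∀ i < n, ∀ j < n, w i = w j → i = j) :
    ExcessLE G S 0 := by
  have h3 := hp.three_le
  obtain ⟨k, hk⟩ : ∃ k, n = 2 * k ∨ n = 2 * k + 1 := ⟨n / 2, by omega⟩
  have hpne : ∀ i < n, ∀ j < n, i ≠ j → p i ≠ p j := fun i hi j hj hij h => hij (hp.inj i hi j hj h)
  let y : ℕ → V := fun i => if 2 * i + 3 = n then p (2 * i + 2) else w (2 * i + 1)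
  have hy1 : ∀ i, 2 * i + 3 = n → y i = p (2 * i + 2) := fun i hi => if_pos hi
  have hy2 : ∀ i, 2 * i + 3 ≠ n → y i = w (2 * i + 1) := fun i hi => if_neg hi
  have hpy : ∀ j < n, ∀ i < k, (2 * i + 3 = n → j ≠ 2 * i + 2) → p j ≠ y i := by
    intro j hj i hi hji
    by_cases h : 2 * i + 3 = n
    · rw [hy1 i h]
      exact hpne _ hj _ (by omega) (hji h)
    · rw [hy2 i h]
      exact hwp _ (by omega) _ hj
  have key := ExcessLE.of_matching (G := G) (S := S) (k := k) (t := -(2 * k))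
    (x := fun i => p (2 * i + 1)) (y := y)
    (fun i hi => hp.mem _ (by omega))
    (fun i hi => by
      by_cases h : 2 * i + 3 = n
      · rw [hy1 i h]
        exact hp.mem _ (by omega)
      · rw [hy2 i h]
        exact hwS _ (by omega))
    (fun i hi => by
      by_cases h : 2 * i + 3 = n
      · rw [hy1 i h]
        exact hp.adj _ (by omega)
      · rw [hy2 i h]
        exact hpw _ (by omega))
    (fun i hi j hj h => by
      have := hp.inj _ (by omega) _ (by omega) h
      omega)
    (fun i hi j hj h => by
      by_cases h1 : 2 * i + 3 = n
      · rw [hy1 i h1] at h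
        by_contra hne
        exact hpy _ (by omega) j hj (by omega) h
      · by_cases h2 : 2 * j + 3 = n
        · rw [hy1 j h2] at h
          by_contra hne
          exact hpy _ (by omega) i hi (by omega) h.symm
        · rw [hy2 i h1, hy2 j h2] at h
          have := hww _ (by omega) _ (by omega) h
          omega)
    (fun i hi j hj => hpy _ (by omega) j hj (by omega))
    (by
      refine ExcessLE.of_pendant (t := fun i => p (2 * i)) (c := fun i => w (2 * i))
        ?_ ?_ ?_ ?_ ?_ ?_
      · intro S' hS'
        refine ih S' ((Finset.ssubset_iff_of_subset (hS'.trans (Finset.filter_subset _ _))).2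
          ⟨p 1, hp.mem 1 (by omega), fun h => ?_⟩)
        exact ((Finset.mem_filter.1 (hS' h)).2 0 (by omega)).1 rfl
      · intro i hi
        refine Finset.mem_filter.2 ⟨hp.mem _ (by omega), fun j hj => ⟨?_, ?_⟩⟩
        · exact hpne _ (by omega) _ (by omega) (by omega)
        · exact hpy _ (by omega) j hj (by omega)
      · intro i hi j hj h
        have := hp.inj _ (by omega) _ (by omega) h
        omega
      · intro i hi z hz hadj
        obtain ⟨hzS, hz⟩ := Finset.mem_filter.1 hz
        have hsucc := hp.adj (2 * i) (by omega)
        have hzs : z ≠ p (2 * i + 1) := (hz i hi).1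
        obtain ⟨m, hm, hmne, hmadj, hzm⟩ :
            ∃ m < n, m ≠ 2 * i + 1 ∧ G.Adj (p (2 * i)) (p m) ∧ z ≠ p m := by
          rcases Nat.eq_zero_or_pos i with rfl | hi0
          · refine ⟨n - 1, by omega, by omega, hp.adj_zero.symm, ?_⟩
            rcases hk with hk | hk
            · have := (hz (k - 1) (by omega)).1
              rwa [show 2 * (k - 1) + 1 = n - 1 by omega] at this
            · have := (hz (k - 1) (by omega)).2
              rwa [hy1 _ (by omega), show 2 * (k - 1) + 2 = n - 1 by omega] at this
          · refine ⟨2 * i - 1, by omega, by omega, ?_, ?_⟩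
            · have := hp.adj (2 * i - 1) (by omega)
              rw [show 2 * i - 1 + 1 = 2 * i by omega] at this
              exact this.symm
            · have := (hz (i - 1) (by omega)).1
              rwa [show 2 * (i - 1) + 1 = 2 * i - 1 by omega] at this
        have := eq_or_eq_or_eq_of_adj hdeg hsucc hmadj (hpw (2 * i) (by omega))
          (hpne _ (by omega) _ hm hmne.symm) (hwp _ (by omega) _ (by omega))
          (hwp _ (by omega) _ hm) hadj
        tauto
      · intro i hi j hj h
        have := hww _ (by omega) _ (by omega) h
        omega
      · intro i hi j hj
        exact (hwp _ (by omega) _ (by omega)).symm)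
  exact key.mono (by linarith)

lemma excessLE_zero (hdeg : ∀ v, G.degree v ≤ 3)
    (hK : ∀ p q : Fin 3 → V, p.Injective → q.Injective → ∃ i j, ¬ G.Adj (p i) (q j))
    (S : Finset V) : ExcessLE G S 0 := by
  induction S using Finset.strongInduction with | H S ih
  rcases S.eq_empty_or_nonempty with rfl | hne
  · exact excessLE_empty
  by_cases hcub : ∀ v ∈ S, ∀ a b, ∃ z ∈ S, G.Adj v z ∧ z ≠ a ∧ z ≠ b
  swap
  · push Not at hcub
    obtain ⟨v, hv, a, b, h⟩ := hcub
    exact excessLE_of_degree_le_two ih hv (fun z hz hvz => by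
      have := h z hz hvz
      tauto)
  by_cases htri : ∀ x ∈ S, ∀ y ∈ S, ∀ z ∈ S, G.Adj x y → G.Adj x z → ¬ G.Adj y z
  swap
  · push Not at htri
    obtain ⟨x, hx, y, hy, z, hz, hxy, hxz, hyz⟩ := htri
    exact excessLE_of_triangle hdeg ih hx hy hz hxy hxz hyz
  by_cases hK23 : ∃ u ∈ S, ∃ v ∈ S, ∃ a ∈ S, ∃ b ∈ S, ∃ c ∈ S, u ≠ v ∧ a ≠ b ∧ a ≠ c ∧ b ≠ c ∧
      G.Adj u a ∧ G.Adj u b ∧ G.Adj u c ∧ G.Adj v a ∧ G.Adj v b ∧ G.Adj v c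
  · obtain ⟨u, hu, v, hv, a, ha, b, hb, c, hc, huv, hab, hac, hbc, h1, h2, h3, h4, h5, h6⟩ := hK23
    exact excessLE_of_completeBipartite_two_three hdeg hK ih hcub htri hu hv ha hb hc huv hab hac
      hbc h1 h2 h3 h4 h5 h6
  classical
  have hex : ∃ n, ∃ p, IsCycleOn G S n p := exists_isCycleOn hne hcub
  obtain ⟨p, hp⟩ := Nat.find_spec hex
  have hmin : ∀ m q, IsCycleOn G S m q → Nat.find hex ≤ m := fun m q hq =>
    Nat.find_min' hex ⟨q, hq⟩
  generalize Nat.find hex = n at hp hmin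
  have h3 := hp.three_le
  have h4 : 4 ≤ n := by
    by_contra h
    obtain rfl : n = 3 := by omega
    exact htri _ (hp.mem 0 (by omega)) _ (hp.mem 1 (by omega)) _ (hp.mem 2 (by omega))
      (hp.adj 0 (by omega)) hp.adj_zero.symm (hp.adj 1 (by omega))
  have hind : ∀ i j, i < j → j < n → G.Adj (p i) (p j) → j = i + 1 ∨ i = 0 ∧ j = n - 1 :=
    fun i j hij hj h => hp.eq_of_adj hmin hij hj h
  have hw : ∀ i, ∃ w, i < n → w ∈ S ∧ G.Adj (p i) w ∧ ∀ j < n, p j ≠ w := by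
    intro i
    by_cases hi : i < n
    · obtain ⟨w, hw, hadj, h1, h2⟩ := hcub (p i) (hp.mem i hi)
        (p (if i = 0 then n - 1 else i - 1)) (p (if i + 1 = n then 0 else i + 1))
      refine ⟨w, fun _ => ⟨hw, hadj, ?_⟩⟩
      rintro j hj rfl
      have hij : i ≠ j := by rintro rfl; exact hadj.ne rfl
      rcases hij.lt_or_gt with hlt | hlt
      · rcases hind i j hlt hj hadj with rfl | ⟨rfl, rfl⟩
        · rw [if_neg (by omega)] at h2
          exact h2 rfl
        · simp at h1
      · rcases hind j i hlt hi hadj.symm with rfl | ⟨rfl, rfl⟩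
        · rw [if_neg (by omega)] at h1
          exact h1 rfl
        · rw [if_pos (by omega)] at h2
          exact h2 rfl
    · exact ⟨p 0, fun h => absurd h hi⟩
  choose w hw using hw
  have hlt : ∀ i j, i < j → j < n → w i ≠ w j := by
    intro i j hij hj h
    obtain ⟨hwS, hiw, hwp⟩ := hw i (by omega)
    have hjw : G.Adj (p j) (w i) := h ▸ (hw j hj).2.1
    have hle := hp.le_of_common_neighbor hmin hij hj hwS hwp hiw hjw
    have hlast : G.Adj (p (n - 1)) (p 0) := hp.adj_zero
    have hpair : ∀ a b c, a < n → b < n → c < n → a ≠ b → G.Adj (p a) (p c) → G.Adj (p b) (p c) →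
        G.Adj (p a) (w i) → G.Adj (p b) (w i) → n = 4 := by
      intro a b c ha hb hc hab hac hbc haw hbw
      obtain ⟨q, hq⟩ := IsCycleOn.exists_four (hp.mem a ha) (hp.mem c hc) (hp.mem b hb) hwS
        hac hbc.symm hbw haw.symm (fun h => hab (hp.inj a ha b hb h)) (hwp c hc)
      have := hmin 4 q hq
      omega
    have hne : ∀ a < n, ∀ b < n, a ≠ b → p a ≠ p b := fun a ha b hb hab h =>
      hab (hp.inj a ha b hb h)
    obtain ⟨rfl, rfl⟩ | ⟨rfl, rfl⟩ | ⟨rfl, rfl⟩ : (i = 0 ∧ j = n - 1) ∨ (i = 0 ∧ j = n - 2) ∨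
        (i = 1 ∧ j = n - 1) := by omega
    · exact htri _ (hp.mem _ (by omega)) _ (hp.mem _ hj) _ hwS hlast.symm hiw hjw
    · have h2 := hp.adj (n - 2) (by omega)
      rw [show n - 2 + 1 = n - 1 by omega] at h2
      obtain rfl := hpair 0 (n - 2) (n - 1) (by omega) (by omega) (by omega) (by omega)
        hlast.symm h2 hiw hjw
      exact hK23 ⟨p 0, hp.mem _ (by omega), p 2, hp.mem _ (by omega), p 1, hp.mem _ (by omega),
        p 3, hp.mem _ (by omega), w 0, hwS, hne _ (by omega) _ (by omega) (by omega),
        hne _ (by omega) _ (by omega) (by omega), hwp _ (by omega), hwp _ (by omega),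
        hp.adj 0 (by omega), hlast.symm, hiw, (hp.adj 1 (by omega)).symm, h2, hjw⟩
    · obtain rfl := hpair 1 (n - 1) 0 (by omega) (by omega) (by omega) (by omega)
        (hp.adj 0 (by omega)).symm hlast hiw hjw
      exact hK23 ⟨p 1, hp.mem _ (by omega), p 3, hp.mem _ (by omega), p 0, hp.mem _ (by omega),
        p 2, hp.mem _ (by omega), w 1, hwS, hne _ (by omega) _ (by omega) (by omega),
        hne _ (by omega) _ (by omega) (by omega), hwp _ (by omega), hwp _ (by omega),
        (hp.adj 0 (by omega)).symm, hp.adj 1 (by omega), hiw, hlast,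
        (hp.adj 2 (by omega)).symm, hjw⟩
  refine hp.excessLE hdeg ih (fun i hi => (hw i hi).1) (fun i hi => (hw i hi).2.1)
    (fun i hi => (hw i hi).2.2) (fun i hi j hj h => ?_)
  by_contra hne
  rcases Ne.lt_or_gt hne with h' | h'
  · exact hlt i j h' hj h
  · exact hlt j i h' hi h.symm

end Cycle

/-- In a subcubic graph, every subgraph isomorphic to `K_{3,3}` is a connected component. -/
lemma exists_connectedComponent_iso_completeBipartiteGraph {V : Type*} [Fintype V] [DecidableEq V]
    (G : SimpleGraph V) [DecidableRel G.Adj] (hdeg : ∀ v, G.degree v ≤ 3) {p q : Fin 3 → V}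
    (hp : p.Injective) (hq : q.Injective) (hpq : ∀ i j, G.Adj (p i) (q j)) :
    ∃ c : G.ConnectedComponent,
      Nonempty (G.induce c.supp ≃g completeBipartiteGraph (Fin 3) (Fin 3)) := by
  have hpn : ∀ i z, G.Adj (p i) z → ∃ j, q j = z := by
    intro i z hz
    have := eq_or_eq_or_eq_of_adj hdeg (hpq i 0) (hpq i 1) (hpq i 2)
      (hq.ne (by decide)) (hq.ne (by decide)) (hq.ne (by decide)) hz
    rcases this with h | h | h <;> exact ⟨_, h.symm⟩
  have hqn : ∀ i z, G.Adj (q i) z → ∃ j, p j = z := by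
    intro i z hz
    have := eq_or_eq_or_eq_of_adj hdeg (hpq 0 i).symm (hpq 1 i).symm (hpq 2 i).symm
      (hp.ne (by decide)) (hp.ne (by decide)) (hp.ne (by decide)) hz
    rcases this with h | h | h <;> exact ⟨_, h.symm⟩
  have hdisj : ∀ i j, p i ≠ q j := fun i j => (hpq i j).ne
  have hpp : ∀ i j, ¬ G.Adj (p i) (p j) := fun i j h => by
    obtain ⟨k, hk⟩ := hpn i _ h
    exact hdisj _ _ hk.symm
  have hqq : ∀ i j, ¬ G.Adj (q i) (q j) := fun i j h => by
    obtain ⟨k, hk⟩ := hqn i _ h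
    exact hdisj _ _ hk
  let φ : Fin 3 ⊕ Fin 3 → V := Sum.elim p q
  have hreach : ∀ s, G.Reachable (φ s) (p 0) := by
    rintro (i | i)
    · exact (hpq i 0).reachable.trans (hpq 0 0).symm.reachable
    · exact (hpq 0 i).symm.reachable
  have hclosed : ∀ z, G.Reachable (p 0) z → ∃ s, φ s = z := by
    rintro z ⟨W⟩
    suffices ∀ x y (W : G.Walk x y), (∃ s, φ s = x) → ∃ s, φ s = y from this _ _ W ⟨.inl 0, rfl⟩
    intro x y W
    induction W with
    | nil => exact id
    | cons h _ ih =>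
      rintro ⟨i | i, rfl⟩
      · obtain ⟨j, rfl⟩ := hpn i _ h
        exact ih ⟨.inr j, rfl⟩
      · obtain ⟨j, rfl⟩ := hqn i _ h
        exact ih ⟨.inl j, rfl⟩
  have hφ : φ.Injective := by
    rintro (i | i) (j | j) h
    · exact congrArg _ (hp h)
    · exact absurd h (hdisj _ _)
    · exact absurd h.symm (hdisj _ _)
    · exact congrArg _ (hq h)
  let c := G.connectedComponentMk (p 0)
  let ψ : Fin 3 ⊕ Fin 3 → c.supp := fun s =>
    ⟨φ s, ConnectedComponent.eq.2 (hreach s)⟩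
  have hψ : ψ.Bijective := by
    refine ⟨fun s t h => hφ (congrArg Subtype.val h), fun ⟨z, hz⟩ => ?_⟩
    obtain ⟨s, hs⟩ := hclosed z (ConnectedComponent.eq.1 hz).symm
    exact ⟨s, Subtype.ext hs⟩
  refine ⟨c, ⟨RelIso.symm ⟨Equiv.ofBijective ψ hψ, ?_⟩⟩⟩
  rintro (i | i) (j | j)
  · simpa [ψ, φ] using hpp i j
  · simpa [ψ, φ] using hpq i j
  · simpa [ψ, φ] using (hpq j i).symm
  · simpa [ψ, φ] using hqq i j

/-- If `G` is a subcubic graph on `n` vertices none of whose connected components is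
isomorphic to `K_{3,3}`, then `γ'_R(G) ≤ (4/5)·n`. -/
theorem edgeRomanNumber_le_of_subcubic {V : Type*} [Fintype V] [DecidableEq V]
    (G : SimpleGraph V) [DecidableRel G.Adj]
    (hdeg : ∀ v, G.degree v ≤ 3)
    (hK33 : ∀ c : G.ConnectedComponent,
      ¬ Nonempty (G.induce c.supp ≃g completeBipartiteGraph (Fin 3) (Fin 3))) :
    (edgeRomanNumber V G : ℝ) ≤ 4 / 5 * Fintype.card V := by
  obtain ⟨f, ⟨h1, h2, h3⟩, hw⟩ : ExcessLE G univ 0 := by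
    refine excessLE_zero hdeg (fun p q hp hq => ?_) univ
    by_contra! hpq
    obtain ⟨c, hc⟩ := exists_connectedComponent_iso_completeBipartiteGraph G hdeg hp hq hpq
    exact hK33 c hc
  have hle : edgeRomanNumber V G ≤ ∑ e, f e := Nat.sInf_le ⟨f, ⟨h1, fun e he => by
    by_contra h
    exact he (h2 e h).1, fun e he h0 => h3 e he (by simp) h0⟩, rfl⟩
  have hw' : 5 * ∑ e, f e ≤ 4 * Fintype.card V := by
    rw [Finset.card_univ] at hw
    push_cast at hw
    exact_mod_cast (add_zero (4 * (Fintype.card V : ℤ))) ▸ hw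
  have : (5 * edgeRomanNumber V G : ℝ) ≤ 4 * Fintype.card V := by exact_mod_cast (by omega)
  linarith
end

section
/- If G is a planar graph on n vertices, then γ'_R(G) ≤ (6/7)·n. (Here planarity may be taken in the Kuratowski form: G contains no subgraph isomorphic to a subdivision of K_5 or of K_{3,3}.) -/
open Finset SimpleGraph

/-- `G` contains a subgraph isomorphic to a subdivision of `H`: there is an injection
`f` of the vertices of `H` (the branch vertices) into `G` and, for each edge of `H`,
a path in `G` between the corresponding branch vertices, such that the only branch
vertices on each such path are its two endpoints, and paths corresponding to distinct
edges of `H` share only branch vertices. -/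
def ContainsSubdivision {V U : Type*} (G : SimpleGraph V) (H : SimpleGraph U) : Prop :=
  ∃ f : U → V, Function.Injective f ∧
    ∃ P : ∀ ⦃u w : U⦄, H.Adj u w → G.Walk (f u) (f w),
      (∀ ⦃u w : U⦄ (h : H.Adj u w), (P h).IsPath) ∧
      (∀ ⦃u w : U⦄ (h : H.Adj u w), ∀ x ∈ (P h).support,
        x ∈ Set.range f → x = f u ∨ x = f w) ∧
      (∀ ⦃u w : U⦄ (h : H.Adj u w) ⦃u' w' : U⦄ (h' : H.Adj u' w'),
        s(u, w) ≠ s(u', w') →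
          ∀ x ∈ (P h).support, x ∈ (P h').support → x ∈ Set.range f)


set_option linter.unusedSectionVars false

section EdgeSets

variable {V E : Type*} [DecidableEq V] [DecidableEq E]

/-- The boundary modulo two of a set `D` of edges of the multigraph with endpoint map `g`. -/
def bdry (g : E → V × V) (D : Finset E) : V → ZMod 2 :=
  ∑ e ∈ D, (Pi.single (g e).1 1 + Pi.single (g e).2 1)

/-- The vertices covered by the edges in `D`. -/
def verts (g : E → V × V) (D : Finset E) : Finset V :=
  D.image (fun e => (g e).1) ∪ D.image (fun e => (g e).2)

/-- Adjacency through an edge in `D`. -/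
def Lnk (g : E → V × V) (D : Finset E) (u v : V) : Prop :=
  ∃ e ∈ D, g e = (u, v) ∨ g e = (v, u)

/-- `v` is an endpoint of `e`. -/
def Inc (g : E → V × V) (e : E) (v : V) : Prop := (g e).1 = v ∨ (g e).2 = v

/-- No nonempty subset of `D` has zero boundary. -/
def Acyc (g : E → V × V) (D : Finset E) : Prop := ∀ D' ⊆ D, bdry g D' = 0 → D' = ∅

variable {g : E → V × V} {D D' : Finset E} {a b v : V}

lemma add_self_vec (f : V → ZMod 2) : f + f = 0 := by
  funext v; exact CharTwo.add_self_eq_zero _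

lemma mem_verts : v ∈ verts g D ↔ ∃ e ∈ D, Inc g e v := by
  simp only [verts, Inc, mem_union, mem_image]
  constructor
  · rintro (⟨e, h, h'⟩ | ⟨e, h, h'⟩)
    exacts [⟨e, h, .inl h'⟩, ⟨e, h, .inr h'⟩]
  · rintro ⟨e, h, h' | h'⟩
    exacts [.inl ⟨e, h, h'⟩, .inr ⟨e, h, h'⟩]

lemma verts_mono (h : D ⊆ D') : verts g D ⊆ verts g D' := by
  intro v hv
  obtain ⟨e, he, hi⟩ := mem_verts.1 hv
  exact mem_verts.2 ⟨e, h he, hi⟩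

lemma verts_union : verts g (D ∪ D') = verts g D ∪ verts g D' := by
  ext v
  simp only [mem_verts, mem_union]
  grind

lemma Lnk.symm (h : Lnk g D a b) : Lnk g D b a := by
  obtain ⟨e, he, h⟩ := h
  exact ⟨e, he, h.symm⟩

lemma Lnk.mono (hD : D ⊆ D') (h : Lnk g D a b) : Lnk g D' a b := by
  obtain ⟨e, he, h⟩ := h
  exact ⟨e, hD he, h⟩

lemma Inc.exists_other {e : E} (h : Inc g e v) : ∃ w, g e = (v, w) ∨ g e = (w, v) := by
  rcases h with h | h
  · exact ⟨(g e).2, .inl (Prod.ext h rfl)⟩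
  · exact ⟨(g e).1, .inr (Prod.ext rfl h)⟩

lemma bdry_empty : bdry g ∅ = 0 := rfl

lemma bdry_singleton (e : E) : bdry g {e} = Pi.single (g e).1 1 + Pi.single (g e).2 1 := by
  simp [bdry]

lemma bdry_singleton_of {e : E} (h : g e = (a, b) ∨ g e = (b, a)) :
    bdry g {e} = Pi.single a 1 + Pi.single b 1 := by
  rw [bdry_singleton]
  rcases h with h | h <;> rw [h]
  exact add_comm _ _

lemma bdry_union (h : Disjoint D D') : bdry g (D ∪ D') = bdry g D + bdry g D' :=
  sum_union h

lemma bdry_sdiff (h : D' ⊆ D) : bdry g (D \ D') = bdry g D + bdry g D' := by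
  have : bdry g (D \ D') + bdry g D' = bdry g D := sum_sdiff h
  rw [← this, add_assoc, add_self_vec, add_zero]

lemma bdry_symmDiff : bdry g (symmDiff D D') = bdry g D + bdry g D' := by
  have h1 : bdry g D = bdry g (D \ D') + bdry g (D ∩ D') := by
    rw [← bdry_union (disjoint_sdiff_inter D D'), sdiff_union_inter]
  have h2 : bdry g D' = bdry g (D' \ D) + bdry g (D ∩ D') := by
    rw [inter_comm, ← bdry_union (disjoint_sdiff_inter D' D), sdiff_union_inter]
  have h3 : bdry g (symmDiff D D') = bdry g (D \ D') + bdry g (D' \ D) :=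
    bdry_union disjoint_sdiff_sdiff
  rw [h1, h2, h3, add_add_add_comm, add_self_vec, add_zero]

lemma bdry_erase {e : E} (he : e ∈ D) (h : g e = (a, b) ∨ g e = (b, a)) :
    bdry g (D.erase e) = bdry g D + (Pi.single a 1 + Pi.single b 1) := by
  rw [← bdry_singleton_of h, ← sdiff_singleton_eq_erase, bdry_sdiff (singleton_subset_iff.2 he)]

lemma bdry_apply_eq_zero (h : v ∉ verts g D) : bdry g D v = 0 := by
  rw [bdry, Finset.sum_apply]
  refine sum_eq_zero fun e he => ?_
  have h1 : ¬ Inc g e v := fun hi => h (mem_verts.2 ⟨e, he, hi⟩)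
  simp only [Inc, not_or] at h1
  simp [Ne.symm h1.1, Ne.symm h1.2]

lemma mem_verts_of_bdry (h : bdry g D v ≠ 0) : v ∈ verts g D := by
  by_contra h'
  exact h (bdry_apply_eq_zero h')

lemma single_add_single_ne (h : a ≠ b) :
    (Pi.single a 1 + Pi.single b 1 : V → ZMod 2) a ≠ 0 := by
  simp [h]

lemma eq_of_single_add_single {a b c : V}
    (h : (Pi.single a 1 + Pi.single b 1 : V → ZMod 2) = Pi.single a 1 + Pi.single c 1) :
    b = c := by
  have h1 := congrFun (add_left_cancel h) b
  by_contra hbc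
  simp [hbc] at h1

lemma eq_of_single_add_single_zero
    (h : (Pi.single a 1 + Pi.single b 1 : V → ZMod 2) = 0) : a = b := by
  by_contra hab
  exact single_add_single_ne hab (congrFun h a)

lemma Acyc.mono (h : Acyc g D) (hD : D' ⊆ D) : Acyc g D' :=
  fun _ h1 h2 => h _ (h1.trans hD) h2

lemma Acyc.eq_of_bdry (h : Acyc g D) (hD : D' ⊆ D) (hb : bdry g D' = bdry g D) : D' = D := by
  have h1 := h (D \ D') sdiff_subset (by rw [bdry_sdiff hD, hb, add_self_vec])
  exact hD.antisymm (sdiff_eq_empty_iff_subset.1 h1)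

lemma Acyc.ne (h : Acyc g D) {e : E} (he : e ∈ D) : (g e).1 ≠ (g e).2 := by
  intro hne
  have := h {e} (singleton_subset_iff.2 he) (by rw [bdry_singleton, hne, add_self_vec])
  simp at this

/-- The edges of `D` starting in a set `X` closed under `D` have the boundary of `D` on `X`. -/
lemma bdry_filter_closed (X : Set V) [DecidablePred (· ∈ X)]
    (hX : ∀ e ∈ D, (g e).1 ∈ X ↔ (g e).2 ∈ X) :
    bdry g (D.filter fun e => (g e).1 ∈ X) v = if v ∈ X then bdry g D v else 0 := by
  simp only [bdry, Finset.sum_apply, sum_filter]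
  split_ifs with hv
  · refine sum_congr rfl fun e he => ?_
    split_ifs with h1
    · rfl
    · have h2 : (g e).2 ∉ X := fun h => h1 ((hX e he).2 h)
      have h3 : v ≠ (g e).1 := fun h => h1 (h ▸ hv)
      have h4 : v ≠ (g e).2 := fun h => h2 (h ▸ hv)
      simp [h3, h4]
  · refine sum_eq_zero fun e he => ?_
    split_ifs with h1
    · have h2 := (hX e he).1 h1
      have h3 : v ≠ (g e).1 := fun h => hv (h ▸ h1)
      have h4 : v ≠ (g e).2 := fun h => hv (h ▸ h2)
      simp [h3, h4]
    · rfl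

lemma sum_bdry [Fintype V] : ∑ v, bdry g D v = 0 := by
  simp only [bdry, Finset.sum_apply]
  rw [sum_comm]
  refine sum_eq_zero fun e _ => ?_
  simp only [Pi.add_apply, sum_add_distrib]
  simp [Pi.single_apply]
  decide

open Relation in
lemma exists_bdry_of_reach (h : ReflTransGen (Lnk g D) a b) :
    ∃ S ⊆ D, bdry g S = Pi.single a 1 + Pi.single b 1 := by
  induction h with
  | refl => exact ⟨∅, empty_subset _, by rw [add_self_vec, bdry_empty]⟩
  | tail _ hl ih =>
    obtain ⟨S, hS, hb⟩ := ih
    obtain ⟨e, he, hg⟩ := hl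
    refine ⟨symmDiff S {e}, ?_, ?_⟩
    · intro x hx
      rw [mem_symmDiff, mem_singleton] at hx
      rcases hx with hx | hx
      exacts [hS hx.1, hx.1 ▸ he]
    · rw [bdry_symmDiff, hb, bdry_singleton_of hg, add_assoc]
      congr 1
      rw [← add_assoc, add_self_vec, zero_add]

/-- The set of vertices reachable from `a` through `D`. -/
def reachSet (g : E → V × V) (D : Finset E) (a : V) : Set V :=
  {v | Relation.ReflTransGen (Lnk g D) a v}

lemma reachSet_closed : ∀ e ∈ D, (g e).1 ∈ reachSet g D a ↔ (g e).2 ∈ reachSet g D a :=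
  fun e he => ⟨fun h => Relation.ReflTransGen.tail h ⟨e, he, .inl rfl⟩,
    fun h => Relation.ReflTransGen.tail h ⟨e, he, .inr rfl⟩⟩

lemma mem_reachSet_self : a ∈ reachSet g D a := Relation.ReflTransGen.refl

/-- A vertex with nonzero boundary reaches another one. -/
lemma exists_reach_of_bdry [Fintype V] (h : bdry g D a ≠ 0) :
    ∃ b ≠ a, bdry g D b ≠ 0 ∧ b ∈ reachSet g D a := by
  classical
  by_contra! hc
  have h1 := sum_bdry (g := g) (D := D.filter fun e => (g e).1 ∈ reachSet g D a)
  rw [sum_eq_single a] at h1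
  · rw [bdry_filter_closed _ reachSet_closed, if_pos mem_reachSet_self] at h1
    exact h h1
  · intro b _ hb
    rw [bdry_filter_closed _ reachSet_closed]
    split_ifs with hr
    · by_contra h0
      exact hc b hb h0 hr
    · rfl
  · simp

lemma reach_of_bdry [Fintype V] (h : bdry g D = Pi.single a 1 + Pi.single b 1) :
    b ∈ reachSet g D a := by
  by_cases hab : a = b
  · exact hab ▸ mem_reachSet_self
  obtain ⟨c, hc, h1, h2⟩ := exists_reach_of_bdry (g := g) (D := D) (a := a)
    (by rw [h]; exact single_add_single_ne hab)
  have : c = b := by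
    by_contra hcb
    rw [h] at h1
    simp [hc, hcb] at h1
  exact this ▸ h2

lemma verts_subset_of_filter (X : Set V) [DecidablePred (· ∈ X)]
    (hX : ∀ e ∈ D, (g e).1 ∈ X ↔ (g e).2 ∈ X) (h : (D.filter fun e => (g e).1 ∈ X) = D)
    (hv : v ∈ verts g D) : v ∈ X := by
  obtain ⟨e, he, hi⟩ := mem_verts.1 hv
  rw [← h] at he
  obtain ⟨he, h1⟩ := mem_filter.1 he
  rcases hi with hi | hi
  exacts [hi ▸ h1, hi ▸ (hX e he).1 h1]

lemma Acyc.reach [Fintype V] (hD : Acyc g D) (h : bdry g D = Pi.single a 1 + Pi.single b 1)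
    (hv : v ∈ verts g D) : v ∈ reachSet g D a := by
  classical
  refine verts_subset_of_filter _ reachSet_closed ?_ hv
  refine hD.eq_of_bdry (filter_subset _ _) ?_
  funext u
  rw [bdry_filter_closed _ reachSet_closed]
  split_ifs with hu
  · rfl
  · have h1 : u ≠ a := fun h => hu (h ▸ mem_reachSet_self)
    have h2 : u ≠ b := fun h' => hu (h' ▸ reach_of_bdry h)
    rw [h]
    simp [h1, h2]

/-- A minimal nonempty edge set with zero boundary. -/
structure Circ (g : E → V × V) (C : Finset E) : Prop where
  nonempty : C.Nonempty
  bdry_eq : bdry g C = 0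
  min : ∀ D ⊆ C, D.Nonempty → bdry g D = 0 → D = C

lemma Circ.acyc {C : Finset E} (hC : Circ g C) (hD : D ⊂ C) : Acyc g D := by
  intro D' h1 h2
  by_contra h3
  have := hC.min D' (h1.trans hD.1) (nonempty_iff_ne_empty.2 h3) h2
  exact hD.2 (this ▸ h1)

lemma Circ.reach {C : Finset E} (hC : Circ g C) (ha : a ∈ verts g C) (hv : v ∈ verts g C) :
    v ∈ reachSet g C a := by
  classical
  refine verts_subset_of_filter _ reachSet_closed (hC.min _ (filter_subset _ _) ?_ ?_) hv
  · obtain ⟨e, he, hi⟩ := mem_verts.1 ha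
    refine ⟨e, mem_filter.2 ⟨he, ?_⟩⟩
    rcases hi with hi | hi
    · rw [hi]; exact mem_reachSet_self
    · rw [reachSet_closed e he, hi]; exact mem_reachSet_self
  · funext u
    rw [bdry_filter_closed _ reachSet_closed, hC.bdry_eq]
    simp

lemma card_verts_le (h : bdry g D = 0) : (verts g D).card ≤ D.card := by
  have h1 : ∀ v ∈ verts g D, 2 ≤ ∑ e ∈ D, ((if v = (g e).1 then 1 else 0) +
      (if v = (g e).2 then 1 else 0)) := by
    intro v hv
    have h2 : ((∑ e ∈ D, ((if v = (g e).1 then 1 else 0) +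
      (if v = (g e).2 then 1 else 0)) : ℕ) : ZMod 2) = 0 := by
      have := congrFun h v
      rw [bdry, Finset.sum_apply] at this
      rw [← Pi.zero_apply (M := fun _ : V => ZMod 2) v, ← this]
      push_cast
      refine sum_congr rfl fun e _ => ?_
      simp [Pi.single_apply]
    rw [ZMod.natCast_eq_zero_iff] at h2
    refine Nat.le_of_dvd ?_ h2
    obtain ⟨e, he, hi⟩ := mem_verts.1 hv
    refine sum_pos' (fun _ _ => Nat.zero_le _) ⟨e, he, ?_⟩
    rcases hi with hi | hi <;> simp [hi]
  have h3 : (verts g D).card * 2 ≤ D.card * 2 :=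
    calc (verts g D).card * 2 = ∑ v ∈ verts g D, 2 := by simp
      _ ≤ ∑ v ∈ verts g D, ∑ e ∈ D, ((if v = (g e).1 then 1 else 0) +
          (if v = (g e).2 then 1 else 0)) := sum_le_sum h1
      _ = ∑ e ∈ D, ∑ v ∈ verts g D, ((if v = (g e).1 then 1 else 0) +
          (if v = (g e).2 then 1 else 0)) := sum_comm
      _ ≤ ∑ e ∈ D, 2 := by
        refine sum_le_sum fun e _ => ?_
        rw [sum_add_distrib, sum_ite_eq', sum_ite_eq']
        split_ifs <;> simp
      _ = D.card * 2 := by simp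
  omega

/-- The map identifying `y` with `x`. -/
def merge (x y v : V) : V := if v = y then x else v

/-- The endpoint map after identifying `y` with `x`. -/
def mergeEnds (g : E → V × V) (x y : V) (e : E) : V × V :=
  (merge x y (g e).1, merge x y (g e).2)

lemma bdry_mergeEnds {x y : V} (hxy : x ≠ y) :
    bdry (mergeEnds g x y) D v =
      if v = y then 0 else if v = x then bdry g D x + bdry g D y else bdry g D v := by
  have key : ∀ a v : V, (Pi.single (merge x y a) 1 : V → ZMod 2) v =
      if v = y then 0 else if v = x then (Pi.single a 1 : V → ZMod 2) x +
        (Pi.single a 1 : V → ZMod 2) y else (Pi.single a 1 : V → ZMod 2) v := by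
    intro a v
    simp only [merge, Pi.single_apply]
    grind
  simp only [bdry, Finset.sum_apply, Pi.add_apply, mergeEnds, key]
  split_ifs
  · simp
  · rw [← sum_add_distrib]
    exact sum_congr rfl fun e _ => add_add_add_comm _ _ _ _
  · rfl

lemma bdry_of_mergeEnds {e : E} (hxy : (g e).1 ≠ (g e).2) (he : e ∉ D)
    (h : bdry (mergeEnds g (g e).1 (g e).2) D = 0) :
    bdry g D = 0 ∨ bdry g (insert e D) = 0 := by
  have h1 : ∀ v, v ≠ (g e).1 → v ≠ (g e).2 → bdry g D v = 0 := by
    intro v hx hy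
    have := congrFun h v
    rwa [bdry_mergeEnds hxy, if_neg hy, if_neg hx] at this
  have h2 : bdry g D (g e).1 = bdry g D (g e).2 := by
    have := congrFun h (g e).1
    rw [bdry_mergeEnds hxy, if_neg hxy, if_pos rfl] at this
    exact CharTwo.add_eq_zero.1 this
  have h01 : ∀ z : ZMod 2, z = 0 ∨ z = 1 := by decide
  rcases h01 (bdry g D (g e).1) with h0 | h0
  · left
    funext v
    by_cases hx : v = (g e).1
    · rw [hx, h0]; rfl
    by_cases hy : v = (g e).2
    · rw [hy, ← h2, h0]; rfl
    exact h1 v hx hy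
  · right
    rw [insert_eq, bdry_union (disjoint_singleton_left.2 he), bdry_singleton]
    funext v
    simp only [Pi.add_apply, Pi.single_apply, Pi.zero_apply]
    by_cases hx : v = (g e).1
    · rw [hx, h0, if_pos rfl, if_neg hxy]; decide
    by_cases hy : v = (g e).2
    · rw [hy, ← h2, h0, if_pos rfl, if_neg hxy.symm]; decide
    rw [h1 v hx hy, if_neg hx, if_neg hy]; decide

lemma bdry_mergeEnds_erase {e : E} (hxy : (g e).1 ≠ (g e).2) (h : bdry g D = 0) :
    bdry (mergeEnds g (g e).1 (g e).2) (D.erase e) = 0 := by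
  have h0 : bdry (mergeEnds g (g e).1 (g e).2) D = 0 := by
    funext v
    rw [bdry_mergeEnds hxy, h]
    simp
  by_cases he : e ∈ D
  · rw [bdry_erase (a := (g e).1) (b := (g e).1) he, h0, add_self_vec, zero_add]
    left
    simp [mergeEnds, merge]
  · rwa [erase_eq_of_notMem he]

lemma card_verts_mergeEnds {e : E} (hxy : (g e).1 ≠ (g e).2) (he : e ∈ D) :
    (verts (mergeEnds g (g e).1 (g e).2) (D.erase e)).card + 1 ≤ (verts g D).card := by
  have hy : (g e).2 ∈ verts g D := mem_verts.2 ⟨e, he, .inr rfl⟩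
  rw [← card_erase_add_one hy]
  refine Nat.succ_le_succ (card_le_card fun v hv => ?_)
  obtain ⟨f, hf, hi⟩ := mem_verts.1 hv
  have hx : (g e).1 ∈ verts g D := mem_verts.2 ⟨e, he, .inl rfl⟩
  have h1 : (g f).1 ∈ verts g D := mem_verts.2 ⟨f, mem_of_mem_erase hf, .inl rfl⟩
  have h2 : (g f).2 ∈ verts g D := mem_verts.2 ⟨f, mem_of_mem_erase hf, .inr rfl⟩
  rw [mem_erase]
  simp only [Inc, mergeEnds, merge] at hi
  grind

lemma Acyc.card_lt (h : Acyc g D) (hne : D.Nonempty) : D.card + 1 ≤ (verts g D).card := by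
  induction hn : D.card generalizing g D with
  | zero => rw [card_eq_zero.1 hn] at hne; simp at hne
  | succ n ih =>
    obtain ⟨e, he⟩ := hne
    have hxy := h.ne he
    have hc := card_verts_mergeEnds hxy he
    have hcard : (D.erase e).card = n := by rw [card_erase_of_mem he, hn]; rfl
    rcases (D.erase e).eq_empty_or_nonempty with h0 | h0
    · have : n = 0 := by rw [← hcard, h0, card_empty]
      have h2 : ({(g e).1, (g e).2} : Finset V) ⊆ verts g D := by
        intro v hv
        rw [mem_insert, mem_singleton] at hv
        exact mem_verts.2 ⟨e, he, hv.imp Eq.symm Eq.symm⟩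
      have := card_le_card h2
      rw [card_pair hxy] at this
      omega
    · have h1 : Acyc (mergeEnds g (g e).1 (g e).2) (D.erase e) := by
        intro D' hD' hb
        have heD : e ∉ D' := fun h => by simpa using hD' h
        rcases bdry_of_mergeEnds hxy heD hb with hb | hb
        · exact h _ (hD'.trans (erase_subset _ _)) hb
        · have := h (insert e D')
            (insert_subset he (hD'.trans (erase_subset _ _))) hb
          simp at this
      have := ih h1 h0 hcard
      omega

end EdgeSets

section Minors

open Relation

variable {V U : Type*} {r r' : V → V → Prop} {A B X : Set V} {p q w v : V}

/-- The relation `r` restricted to the set `B`. -/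
def Within (r : V → V → Prop) (B : Set V) (a b : V) : Prop := r a b ∧ a ∈ B ∧ b ∈ B

/-- Any two elements of `B` are joined by an `r`-path inside `B`. -/
def ConnOn (r : V → V → Prop) (B : Set V) : Prop :=
  ∀ p ∈ B, ∀ q ∈ B, ReflTransGen (Within r B) p q

/-- Some element of `A` is related to some element of `B`. -/
def Linked (r : V → V → Prop) (A B : Set V) : Prop := ∃ p ∈ A, ∃ q ∈ B, r p q

/-- `B` is a family of branch sets exhibiting `H` as a minor of `r`. -/
structure IsModel (r : V → V → Prop) (H : SimpleGraph U) (B : U → Set V) : Prop where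
  nonempty : ∀ u, (B u).Nonempty
  conn : ∀ u, ConnOn r (B u)
  disj : ∀ u w, u ≠ w → Disjoint (B u) (B w)
  linked : ∀ u w, H.Adj u w → Linked r (B u) (B w)

/-- `H` is a minor of `r`. -/
def HasMinor (r : V → V → Prop) (H : SimpleGraph U) : Prop := ∃ B, IsModel r H B

lemma Within.mono (hr : ∀ a b, r a b → r' a b) (hB : A ⊆ B) :
    ∀ a b, Within r A a b → Within r' B a b :=
  fun _ _ h => ⟨hr _ _ h.1, hB h.2.1, hB h.2.2⟩

lemma Within.symm (hr : ∀ a b, r a b → r b a) : ∀ a b, Within r B a b → Within r B b a :=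
  fun _ _ h => ⟨hr _ _ h.1, h.2.2, h.2.1⟩

lemma reach_mono (hr : ∀ a b, r a b → r' a b) (h : ReflTransGen r p q) :
    ReflTransGen r' p q := by
  induction h with
  | refl => exact .refl
  | tail _ h ih => exact ih.tail (hr _ _ h)

lemma reach_symm (hr : ∀ a b, r a b → r b a) (h : ReflTransGen r p q) : ReflTransGen r q p := by
  induction h with
  | refl => exact .refl
  | tail _ h ih => exact .head (hr _ _ h) ih

lemma ConnOn.mono (hr : ∀ a b, r a b → r' a b) (h : ConnOn r B) : ConnOn r' B :=
  fun p hp q hq => reach_mono (Within.mono hr subset_rfl) (h p hp q hq)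

lemma Linked.mono (hr : ∀ a b, r a b → r' a b) (h : Linked r A B) : Linked r' A B := by
  obtain ⟨p, hp, q, hq, h⟩ := h
  exact ⟨p, hp, q, hq, hr _ _ h⟩

lemma Linked.symm (hr : ∀ a b, r a b → r b a) (h : Linked r A B) : Linked r B A := by
  obtain ⟨p, hp, q, hq, h⟩ := h
  exact ⟨q, hq, p, hp, hr _ _ h⟩

lemma Linked.mono_sets {A' B' : Set V} (hA : A ⊆ A') (hB : B ⊆ B') (h : Linked r A B) :
    Linked r A' B' := by
  obtain ⟨p, hp, q, hq, h⟩ := h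
  exact ⟨p, hA hp, q, hB hq, h⟩

lemma HasMinor.mono {H : SimpleGraph U} (hr : ∀ a b, r a b → r' a b) (h : HasMinor r H) :
    HasMinor r' H := by
  obtain ⟨B, h⟩ := h
  exact ⟨B, h.nonempty, fun u => (h.conn u).mono hr, h.disj,
    fun u w hu => (h.linked u w hu).mono hr⟩

lemma connOn_singleton : ConnOn r {v} := by
  rintro p rfl q rfl
  exact .refl

lemma ConnOn.union (hr : ∀ a b, r a b → r b a) (hA : ConnOn r A) (hB : ConnOn r B)
    (h : Linked r A B) : ConnOn r (A ∪ B) := by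
  obtain ⟨x, hx, y, hy, hxy⟩ := h
  have h1 : ∀ p ∈ A ∪ B, ReflTransGen (Within r (A ∪ B)) p x := by
    rintro p (hp | hp)
    · exact reach_mono (Within.mono (fun _ _ => id) Set.subset_union_left) (hA p hp x hx)
    · exact (reach_mono (Within.mono (fun _ _ => id) Set.subset_union_right) (hB p hp y hy)).tail
        ⟨hr _ _ hxy, .inr hy, .inl hx⟩
  exact fun p hp q hq => (h1 p hp).trans (reach_symm (Within.symm hr) (h1 q hq))

/-- The component of `w` in the complement of `X`. -/
def compl_comp (r : V → V → Prop) (X : Set V) (w : V) : Set V :=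
  {v | ReflTransGen (Within r Xᶜ) w v}

lemma mem_compl_comp_self : w ∈ compl_comp r X w := .refl

lemma compl_comp_disjoint (hw : w ∉ X) (hv : v ∈ compl_comp r X w) : v ∉ X := by
  rcases ReflTransGen.cases_tail hv with h | ⟨_, _, h⟩
  · exact h ▸ hw
  · exact h.2.2

lemma compl_comp_closed (hw : w ∉ X) (hv : v ∈ compl_comp r X w) (h : r v q) (hq : q ∉ X) :
    q ∈ compl_comp r X w :=
  ReflTransGen.tail hv ⟨h, compl_comp_disjoint hw hv, hq⟩

lemma reach_within_reachable {s : V → V → Prop} (hs : ∀ a b, s a b → s b a)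
    (hsub : ∀ a b, s a b → r a b) : ConnOn r {v | ReflTransGen s w v} := by
  have h1 : ∀ q, ReflTransGen s w q →
      ReflTransGen (Within r {v | ReflTransGen s w v}) w q := by
    intro q hq
    induction hq with
    | refl => exact .refl
    | tail h1 h2 ih => exact ih.tail ⟨hsub _ _ h2, h1, h1.tail h2⟩
  have h2 : ∀ q, ReflTransGen s w q →
      ReflTransGen (Within r {v | ReflTransGen s w v}) q w := by
    intro q hq
    induction hq with
    | refl => exact .refl
    | tail h1 h2 ih => exact .head ⟨hsub _ _ (hs _ _ h2), h1.tail h2, h1⟩ ih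
  exact fun p hp q hq => (h2 p hp).trans (h1 q hq)

lemma connOn_compl_comp (hr : ∀ a b, r a b → r b a) : ConnOn r (compl_comp r X w) :=
  reach_within_reachable (Within.symm hr) fun _ _ h => h.1

lemma compl_comp_eq (hr : ∀ a b, r a b → r b a) (hv : v ∈ compl_comp r X w) :
    compl_comp r X v = compl_comp r X w := by
  ext u
  exact ⟨fun h => ReflTransGen.trans hv h,
    fun h => ReflTransGen.trans (reach_symm (Within.symm hr) hv) h⟩

lemma hasMinor_K33 (hr : ∀ a b, r a b → r b a) {A B : Fin 3 → Set V}
    (hA : ∀ i, (A i).Nonempty) (hB : ∀ i, (B i).Nonempty)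
    (cA : ∀ i, ConnOn r (A i)) (cB : ∀ i, ConnOn r (B i))
    (dA : ∀ i j, i ≠ j → Disjoint (A i) (A j)) (dB : ∀ i j, i ≠ j → Disjoint (B i) (B j))
    (dAB : ∀ i j, Disjoint (A i) (B j)) (l : ∀ i j, Linked r (A i) (B j)) :
    HasMinor r (completeBipartiteGraph (Fin 3) (Fin 3)) := by
  refine ⟨Sum.elim A B, ?_, ?_, ?_, ?_⟩
  · rintro (i | i); exacts [hA i, hB i]
  · rintro (i | i); exacts [cA i, cB i]
  · rintro (i | i) (j | j) h
    · exact dA i j fun h' => h (h' ▸ rfl)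
    · exact dAB i j
    · exact (dAB j i).symm
    · exact dB i j fun h' => h (h' ▸ rfl)
  · rintro (i | i) (j | j) h
    · simp at h
    · exact l i j
    · exact (l j i).symm hr
    · simp at h

variable {E : Type*} [DecidableEq V] [DecidableEq E] {g : E → V × V} {F : Finset E}

lemma HasMinor.of_mergeEnds {H : SimpleGraph U} (hH : ∀ u, ∃ w, H.Adj u w) {e : E} (he : e ∈ F)
    (h : HasMinor (Lnk (mergeEnds g (g e).1 (g e).2) (F.erase e)) H) : HasMinor (Lnk g F) H := by
  obtain ⟨B, h⟩ := h
  set m := merge (g e).1 (g e).2 with hm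
  have lift : ∀ p q, Lnk (mergeEnds g (g e).1 (g e).2) (F.erase e) p q →
      ∃ p' q', m p' = p ∧ m q' = q ∧ Lnk g F p' q' := by
    rintro p q ⟨f, hf, hg | hg⟩
    · exact ⟨(g f).1, (g f).2, congrArg Prod.fst hg, congrArg Prod.snd hg,
        f, mem_of_mem_erase hf, .inl rfl⟩
    · exact ⟨(g f).2, (g f).1, congrArg Prod.snd hg, congrArg Prod.fst hg,
        f, mem_of_mem_erase hf, .inr rfl⟩
  have fib : ∀ p q, m p = m q → p = q ∨ Lnk g F p q := by
    intro p q hpq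
    have h1 : p = q ∨ p = (g e).1 ∧ q = (g e).2 ∨ p = (g e).2 ∧ q = (g e).1 := by
      simp only [hm, merge] at hpq
      grind
    rcases h1 with h1 | ⟨rfl, rfl⟩ | ⟨rfl, rfl⟩
    exacts [.inl h1, .inr ⟨e, he, .inl rfl⟩, .inr ⟨e, he, .inr rfl⟩]
  refine ⟨fun u => m ⁻¹' B u, ?_, ?_, ?_, ?_⟩
  · intro u
    obtain ⟨w, hw⟩ := hH u
    obtain ⟨p, hp, q, hq, hpq⟩ := h.linked u w hw
    obtain ⟨p', q', rfl, -, -⟩ := lift p q hpq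
    exact ⟨p', hp⟩
  · intro u p hp
    have h1 : ∀ q, ReflTransGen (Within (Lnk (mergeEnds g (g e).1 (g e).2) (F.erase e)) (B u))
        (m p) q → q ∈ B u ∧
          ∀ q', m q' = q → ReflTransGen (Within (Lnk g F) (m ⁻¹' B u)) p q' := by
      have step : ∀ q q', m q' = m q → m q ∈ B u →
          ReflTransGen (Within (Lnk g F) (m ⁻¹' B u)) q q' := by
        intro q q' hq hqB
        rcases fib q q' hq.symm with rfl | hl
        · exact .refl
        · exact .single ⟨hl, hqB, show m q' ∈ B u from hq ▸ hqB⟩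
      intro q hq
      induction hq with
      | refl => exact ⟨hp, fun q' h => step p q' h hp⟩
      | tail _ hl ih =>
        obtain ⟨c', d', rfl, rfl, hcd⟩ := lift _ _ hl.1
        exact ⟨hl.2.2, fun q' hq' => ((ih.2 c' rfl).tail ⟨hcd, hl.2.1, hl.2.2⟩).trans
          (step d' q' hq' hl.2.2)⟩
    exact fun q hq => (h1 (m q) (h.conn u _ hp _ hq)).2 q rfl
  · exact fun u w huw => (h.disj u w huw).preimage m
  · intro u w huw
    obtain ⟨p, hp, q, hq, hpq⟩ := h.linked u w huw
    obtain ⟨p', q', rfl, rfl, hl⟩ := lift p q hpq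
    exact ⟨p', hp, q', hq, hl⟩

end Minors

section Critical

open Relation

variable {V E : Type*} [DecidableEq V] [DecidableEq E] {g : E → V × V} {F C D P Q : Finset E}
  {a b v : V} {ℓ : E → ℝ}

/-- A nonempty edge set with zero boundary and `ℓ`-weight two. -/
structure Tight (g : E → V × V) (F : Finset E) (ℓ : E → ℝ) (C : Finset E) : Prop where
  sub : C ⊆ F
  nonempty : C.Nonempty
  bdry_eq : bdry g C = 0
  weight : ∑ e ∈ C, ℓ e = 2

/-- The local structure of a minimal violating weighted multigraph. -/
structure Critical (g : E → V × V) (F : Finset E) (ℓ : E → ℝ) : Prop where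
  pos : ∀ e ∈ F, 0 < ℓ e
  lt_one : ∀ e ∈ F, ℓ e < 1
  feasible : ∀ D ⊆ F, D.Nonempty → bdry g D = 0 → 2 ≤ ∑ e ∈ D, ℓ e
  nonsplit : ∀ C, Tight g F ℓ C → ∀ A ⊆ F \ C, A.Nonempty → ((F \ C) \ A).Nonempty →
    ∃ v ∈ verts g A, v ∈ verts g ((F \ C) \ A) ∧ v ∉ verts g C
  sep : ∀ e ∈ F, ∀ f ∈ F, e ≠ f → ∃ D, Tight g F ℓ D ∧ ¬ (e ∈ D ↔ f ∈ D)

lemma Lnk.mem_left (h : Lnk g D a b) : a ∈ verts g D := by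
  obtain ⟨e, he, h | h⟩ := h
  · exact mem_verts.2 ⟨e, he, .inl (congrArg Prod.fst h)⟩
  · exact mem_verts.2 ⟨e, he, .inr (congrArg Prod.snd h)⟩

lemma Lnk.mem_right (h : Lnk g D a b) : b ∈ verts g D := h.symm.mem_left

lemma lnk_symm : ∀ a b, Lnk g D a b → Lnk g D b a := fun _ _ h => h.symm

lemma verts_erase {e : E} (he : e ∈ D) (h : g e = (a, b) ∨ g e = (b, a)) :
    v ∈ verts g D ↔ v = a ∨ v = b ∨ v ∈ verts g (D.erase e) := by
  rw [mem_verts, mem_verts]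
  constructor
  · rintro ⟨f, hf, hi⟩
    by_cases hfe : f = e
    · subst hfe
      rcases h with h | h <;> simp only [Inc, h] at hi <;> grind
    · exact .inr (.inr ⟨f, mem_erase.2 ⟨hfe, hf⟩, hi⟩)
  · rintro (rfl | rfl | ⟨f, hf, hi⟩)
    · refine ⟨e, he, ?_⟩
      rcases h with h | h <;> simp [Inc, h]
    · refine ⟨e, he, ?_⟩
      rcases h with h | h <;> simp [Inc, h]
    · exact ⟨f, mem_of_mem_erase hf, hi⟩

lemma nonempty_of_bdry (hab : a ≠ b) (h : bdry g D = Pi.single a 1 + Pi.single b 1) :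
    D.Nonempty := by
  rw [nonempty_iff_ne_empty]
  rintro rfl
  exact hab (eq_of_single_add_single_zero (h.symm.trans bdry_empty))

lemma left_mem_verts (hab : a ≠ b) (h : bdry g D = Pi.single a 1 + Pi.single b 1) :
    a ∈ verts g D :=
  mem_verts_of_bdry (by rw [h]; exact single_add_single_ne hab)

lemma right_mem_verts (hab : a ≠ b) (h : bdry g D = Pi.single a 1 + Pi.single b 1) :
    b ∈ verts g D :=
  left_mem_verts hab.symm (h.trans (add_comm _ _))

/-- At an endpoint of a path there is exactly one edge, and removing it leaves a path. -/
lemma Acyc.peel [Fintype V] (hQ : Acyc g Q) (hab : a ≠ b)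
    (h : bdry g Q = Pi.single a 1 + Pi.single b 1) :
    ∃ e ∈ Q, ∃ a', (g e = (a, a') ∨ g e = (a', a)) ∧ a' ≠ a ∧ a ∉ verts g (Q.erase e) ∧
      bdry g (Q.erase e) = Pi.single a' 1 + Pi.single b 1 := by
  obtain ⟨e, he, hi⟩ := mem_verts.1 (left_mem_verts hab h)
  obtain ⟨a', ha'⟩ := hi.exists_other
  have hne : a' ≠ a := by
    have := hQ.ne he
    rcases ha' with h | h <;> rw [h] at this
    exacts [this.symm, this]
  have hb : bdry g (Q.erase e) = Pi.single a' 1 + Pi.single b 1 := by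
    rw [bdry_erase he ha', h, add_comm (Pi.single a 1) (Pi.single b 1), add_assoc,
      ← add_assoc (Pi.single a 1), add_self_vec, zero_add, add_comm]
  refine ⟨e, he, a', ha', hne, fun hv => ?_, hb⟩
  obtain ⟨S, hS, hSb⟩ := exists_bdry_of_reach
    ((hQ.mono (erase_subset _ _)).reach hb hv)
  have heS : e ∉ S := fun h => by simpa using hS h
  have := hQ (insert e S) (insert_subset he (hS.trans (erase_subset _ _))) (by
    rw [insert_eq, bdry_union (disjoint_singleton_left.2 heS), bdry_singleton_of ha', hSb,
      add_comm (Pi.single a 1), add_self_vec])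
  simp at this

/-- The interior of a path which is not a single edge is connected and touches both ends. -/
lemma Acyc.interior [Fintype V] (hQ : Acyc g Q) (hab : a ≠ b)
    (h : bdry g Q = Pi.single a 1 + Pi.single b 1) (hl : ¬ Lnk g Q a b) :
    ConnOn (Lnk g Q) {v | v ∈ verts g Q ∧ v ≠ a ∧ v ≠ b} ∧
    Linked (Lnk g Q) {a} {v | v ∈ verts g Q ∧ v ≠ a ∧ v ≠ b} ∧
    Linked (Lnk g Q) {b} {v | v ∈ verts g Q ∧ v ≠ a ∧ v ≠ b} := by
  obtain ⟨e, he, a', hg, hne, ha, hb⟩ := hQ.peel hab h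
  have ha'b : a' ≠ b := fun h => hl ⟨e, he, h ▸ hg⟩
  obtain ⟨f, hf, b', hg', hne', hb', hbd⟩ := (hQ.mono (erase_subset _ _)).peel ha'b.symm
    (hb.trans (add_comm _ _))
  set R := (Q.erase e).erase f with hR
  have hRQ : R ⊆ Q := (erase_subset _ _).trans (erase_subset _ _)
  have hQe : b' ∈ verts g (Q.erase e) := (verts_erase hf hg').2 (.inr (.inl rfl))
  have hb'a : b' ≠ a := fun h => ha (h ▸ hQe)
  have haR : a ∉ verts g R := fun h => ha (verts_mono (erase_subset _ _) h)
  have hRI : ∀ v ∈ verts g R, v ∈ verts g Q ∧ v ≠ a ∧ v ≠ b := fun v hv =>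
    ⟨verts_mono hRQ hv, fun h => haR (h ▸ hv), fun h => hb' (h ▸ hv)⟩
  have hbd' : bdry g R = Pi.single a' 1 + Pi.single b' 1 := hbd.trans (add_comm _ _)
  have ha'I : a' ∈ verts g Q := (verts_erase he hg).2 (.inr (.inl rfl))
  have key : ∀ v, v ∈ verts g Q ∧ v ≠ a ∧ v ≠ b → v ∈ reachSet g R a' := by
    rintro v ⟨h1, h2, h3⟩
    rcases (verts_erase he hg).1 h1 with h4 | h4 | h4
    · exact absurd h4 h2
    · exact h4 ▸ mem_reachSet_self
    · rcases (verts_erase hf hg').1 h4 with h5 | h5 | h5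
      · exact absurd h5 h3
      · exact h5 ▸ reach_of_bdry hbd'
      · exact (hQ.mono hRQ).reach hbd' h5
  have key' : ∀ v, v ∈ verts g Q ∧ v ≠ a ∧ v ≠ b →
      ReflTransGen (Within (Lnk g Q) {v | v ∈ verts g Q ∧ v ≠ a ∧ v ≠ b}) a' v := fun v hv =>
    reach_mono (fun p q hpq => ⟨hpq.mono hRQ, hRI _ hpq.mem_left, hRI _ hpq.mem_right⟩) (key v hv)
  refine ⟨fun p hp q hq => (reach_symm (Within.symm lnk_symm) (key' p hp)).trans (key' q hq),
    ⟨a, rfl, a', ⟨ha'I, hne, ha'b⟩, e, he, hg⟩, ⟨b, rfl, b',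
      ⟨verts_mono (erase_subset _ _) hQe, hb'a, hne'⟩, f, mem_of_mem_erase hf, hg'⟩⟩

/-- Two paths forming a circuit meet only in their ends. -/
lemma eq_end_of_mem [Fintype V] (hPQ : Disjoint P Q) (hab : a ≠ b)
    (hP : bdry g P = Pi.single a 1 + Pi.single b 1)
    (hQ : bdry g Q = Pi.single a 1 + Pi.single b 1)
    (hmin : ∀ D ⊆ P ∪ Q, D.Nonempty → bdry g D = 0 → D = P ∪ Q)
    (h1 : v ∈ verts g P) (h2 : v ∈ verts g Q) : v = a ∨ v = b := by
  by_contra! hv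
  have aux : ∀ {P Q : Finset E}, Disjoint P Q → Q.Nonempty →
      (∀ D ⊆ P ∪ Q, D.Nonempty → bdry g D = 0 → D = P ∪ Q) → Acyc g P := by
    intro P Q hd ⟨e, he⟩ hm D hD hb
    by_contra hne
    have := hm D (hD.trans subset_union_left) (nonempty_iff_ne_empty.2 hne) hb
    exact disjoint_left.1 hd (hD (this ▸ mem_union_right _ he)) he
  have aP := aux hPQ (nonempty_of_bdry hab hQ) hmin
  have aQ := aux hPQ.symm (nonempty_of_bdry hab hP) (by rwa [union_comm])
  obtain ⟨S, hS, hSb⟩ := exists_bdry_of_reach (aP.reach hP h1)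
  obtain ⟨T, hT, hTb⟩ := exists_bdry_of_reach (aQ.reach hQ h2)
  have hd : Disjoint S T := hPQ.mono hS hT
  have := hmin (S ∪ T) (union_subset_union hS hT)
    ((nonempty_of_bdry hv.1.symm hSb).mono subset_union_left)
    (by rw [bdry_union hd, hSb, hTb, add_self_vec])
  have hSP : S = P := by
    refine hS.antisymm fun x hx => ?_
    have hx' : x ∈ S ∪ T := this ▸ mem_union_left _ hx
    exact (mem_union.1 hx').resolve_right fun h => disjoint_left.1 hPQ hx (hT h)
  rw [hSP, hP] at hSb
  exact hv.2 (eq_of_single_add_single hSb).symm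

lemma exists_second_edge {e : E} (h : bdry g D = 0) (he : e ∈ D) (hne : (g e).1 ≠ (g e).2)
    (hv : Inc g e v) : ∃ f ∈ D, f ≠ e ∧ Inc g f v := by
  obtain ⟨w, hw⟩ := hv.exists_other
  have hvw : v ≠ w := by
    rcases hw with h | h <;> rw [h] at hne
    exacts [hne, hne.symm]
  have : v ∈ verts g (D.erase e) :=
    left_mem_verts hvw (by rw [bdry_erase he hw, h, zero_add])
  obtain ⟨f, hf, hi⟩ := mem_verts.1 this
  exact ⟨f, mem_of_mem_erase hf, ne_of_mem_erase hf, hi⟩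

namespace Critical

variable {C₁ C₂ : Finset E}

lemma circ (h : Critical g F ℓ) (hC : Tight g F ℓ C) : Circ g C := by
  refine ⟨hC.nonempty, hC.bdry_eq, fun D hD hne hb => ?_⟩
  by_contra hDC
  have h1 : (C \ D).Nonempty := by
    rw [nonempty_iff_ne_empty, Ne, sdiff_eq_empty_iff_subset]
    exact fun h => hDC (hD.antisymm h)
  have h2 := h.feasible _ (sdiff_subset.trans hC.sub) h1
    (by rw [bdry_sdiff hD, hC.bdry_eq, hb, add_zero])
  have h3 := h.feasible _ (hD.trans hC.sub) hne hb
  have h4 := sum_sdiff (f := ℓ) hD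
  have := hC.weight
  linarith

lemma ne (h : Critical g F ℓ) {e : E} (he : e ∈ F) : (g e).1 ≠ (g e).2 := by
  intro hne
  have := h.feasible {e} (singleton_subset_iff.2 he) (singleton_nonempty e)
    (by rw [bdry_singleton, hne, add_self_vec])
  rw [sum_singleton] at this
  linarith [h.lt_one e he]

lemma sum_pos (h : Critical g F ℓ) {D : Finset E} (hD : D ⊆ F)
    (hne : D.Nonempty) : 0 < ∑ e ∈ D, ℓ e :=
  Finset.sum_pos (fun e he => h.pos e (hD he)) hne

lemma false_of_closed (h : Critical g F ℓ) (hC : Tight g F ℓ C) (K : Set V)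
    (hK : ∀ v ∈ K, v ∉ verts g C)
    (hcl : ∀ p ∈ K, ∀ q, Lnk g F p q → q ∈ K ∨ q ∈ verts g C) (hf : ∃ p ∈ K, p ∈ verts g F)
    (hf' : ∃ e ∈ F, e ∉ C ∧ ∀ v, Inc g e v → v ∉ K) : False := by
  classical
  obtain ⟨p, hp, hpF⟩ := hf
  obtain ⟨e, he, hi⟩ := mem_verts.1 hpF
  obtain ⟨e', he', heC', hK'⟩ := hf'
  have heC : e ∉ C := fun h => hK p hp (mem_verts.2 ⟨e, h, hi⟩)
  obtain ⟨v, h1, h2, h3⟩ := h.nonsplit C hC ((F \ C).filter fun e => ∃ v, Inc g e v ∧ v ∈ K)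
    (filter_subset _ _) ⟨e, mem_filter.2 ⟨mem_sdiff.2 ⟨he, heC⟩, p, hi, hp⟩⟩
    ⟨e', mem_sdiff.2 ⟨mem_sdiff.2 ⟨he', heC'⟩, fun h => by
      obtain ⟨v, hv, hvK⟩ := (mem_filter.1 h).2
      exact hK' v hv hvK⟩⟩
  obtain ⟨e1, he1, hi1⟩ := mem_verts.1 h1
  obtain ⟨e2, he2, hi2⟩ := mem_verts.1 h2
  rw [mem_filter, mem_sdiff] at he1
  rw [mem_sdiff, mem_filter, mem_sdiff] at he2
  obtain ⟨⟨he1F, -⟩, u, hu, huK⟩ := he1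
  have hvK : v ∉ K := fun hvK => he2.2 ⟨he2.1, v, hi2, hvK⟩
  have huv : u ≠ v := fun h => hvK (h ▸ huK)
  have hl : Lnk g F u v := by
    refine ⟨e1, he1F, ?_⟩
    rcases hu with hu | hu <;> rcases hi1 with hi1 | hi1
    · exact absurd (hu.symm.trans hi1) huv
    · exact .inl (Prod.ext hu hi1)
    · exact .inr (Prod.ext hi1 hu)
    · exact absurd (hu.symm.trans hi1) huv
  exact (hcl u huK v hl).elim hvK h3

lemma eq_of_chord (h : Critical g F ℓ) (hC : Tight g F ℓ C) {e f : E} (he : e ∈ F) (heC : e ∉ C)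
    (hv : ∀ v, Inc g e v → v ∈ verts g C) (hf : f ∈ F) (hfC : f ∉ C) : f = e := by
  by_contra hfe
  obtain ⟨v, h1, -, h3⟩ := h.nonsplit C hC {e}
    (singleton_subset_iff.2 (mem_sdiff.2 ⟨he, heC⟩)) (singleton_nonempty e)
    ⟨f, mem_sdiff.2 ⟨mem_sdiff.2 ⟨hf, hfC⟩, by simpa using hfe⟩⟩
  obtain ⟨e', he', hi⟩ := mem_verts.1 h1
  rw [mem_singleton] at he'
  exact h3 (hv v (he' ▸ hi))

lemma symmDiff_min (h : Critical g F ℓ) (h1 : Tight g F ℓ C₁) (h2 : Tight g F ℓ C₂)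
    (hne : (C₁ ∩ C₂).Nonempty) :
    ∀ D ⊆ symmDiff C₁ C₂, D.Nonempty → bdry g D = 0 → D = symmDiff C₁ C₂ := by
  intro D hD hDne hb
  by_contra hDC
  have hX : symmDiff C₁ C₂ ⊆ F := by
    intro x hx
    rw [mem_symmDiff] at hx
    exact hx.elim (fun h => h1.sub h.1) (fun h => h2.sub h.1)
  have h3 : (symmDiff C₁ C₂ \ D).Nonempty := by
    rw [nonempty_iff_ne_empty, Ne, sdiff_eq_empty_iff_subset]
    exact fun h => hDC (hD.antisymm h)
  have h4 := h.feasible _ (sdiff_subset.trans hX) h3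
    (by rw [bdry_sdiff hD, bdry_symmDiff, h1.bdry_eq, h2.bdry_eq, hb, add_zero, add_zero])
  have h5 := h.feasible _ (hD.trans hX) hDne hb
  have h6 := sum_sdiff (f := ℓ) hD
  have h7 := h.sum_pos (inter_subset_left.trans h1.sub) hne
  have h8 : ∑ e ∈ symmDiff C₁ C₂, ℓ e = ∑ e ∈ C₁ \ C₂, ℓ e + ∑ e ∈ C₂ \ C₁, ℓ e :=
    sum_union disjoint_sdiff_sdiff
  have h9 := sum_inter_add_sum_sdiff C₁ C₂ ℓ
  have h10 := sum_inter_add_sum_sdiff C₂ C₁ ℓ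
  rw [inter_comm] at h10
  have := h1.weight
  have := h2.weight
  linarith

lemma sdiff_nonempty (h : Critical g F ℓ) (h1 : Tight g F ℓ C₁) (h2 : Tight g F ℓ C₂)
    (hC : C₁ ≠ C₂) :
    (C₂ \ C₁).Nonempty := by
  rw [nonempty_iff_ne_empty, Ne, sdiff_eq_empty_iff_subset]
  exact fun hs => hC ((h.circ h1).min _ hs h2.nonempty h2.bdry_eq).symm

/-- Two intersecting tight sets form a theta graph. -/
lemma bdry_inter [Fintype V] (h : Critical g F ℓ) (h1 : Tight g F ℓ C₁) (h2 : Tight g F ℓ C₂)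
    (hC : C₁ ≠ C₂)
    (hne : (C₁ ∩ C₂).Nonempty) :
    ∃ a b, a ≠ b ∧ bdry g (C₁ ∩ C₂) = Pi.single a 1 + Pi.single b 1 := by
  obtain ⟨e, he⟩ := hne
  obtain ⟨he1, he2⟩ := mem_inter.1 he
  have hQ : bdry g (C₂ \ C₁) = bdry g (C₁ ∩ C₂) := by
    rw [← sdiff_inter_self_right, bdry_sdiff inter_subset_right, h2.bdry_eq, zero_add]
  have hQ0 : bdry g (C₂ \ C₁) ≠ 0 := by
    intro h0
    have := (h.circ h2).min _ sdiff_subset (h.sdiff_nonempty h1 h2 hC) h0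
    rw [← this] at he2
    exact (mem_sdiff.1 he2).2 he1
  obtain ⟨a, ha⟩ := Function.ne_iff.1 hQ0
  obtain ⟨z, hza, hz, hr⟩ := exists_reach_of_bdry ha
  obtain ⟨S, hS, hSb⟩ := exists_bdry_of_reach hr
  have haC : a ∈ verts g C₁ :=
    verts_mono inter_subset_left (mem_verts_of_bdry (D := C₁ ∩ C₂) (hQ ▸ ha))
  have hzC : z ∈ verts g C₁ :=
    verts_mono inter_subset_left (mem_verts_of_bdry (D := C₁ ∩ C₂) (hQ ▸ hz))
  obtain ⟨β, hβ, hβb, heβ⟩ : ∃ β ⊆ C₁, bdry g β = Pi.single a 1 + Pi.single z 1 ∧ e ∉ β := by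
    obtain ⟨β, hβ, hβb⟩ := exists_bdry_of_reach ((h.circ h1).reach haC hzC)
    by_cases heβ : e ∈ β
    · exact ⟨C₁ \ β, sdiff_subset, by rw [bdry_sdiff hβ, h1.bdry_eq, hβb, zero_add],
        fun h => (mem_sdiff.1 h).2 heβ⟩
    · exact ⟨β, hβ, hβb, heβ⟩
  have hSC : ∀ x ∈ S, x ∈ C₂ ∧ x ∉ C₁ := fun x hx => mem_sdiff.1 (hS hx)
  have hSβ : Disjoint S β := disjoint_left.2 fun x hx hx' => (hSC x hx).2 (hβ hx')
  have hD0 : bdry g (S ∪ β) = 0 := by rw [bdry_union hSβ, hSb, hβb, add_self_vec]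
  have hSne : S.Nonempty := nonempty_of_bdry hza.symm hSb
  have k1 : 2 ≤ ∑ e ∈ (C₁ \ β) ∪ S, ℓ e := by
    refine h.feasible _ (union_subset (sdiff_subset.trans h1.sub)
      fun x hx => h2.sub (hSC x hx).1) (hSne.mono subset_union_right) ?_
    rw [bdry_union (disjoint_left.2 fun x hx hx' => (hSC x hx').2 (mem_sdiff.1 hx).1),
      bdry_sdiff hβ, h1.bdry_eq, hβb, hSb, zero_add, add_self_vec]
  have k2 : 2 ≤ ∑ e ∈ symmDiff C₂ (S ∪ β), ℓ e := by
    refine h.feasible _ ?_ ⟨e, ?_⟩ (by rw [bdry_symmDiff, hD0, h2.bdry_eq, add_zero])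
    · intro x hx
      rw [mem_symmDiff, mem_union] at hx
      rcases hx with hx | hx
      · exact h2.sub hx.1
      · exact hx.1.elim (fun hx => h2.sub (hSC x hx).1) fun hx => h1.sub (hβ hx)
    · rw [mem_symmDiff, mem_union]
      exact .inl ⟨he2, fun h => h.elim (fun h => (hSC e h).2 he1) heβ⟩
  have k3 : ∑ e ∈ (C₁ \ β) ∪ S, ℓ e + ∑ e ∈ β, ℓ e = 2 + ∑ e ∈ S, ℓ e := by
    rw [sum_union (disjoint_left.2 fun x hx hx' => (hSC x hx').2 (mem_sdiff.1 hx).1),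
      ← h1.weight, ← sum_sdiff (f := ℓ) hβ]
    ring
  have k4 : ∑ e ∈ symmDiff C₂ (S ∪ β), ℓ e + ∑ e ∈ S, ℓ e + 2 * ∑ e ∈ β ∩ C₂, ℓ e =
      2 + ∑ e ∈ β, ℓ e := by
    have e1 : ∑ e ∈ symmDiff C₂ (S ∪ β), ℓ e =
        ∑ e ∈ C₂ \ (S ∪ β), ℓ e + ∑ e ∈ (S ∪ β) \ C₂, ℓ e := sum_union disjoint_sdiff_sdiff
    have e2 : (S ∪ β) \ C₂ = β \ C₂ := by
      ext x
      simp only [mem_sdiff, mem_union]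
      have := hSC x
      grind
    have e3 := sum_inter_add_sum_sdiff β C₂ ℓ
    have e4 := sum_inter_add_sum_sdiff C₂ (S ∪ β) ℓ
    have e5 : ∑ e ∈ C₂ ∩ (S ∪ β), ℓ e = ∑ e ∈ S, ℓ e + ∑ e ∈ β ∩ C₂, ℓ e := by
      rw [← sum_union (hSβ.mono_right inter_subset_left)]
      congr 1
      ext x
      simp only [mem_inter, mem_union]
      have := hSC x
      grind
    rw [h2.weight] at e4
    rw [e1, e2]
    linarith
  have hβ2 : β ∩ C₂ = ∅ := by
    by_contra hne
    have := h.sum_pos (inter_subset_right.trans h2.sub) (nonempty_iff_ne_empty.2 hne)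
    linarith
  have hall := h.symmDiff_min h1 h2 ⟨e, he⟩ (S ∪ β) (by
    intro x hx
    rw [mem_symmDiff]
    rcases mem_union.1 hx with hx | hx
    · exact .inr (hSC x hx)
    · exact .inl ⟨hβ hx, fun h => by simpa [hβ2] using mem_inter.2 ⟨hx, h⟩⟩)
    (hSne.mono subset_union_left) hD0
  have hSQ : S = C₂ \ C₁ := by
    refine hS.antisymm fun x hx => ?_
    have hx' : x ∈ S ∪ β := by
      rw [hall, mem_symmDiff]
      exact .inr (mem_sdiff.1 hx)
    exact (mem_union.1 hx').resolve_right fun h => (mem_sdiff.1 hx).2 (hβ h)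
  exact ⟨a, z, hza.symm, by rw [← hQ, ← hSQ, hSb]⟩

end Critical

end Critical

section ThreeTight

open Relation

variable {V E : Type*} [DecidableEq V] [DecidableEq E] {g : E → V × V} {F C D P Q : Finset E}
  {a b v : V} {ℓ : E → ℝ}

/-- The vertices of `Q` other than `a` and `b`. -/
def innerVerts (g : E → V × V) (Q : Finset E) (a b : V) : Set V :=
  {v | v ∈ verts g Q ∧ v ≠ a ∧ v ≠ b}

lemma hasMinor_K5 {r : V → V → Prop} (hr : ∀ a b, r a b → r b a) {x y : V} {B : Fin 3 → Set V}
    (hxy : x ≠ y) (lxy : r x y) (hB : ∀ i, (B i).Nonempty) (cB : ∀ i, ConnOn r (B i))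
    (dB : ∀ i j, i ≠ j → Disjoint (B i) (B j)) (hx : ∀ i, x ∉ B i) (hy : ∀ i, y ∉ B i)
    (lB : ∀ i j, i ≠ j → Linked r (B i) (B j)) (lx : ∀ i, Linked r {x} (B i))
    (ly : ∀ i, Linked r {y} (B i)) : HasMinor r (completeGraph (Fin 5)) := by
  have key : HasMinor r (completeGraph (Fin 2 ⊕ Fin 3)) := by
    refine ⟨Sum.elim ![{x}, {y}] B, ?_, ?_, ?_, ?_⟩
    · rintro (i | i)
      · fin_cases i <;> simp
      · exact hB i
    · rintro (i | i)
      · fin_cases i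
        exacts [connOn_singleton, connOn_singleton]
      · exact cB i
    · rintro (i | i) (j | j) h
      · fin_cases i <;> fin_cases j <;> simp_all
        exact Ne.symm hxy
      · fin_cases i
        exacts [Set.disjoint_singleton_left.2 (hx j), Set.disjoint_singleton_left.2 (hy j)]
      · fin_cases j
        exacts [Set.disjoint_singleton_right.2 (hx i), Set.disjoint_singleton_right.2 (hy i)]
      · exact dB i j fun h' => h (h' ▸ rfl)
    · rintro (i | i) (j | j) h
      · fin_cases i <;> fin_cases j
        · simp at h
        · exact ⟨x, rfl, y, rfl, lxy⟩
        · exact ⟨y, rfl, x, rfl, hr _ _ lxy⟩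
        · simp at h
      · fin_cases i
        exacts [lx j, ly j]
      · fin_cases j
        exacts [(lx i).symm hr, (ly i).symm hr]
      · exact lB i j fun h' => h.ne (h' ▸ rfl)
  obtain ⟨B', hm⟩ := key
  have inj : Function.Injective (finSumFinEquiv : Fin 2 ⊕ Fin 3 ≃ Fin 5).symm :=
    Equiv.injective _
  exact ⟨fun u => B' (finSumFinEquiv.symm u), fun u => hm.nonempty _, fun u => hm.conn _,
    fun u w huw => hm.disj _ _ (inj.ne huw), fun u w huw => hm.linked _ _ (inj.ne huw.ne)⟩

/-- Three internally disjoint paths between `a` and `b` together with a connected set disjoint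
from them and touching all three interiors give a `K_{3,3}` minor. -/
lemma hasMinor_K33_of_paths [Fintype V] {Q : Fin 3 → Finset E} (hab : a ≠ b)
    (hQF : ∀ i, Q i ⊆ F) (hQ : ∀ i, Acyc g (Q i))
    (hb : ∀ i, bdry g (Q i) = Pi.single a 1 + Pi.single b 1) (hl : ∀ i, ¬ Lnk g (Q i) a b)
    (hd : ∀ i j, i ≠ j → Disjoint (innerVerts g (Q i) a b) (innerVerts g (Q j) a b))
    {K : Set V} (hK : ConnOn (Lnk g F) K) (hKd : ∀ i, ∀ v ∈ K, v ∉ verts g (Q i))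
    (hKl : ∀ i, Linked (Lnk g F) K (innerVerts g (Q i) a b)) :
    HasMinor (Lnk g F) (completeBipartiteGraph (Fin 3) (Fin 3)) := by
  have mono : ∀ i a b, Lnk g (Q i) a b → Lnk g F a b := fun i _ _ h => h.mono (hQF i)
  have haK : a ∉ K := fun h => hKd 0 a h (left_mem_verts hab (hb 0))
  have hbK : b ∉ K := fun h => hKd 0 b h (right_mem_verts hab (hb 0))
  obtain ⟨k, hk, -⟩ := hKl 0
  have dK : ∀ j, Disjoint K (innerVerts g (Q j) a b) := fun j =>
    Set.disjoint_left.2 fun v hv hv' => hKd j v hv hv'.1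
  refine hasMinor_K33 (A := ![{a}, {b}, K]) (B := fun i => innerVerts g (Q i) a b)
    lnk_symm ?_ ?_ ?_ (fun i => ((hQ i).interior hab (hb i) (hl i)).1.mono (mono i)) ?_ hd ?_ ?_
  · intro i
    fin_cases i
    exacts [⟨a, rfl⟩, ⟨b, rfl⟩, ⟨k, hk⟩]
  · intro i
    obtain ⟨-, -, v, h, -⟩ := ((hQ i).interior hab (hb i) (hl i)).2.1
    exact ⟨_, h⟩
  · intro i
    fin_cases i
    exacts [connOn_singleton, connOn_singleton, hK]
  · intro i j hij
    fin_cases i <;> fin_cases j <;> simp_all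
    exact Ne.symm hab
  · intro i j
    fin_cases i
    · exact Set.disjoint_singleton_left.2 fun h => h.2.1 rfl
    · exact Set.disjoint_singleton_left.2 fun h => h.2.2 rfl
    · exact dK j
  · intro i j
    obtain ⟨-, h1, h2⟩ := (hQ j).interior hab (hb j) (hl j)
    fin_cases i
    exacts [h1.mono (mono j), h2.mono (mono j), hKl j]

namespace Critical

variable {C₁ C₂ : Finset E}

lemma inter_eq_singleton [Fintype V] (h : Critical g F ℓ) (h1 : Tight g F ℓ C₁)
    (h2 : Tight g F ℓ C₂) (hC : C₁ ≠ C₂)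
    {e : E} (he : e ∈ C₁ ∩ C₂)
    (hK : ¬ HasMinor (Lnk g F) (completeBipartiteGraph (Fin 3) (Fin 3))) : C₁ ∩ C₂ = {e} := by
  by_contra hR
  obtain ⟨a, b, hab, hRb⟩ := h.bdry_inter h1 h2 hC ⟨e, he⟩
  obtain ⟨he1, he2⟩ := mem_inter.1 he
  set R := C₁ ∩ C₂ with hRdef
  have hRF : R ⊆ F := inter_subset_left.trans h1.sub
  have n1 := h.sdiff_nonempty h2 h1 hC.symm
  have n2 := h.sdiff_nonempty h1 h2 hC
  have b1 : bdry g (C₁ \ C₂) = Pi.single a 1 + Pi.single b 1 := by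
    rw [← sdiff_inter_self_left, bdry_sdiff inter_subset_left, h1.bdry_eq, zero_add, hRb]
  have b2 : bdry g (C₂ \ C₁) = Pi.single a 1 + Pi.single b 1 := by
    rw [← sdiff_inter_self_right, bdry_sdiff inter_subset_right, h2.bdry_eq, zero_add, hRb]
  have acR : Acyc g R := (h.circ h1).acyc ⟨inter_subset_left, fun hs => by
    obtain ⟨x, hx⟩ := n1
    exact (mem_sdiff.1 hx).2 (mem_inter.1 (hs (mem_sdiff.1 hx).1)).2⟩
  have ac1 : Acyc g (C₁ \ C₂) := (h.circ h1).acyc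
    ⟨sdiff_subset, fun hs => (mem_sdiff.1 (hs he1)).2 he2⟩
  have ac2 : Acyc g (C₂ \ C₁) := (h.circ h2).acyc
    ⟨sdiff_subset, fun hs => (mem_sdiff.1 (hs he2)).2 he1⟩
  have lR : ¬ Lnk g R a b := by
    rintro ⟨f, hf, hg⟩
    have h3 := acR.eq_of_bdry (singleton_subset_iff.2 hf) ((bdry_singleton_of hg).trans hRb.symm)
    rw [← h3, mem_singleton] at he
    exact hR (he ▸ h3.symm)
  -- the paths meet only in `a` and `b`
  have d1R : ∀ v, v ∈ verts g (C₁ \ C₂) → v ∈ verts g R → v = a ∨ v = b := fun v =>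
    eq_end_of_mem (disjoint_sdiff_inter C₁ C₂) hab b1 hRb
      (by rw [hRdef, sdiff_union_inter]; exact (h.circ h1).min)
  have d2R : ∀ v, v ∈ verts g (C₂ \ C₁) → v ∈ verts g R → v = a ∨ v = b := fun v =>
    eq_end_of_mem (by rw [hRdef, inter_comm]; exact disjoint_sdiff_inter C₂ C₁) hab b2 hRb
      (by rw [hRdef, inter_comm, sdiff_union_inter]; exact (h.circ h2).min)
  have d12 : ∀ v, v ∈ verts g (C₁ \ C₂) → v ∈ verts g (C₂ \ C₁) → v = a ∨ v = b := fun v =>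
    eq_end_of_mem disjoint_sdiff_sdiff hab b1 b2 (h.symmDiff_min h1 h2 ⟨e, he⟩)
  have v1 : verts g C₁ = verts g (C₁ \ C₂) ∪ verts g R := by
    rw [← verts_union, hRdef, sdiff_union_inter]
  have v2 : verts g C₂ = verts g (C₂ \ C₁) ∪ verts g R := by
    rw [← verts_union, hRdef, inter_comm, sdiff_union_inter]
  -- an inner vertex `c` of `R` and an edge leaving the theta graph there
  obtain ⟨f₀, hf₀, c, hg₀, hca, haR', hRb'⟩ := acR.peel hab hRb
  have hcb : c ≠ b := fun h => lR ⟨f₀, hf₀, h ▸ hg₀⟩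
  obtain ⟨f₁, hf₁, c', hg₁, -, hcR, -⟩ := (acR.mono (erase_subset _ _)).peel hcb hRb'
  have hcRv : c ∈ verts g R := (verts_erase hf₀ hg₀).2 (.inr (.inl rfl))
  have only : ∀ f ∈ R, Inc g f c → f = f₀ ∨ f = f₁ := by
    intro f hf hi
    by_contra! hne
    exact hcR (mem_verts.2 ⟨f, mem_erase.2 ⟨hne.2, mem_erase.2 ⟨hne.1, hf⟩⟩, hi⟩)
  have hi₀ : Inc g f₀ c := by rcases hg₀ with h | h <;> simp [Inc, h]
  have hi₁ : Inc g f₁ c := by rcases hg₁ with h | h <;> simp [Inc, h]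
  have hf₁R := mem_of_mem_erase hf₁
  obtain ⟨D, hD, hDne⟩ := h.sep f₀ (hRF hf₀) f₁ (hRF hf₁R) (ne_of_mem_erase hf₁).symm
  obtain ⟨f, hfD, hfn₀, hfn₁, hfc⟩ : ∃ f ∈ D, f ≠ f₀ ∧ f ≠ f₁ ∧ Inc g f c := by
    by_cases h0 : f₀ ∈ D
    · obtain ⟨f, hf, hne, hi⟩ := exists_second_edge hD.bdry_eq h0 (h.ne (hRF hf₀)) hi₀
      exact ⟨f, hf, hne, fun h => hDne ⟨fun _ => h ▸ hf, fun _ => h0⟩, hi⟩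
    · have h01 : f₁ ∈ D := by
        by_contra h01
        exact hDne ⟨fun h => absurd h h0, fun h => absurd h h01⟩
      obtain ⟨f, hf, hne, hi⟩ := exists_second_edge hD.bdry_eq h01 (h.ne (hRF hf₁R)) hi₁
      exact ⟨f, hf, fun h => h0 (h ▸ hf), hne, hi⟩
  have hfF := hD.sub hfD
  have hfR : f ∉ R := fun hf => (only f hf hfc).elim hfn₀ hfn₁
  have hf1 : f ∉ C₁ := by
    intro hf
    have hf2 : f ∉ C₂ := fun hf2 => hfR (mem_inter.2 ⟨hf, hf2⟩)
    rcases d1R c (mem_verts.2 ⟨f, mem_sdiff.2 ⟨hf, hf2⟩, hfc⟩) hcRv with h | h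
    exacts [hca h, hcb h]
  have hf2 : f ∉ C₂ := by
    intro hf
    rcases d2R c (mem_verts.2 ⟨f, mem_sdiff.2 ⟨hf, hf1⟩, hfc⟩) hcRv with h | h
    exacts [hca h, hcb h]
  have aR : a ∈ verts g R := left_mem_verts hab hRb
  have bR : b ∈ verts g R := right_mem_verts hab hRb
  have chord : ∀ {C C' : Finset E}, Tight g F ℓ C → Tight g F ℓ C' → f ∉ C → f ∉ C' →
      verts g R ⊆ verts g C → ¬ Lnk g (C' \ C) a b := by
    rintro C C' hC hC' hfC hfC' hv ⟨f', hf', hg'⟩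
    rw [mem_sdiff] at hf'
    have := h.eq_of_chord hC (hC'.sub hf'.1) hf'.2 (fun v hi => ?_) hfF hfC
    · exact hfC' (this ▸ hf'.1)
    · rcases hg' with h | h <;> simp only [Inc, h] at hi <;> rcases hi with rfl | rfl <;>
        first | exact hv aR | exact hv bR
  have l1 := chord h2 h1 hf2 hf1 (v2 ▸ subset_union_right)
  have l2 := chord h1 h2 hf1 hf2 (v1 ▸ subset_union_right)
  obtain ⟨w, hw⟩ := hfc.exists_other
  have hww : ∀ {C : Finset E}, Tight g F ℓ C → f ∉ C → c ∈ verts g C →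
      (∃ f' ∈ F, f' ∉ C ∧ f' ≠ f) → w ∉ verts g C := by
    rintro C hC hfC hcC ⟨f', hf', hf'C, hne⟩ hwC
    refine hne (h.eq_of_chord hC hfF hfC (fun v hi => ?_) hf' hf'C)
    rcases hw with h | h <;> simp only [Inc, h] at hi <;> rcases hi with rfl | rfl <;>
      assumption
  have w1 : w ∉ verts g C₁ := by
    obtain ⟨f', hf'⟩ := n2
    rw [mem_sdiff] at hf'
    exact hww h1 hf1 (by rw [v1]; exact mem_union_right _ hcRv)
      ⟨f', h2.sub hf'.1, hf'.2, fun h => hf2 (h ▸ hf'.1)⟩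
  have w2 : w ∉ verts g C₂ := by
    obtain ⟨f', hf'⟩ := n1
    rw [mem_sdiff] at hf'
    exact hww h2 hf2 (by rw [v2]; exact mem_union_right _ hcRv)
      ⟨f', h1.sub hf'.1, hf'.2, fun h => hf1 (h ▸ hf'.1)⟩
  set X : Set V := {v | v ∈ verts g C₁ ∨ v ∈ verts g C₂} with hX
  have wX : w ∉ X := fun h => h.elim w1 w2
  set K := compl_comp (Lnk g F) X w with hKdef
  have KX : ∀ v ∈ K, v ∉ X := fun v hv => compl_comp_disjoint wX hv
  have lK : ∀ {C C' : Finset E}, Tight g F ℓ C → Tight g F ℓ C' → verts g C' =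
      verts g (C' \ C) ∪ verts g R → verts g R ⊆ verts g C → (∀ v ∈ K, v ∉ verts g C') →
      (∀ v ∈ K, v ∉ verts g C) → (∀ v, v ∈ X → v ∈ verts g C' ∨ v ∈ verts g C) →
      (C' \ C).Nonempty → Linked (Lnk g F) K (innerVerts g (C' \ C) a b) := by
    intro C C' hC hC' hv hR hKC' hKC hX hne
    by_contra hnl
    obtain ⟨f', hf'⟩ := hne
    rw [mem_sdiff] at hf'
    refine h.false_of_closed hC K hKC (fun p hp q hpq => ?_)
      ⟨w, mem_compl_comp_self, mem_verts.2 ⟨f, hfF, by rcases hw with h | h <;> simp [Inc, h]⟩⟩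
      ⟨f', hC'.sub hf'.1, hf'.2, fun v hv hvK => hKC' v hvK (mem_verts.2 ⟨f', hf'.1, hv⟩)⟩
    by_cases hqX : q ∈ X
    · right
      rcases hX q hqX with hq | hq
      · rw [hv, mem_union] at hq
        rcases hq with hq | hq
        · by_contra hqC
          exact hnl ⟨p, hp, q, ⟨hq, fun h => hqC (hR (h ▸ aR)), fun h => hqC (hR (h ▸ bR))⟩, hpq⟩
        · exact hR hq
      · exact hq
    · exact .inl (compl_comp_closed wX hp hpq hqX)
  have k1 := lK h2 h1 v1 (v2 ▸ subset_union_right) (fun v hv h => KX v hv (.inl h))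
    (fun v hv h => KX v hv (.inr h)) (fun _ h => h) n1
  have k2 := lK h1 h2 (by rw [v2]) (v1 ▸ subset_union_right)
    (fun v hv h => KX v hv (.inr h)) (fun v hv h => KX v hv (.inl h)) (fun _ h => h.symm) n2
  have kR : Linked (Lnk g F) K (innerVerts g R a b) :=
    ⟨w, mem_compl_comp_self, c, ⟨hcRv, hca, hcb⟩, f, hfF, hw.symm⟩
  have dint : ∀ {P Q : Finset E}, (∀ v, v ∈ verts g P → v ∈ verts g Q → v = a ∨ v = b) →
      Disjoint (innerVerts g P a b) (innerVerts g Q a b) := fun hPQ =>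
    Set.disjoint_left.2 fun v hv hv' => (hPQ v hv.1 hv'.1).elim hv.2.1 hv.2.2
  refine hK (hasMinor_K33_of_paths (Q := ![R, C₁ \ C₂, C₂ \ C₁]) (K := K) hab ?_ ?_ ?_ ?_ ?_
    (connOn_compl_comp lnk_symm) ?_ ?_)
  · intro i
    fin_cases i
    exacts [hRF, sdiff_subset.trans h1.sub, sdiff_subset.trans h2.sub]
  · intro i
    fin_cases i
    exacts [acR, ac1, ac2]
  · intro i
    fin_cases i
    exacts [hRb, b1, b2]
  · intro i
    fin_cases i
    exacts [lR, l1, l2]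
  · intro i j hij
    fin_cases i <;> fin_cases j
    exacts [absurd rfl hij, (dint d1R).symm, (dint d2R).symm, dint d1R, absurd rfl hij, dint d12,
      dint d2R, (dint d12).symm, absurd rfl hij]
  · intro i v hv
    fin_cases i
    exacts [fun h => KX v hv (.inl (verts_mono inter_subset_left h)),
      fun h => KX v hv (.inl (verts_mono sdiff_subset h)),
      fun h => KX v hv (.inr (verts_mono sdiff_subset h))]
  · intro i
    fin_cases i
    exacts [kR, k1, k2]

/-- An edge in three tight sets produces a Kuratowski minor. -/
theorem hasMinor_of_three [Fintype V] (h : Critical g F ℓ) {C : Fin 3 → Finset E}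
    (hC : ∀ i, Tight g F ℓ (C i))
    (inj : Function.Injective C) {e : E} (he : ∀ i, e ∈ C i)
    (hK : ¬ HasMinor (Lnk g F) (completeBipartiteGraph (Fin 3) (Fin 3))) :
    HasMinor (Lnk g F) (completeGraph (Fin 5)) := by
  obtain ⟨x, y, hxye⟩ : ∃ x y, g e = (x, y) := ⟨_, _, rfl⟩
  have heF := (hC 0).sub (he 0)
  have hxy : x ≠ y := by
    have := h.ne heF
    rwa [hxye] at this
  have hint : ∀ i j, i ≠ j → C i ∩ C j = {e} := fun i j hij =>
    h.inter_eq_singleton (hC i) (hC j) (inj.ne hij) (mem_inter.2 ⟨he i, he j⟩) hK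
  set Q : Fin 3 → Finset E := fun i => (C i).erase e with hQdef
  have QF : ∀ i, Q i ⊆ F := fun i => (erase_subset _ _).trans (hC i).sub
  have Qb : ∀ i, bdry g (Q i) = Pi.single x 1 + Pi.single y 1 := fun i => by
    rw [hQdef, bdry_erase (he i) (.inl hxye), (hC i).bdry_eq, zero_add]
  have Qac : ∀ i, Acyc g (Q i) := fun i => (h.circ (hC i)).acyc (erase_ssubset (he i))
  have Qne : ∀ i, (Q i).Nonempty := fun i => nonempty_of_bdry hxy (Qb i)
  have Ql : ∀ i, ¬ Lnk g (Q i) x y := by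
    rintro i ⟨f, hf, hg⟩
    have hfe : f ∉ ({e} : Finset E) := by simpa using ne_of_mem_erase hf
    have := h.feasible {f, e} (insert_subset (QF i hf) (singleton_subset_iff.2 heF))
      (insert_nonempty _ _) (by rw [insert_eq, bdry_union (disjoint_singleton_left.2 hfe),
        bdry_singleton_of hg, bdry_singleton_of (.inl hxye), add_self_vec])
    rw [sum_insert hfe, sum_singleton] at this
    linarith [h.lt_one e heF, h.lt_one f (QF i hf)]
  have Qsd : ∀ i j, i ≠ j → Q i = C i \ C j := fun i j hij => by
    rw [← sdiff_inter_self_left, hint i j hij, sdiff_singleton_eq_erase]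
  set I : Fin 3 → Set V := fun i => innerVerts g (Q i) x y with hIdef
  have Idisj : ∀ i j, i ≠ j → Disjoint (I i) (I j) := by
    intro i j hij
    refine Set.disjoint_left.2 fun v hv hv' => ?_
    have hm : ∀ D ⊆ Q i ∪ Q j, D.Nonempty → bdry g D = 0 → D = Q i ∪ Q j := by
      rw [Qsd i j hij, Qsd j i hij.symm]
      exact h.symmDiff_min (hC i) (hC j) ⟨e, mem_inter.2 ⟨he i, he j⟩⟩
    have hd : Disjoint (Q i) (Q j) := by
      rw [Qsd i j hij, Qsd j i hij.symm]
      exact disjoint_sdiff_sdiff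
    exact (eq_end_of_mem hd hxy (Qb i) (Qb j) hm hv.1 hv'.1).elim hv.2.1 hv.2.2
  have mono : ∀ i a b, Lnk g (Q i) a b → Lnk g F a b := fun i _ _ h => h.mono (QF i)
  have Iprop := fun i => (Qac i).interior hxy (Qb i) (Ql i)
  have Ine : ∀ i, (I i).Nonempty := fun i => by
    obtain ⟨-, -, v, hv, -⟩ := (Iprop i).2.1
    exact ⟨v, hv⟩
  have Cv : ∀ i v, v ∈ verts g (C i) ↔ v = x ∨ v = y ∨ v ∈ I i := by
    intro i v
    rw [verts_erase (he i) (.inl hxye)]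
    constructor
    · rintro (h | h | h)
      · exact .inl h
      · exact .inr (.inl h)
      · by_cases hx : v = x
        · exact .inl hx
        by_cases hy : v = y
        · exact .inr (.inl hy)
        exact .inr (.inr ⟨h, hx, hy⟩)
    · rintro (h | h | h)
      exacts [.inl h, .inr (.inl h), .inr (.inr h.1)]
  set X : Set V := {v | ∃ i, v ∈ verts g (C i)} with hX
  have IX : ∀ i, ∀ v ∈ I i, v ∈ X := fun i v hv => ⟨i, (Cv i v).2 (.inr (.inr hv))⟩
  have xX : x ∈ X := ⟨0, (Cv 0 x).2 (.inl rfl)⟩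
  have yX : y ∈ X := ⟨0, (Cv 0 y).2 (.inr (.inl rfl))⟩
  have cases3 : ∀ i j k : Fin 3, i ≠ j → i ≠ k → j ≠ k → ∀ l, l = i ∨ l = j ∨ l = k := by decide
  -- any two interiors are linked directly or through a component of the complement of `X`
  have link : ∀ i j, i ≠ j → Linked (Lnk g F) (I i) (I j) ∨ ∃ w ∉ X,
      Linked (Lnk g F) (compl_comp (Lnk g F) X w) (I i) ∧
      Linked (Lnk g F) (compl_comp (Lnk g F) X w) (I j) := by
    intro i j hij
    obtain ⟨k, hik, hjk⟩ : ∃ k, i ≠ k ∧ j ≠ k := by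
      revert i j; decide
    by_contra! hcon
    obtain ⟨hcon1, hcon2⟩ := hcon
    have hnotC : ∀ v ∈ I i, v ∉ verts g (C k) := by
      intro v hv hvk
      rcases (Cv k v).1 hvk with h | h | h
      exacts [hv.2.1 h, hv.2.2 h, Set.disjoint_left.1 (Idisj i k hik) hv h]
    obtain ⟨f, hf⟩ := Qne j
    obtain ⟨p, hp⟩ := Ine i
    refine h.false_of_closed (hC k)
      (I i ∪ {v | v ∉ X ∧ Linked (Lnk g F) (compl_comp (Lnk g F) X v) (I i)}) ?_ ?_
      ⟨p, .inl hp, verts_mono (QF i) hp.1⟩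
      ⟨f, QF j hf, fun hfk => ?_, fun v hv => ?_⟩
    · rintro v (hv | hv)
      · exact hnotC v hv
      · exact fun h => hv.1 ⟨k, h⟩
    · intro p hp q hpq
      by_cases hqX : q ∈ X
      · obtain ⟨l, hl⟩ := hqX
        rcases (Cv l q).1 hl with hq | hq | hq
        · exact .inr ((Cv k q).2 (.inl hq))
        · exact .inr ((Cv k q).2 (.inr (.inl hq)))
        · rcases cases3 i j k hij hik hjk l with rfl | rfl | rfl
          · exact .inl (.inl hq)
          · rcases hp with hp | hp
            · exact absurd ⟨p, hp, q, hq, hpq⟩ hcon1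
            · exact absurd ⟨p, mem_compl_comp_self, q, hq, hpq⟩ (hcon2 p hp.1 hp.2)
          · exact .inr hl
      · refine .inl (.inr ⟨hqX, ?_⟩)
        rcases hp with hp | hp
        · exact ⟨q, mem_compl_comp_self, p, hp, hpq.symm⟩
        · rw [compl_comp_eq lnk_symm (compl_comp_closed hp.1 mem_compl_comp_self hpq hqX)]
          exact hp.2
    · rw [Qsd j k hjk] at hf
      exact (mem_sdiff.1 hf).2 hfk
    · have hvj : v ∈ verts g (C j) := verts_mono (erase_subset _ _) (mem_verts.2 ⟨f, hf, hv⟩)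
      rintro (hvi | hvX)
      · rcases (Cv j v).1 hvj with h | h | h
        exacts [hvi.2.1 h, hvi.2.2 h, Set.disjoint_left.1 (Idisj i j hij) hvi h]
      · exact hvX.1 ⟨j, hvj⟩
  -- no component is linked to all three interiors
  have no3 : ∀ w ∉ X, ∃ i, ¬ Linked (Lnk g F) (compl_comp (Lnk g F) X w) (I i) := by
    intro w hw
    by_contra! hall
    refine hK (hasMinor_K33_of_paths hxy QF Qac Qb Ql Idisj (connOn_compl_comp lnk_symm) ?_ hall)
    exact fun i v hv hvQ => compl_comp_disjoint hw hv ⟨i, verts_mono (erase_subset _ _) hvQ⟩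
  have conn : ∀ i, ∃ K : Set V, ConnOn (Lnk g F) (I i ∪ K) ∧
      Linked (Lnk g F) (I i ∪ K) (I (i + 1)) ∧ ∀ v ∈ K, v ∉ X ∧
        Linked (Lnk g F) (compl_comp (Lnk g F) X v) (I i) ∧
        Linked (Lnk g F) (compl_comp (Lnk g F) X v) (I (i + 1)) := by
    intro i
    have hi : i ≠ i + 1 := by revert i; decide
    have cI := (Iprop i).1.mono (mono i)
    rcases link i (i + 1) hi with hl | ⟨w, hw, h1, h2⟩
    · exact ⟨∅, by rwa [Set.union_empty], by rwa [Set.union_empty], fun v hv => hv.elim⟩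
    · refine ⟨compl_comp (Lnk g F) X w, cI.union lnk_symm (connOn_compl_comp lnk_symm)
        (h1.symm lnk_symm), h2.mono_sets Set.subset_union_right subset_rfl, fun v hv => ?_⟩
      rw [compl_comp_eq lnk_symm hv]
      exact ⟨compl_comp_disjoint hw hv, h1, h2⟩
  choose K K1 K2 K3 using conn
  have Kdisj : ∀ i j, i ≠ j → Disjoint (K i) (K j) := by
    intro i j hij
    refine Set.disjoint_left.2 fun v hv hv' => ?_
    obtain ⟨k, hk⟩ := no3 v (K3 i v hv).1
    have : ∀ i j : Fin 3, i ≠ j → ∀ k, k = i ∨ k = i + 1 ∨ k = j ∨ k = j + 1 := by decide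
    rcases this i j hij k with rfl | rfl | rfl | rfl
    exacts [hk (K3 _ v hv).2.1, hk (K3 _ v hv).2.2, hk (K3 _ v hv').2.1, hk (K3 _ v hv').2.2]
  have Bl : ∀ i, Linked (Lnk g F) (I i ∪ K i) (I (i + 1) ∪ K (i + 1)) := fun i =>
    (K2 i).mono_sets subset_rfl Set.subset_union_left
  refine hasMinor_K5 (B := fun i => I i ∪ K i) lnk_symm hxy ⟨e, heF, .inl hxye⟩
    (fun i => (Ine i).mono Set.subset_union_left) K1 ?_ ?_ ?_ ?_ ?_ ?_
  · intro i j hij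
    have d : ∀ i j, Disjoint (I i) (K j) := fun i j =>
      Set.disjoint_left.2 fun v hv hv' => (K3 j v hv').1 (IX i v hv)
    exact Set.disjoint_union_left.2 ⟨Set.disjoint_union_right.2 ⟨Idisj i j hij, d i j⟩,
      Set.disjoint_union_right.2 ⟨(d j i).symm, Kdisj i j hij⟩⟩
  · rintro i (hv | hv)
    exacts [hv.2.1 rfl, (K3 i x hv).1 xX]
  · rintro i (hv | hv)
    exacts [hv.2.2 rfl, (K3 i y hv).1 yX]
  · intro i j hij
    have : j = i + 1 ∨ i = j + 1 := by revert i j; decide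
    rcases this with rfl | rfl
    exacts [Bl i, (Bl j).symm lnk_symm]
  · exact fun i => ((Iprop i).2.1.mono (mono i)).mono_sets subset_rfl Set.subset_union_left
  · exact fun i => ((Iprop i).2.2.mono (mono i)).mono_sets subset_rfl Set.subset_union_left

end Critical

end ThreeTight

section Weights

variable {V E : Type*} [DecidableEq V] [DecidableEq E]

lemma injective_vec_three {α : Type*} {a b c : α} (hab : a ≠ b) (hac : a ≠ c) (hbc : b ≠ c) :
    Function.Injective ![a, b, c] := by
  intro i j hij
  fin_cases i <;> fin_cases j <;> simp_all

/-- Below a level of the total weight, a polyhedron containing the nonnegativity constraints has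
a point at which the tight constraints determine all coordinates. -/
lemma exists_extreme_point {F : Finset E} {𝒦 : Finset (Finset E × ℝ)} {c : ℝ}
    (h0 : ∀ e ∈ F, ({e}, 0) ∈ 𝒦) (ℓ : E → ℝ) (hℓ : ∀ k ∈ 𝒦, k.2 ≤ ∑ e ∈ k.1, ℓ e)
    (hc : ∑ e ∈ F, ℓ e < c) :
    ∃ ℓ' : E → ℝ, (∀ k ∈ 𝒦, k.2 ≤ ∑ e ∈ k.1, ℓ' e) ∧ ∑ e ∈ F, ℓ' e < c ∧
      ∀ d : E → ℝ, (∀ k ∈ 𝒦, ∑ e ∈ k.1, ℓ' e = k.2 → ∑ e ∈ k.1, d e = 0) →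
        ∀ e ∈ F, d e = 0 := by
  classical
  induction hm : 𝒦.card - (𝒦.filter fun k => ∑ e ∈ k.1, ℓ e = k.2).card
    using Nat.strong_induction_on generalizing ℓ with
  | _ m ih =>
    by_contra! hcon
    obtain ⟨d₀, hd₀, e₀, he₀, hne₀⟩ := hcon ℓ hℓ hc
    obtain ⟨d, hd, hs, hne⟩ : ∃ d : E → ℝ,
        (∀ k ∈ 𝒦, ∑ e ∈ k.1, ℓ e = k.2 → ∑ e ∈ k.1, d e = 0) ∧ ∑ e ∈ F, d e ≤ 0 ∧
        d e₀ ≠ 0 := by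
      rcases le_total (∑ e ∈ F, d₀ e) 0 with h | h
      · exact ⟨d₀, hd₀, h, hne₀⟩
      · refine ⟨fun e => - d₀ e, fun k hk hkt => ?_, ?_, neg_ne_zero.2 hne₀⟩
        · rw [sum_neg_distrib, hd₀ k hk hkt, neg_zero]
        · rw [sum_neg_distrib]; linarith
    have hneg : ∃ e ∈ F, d e < 0 := by
      by_contra! hpos
      exact hne ((sum_eq_zero_iff_of_nonneg hpos).1 (le_antisymm hs (sum_nonneg hpos)) e₀ he₀)
    obtain ⟨e₁, he₁, hlt₁⟩ := hneg
    obtain ⟨k₀, hk₀, hmin⟩ := exists_min_image (𝒦.filter fun k => ∑ e ∈ k.1, d e < 0)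
      (fun k => (∑ e ∈ k.1, ℓ e - k.2) / (-∑ e ∈ k.1, d e))
      ⟨({e₁}, 0), mem_filter.2 ⟨h0 e₁ he₁, by simpa using hlt₁⟩⟩
    obtain ⟨hk₀, hr₀⟩ := mem_filter.1 hk₀
    set t := (∑ e ∈ k₀.1, ℓ e - k₀.2) / (-∑ e ∈ k₀.1, d e) with ht
    have ht0 : 0 ≤ t := div_nonneg (by linarith [hℓ k₀ hk₀]) (by linarith)
    have hsum : ∀ S : Finset E, ∑ e ∈ S, (ℓ e + t * d e) = ∑ e ∈ S, ℓ e + t * ∑ e ∈ S, d e :=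
      fun S => by rw [sum_add_distrib, mul_sum]
    have hnew : ∑ e ∈ k₀.1, (ℓ e + t * d e) = k₀.2 := by
      have : t * (-∑ e ∈ k₀.1, d e) = ∑ e ∈ k₀.1, ℓ e - k₀.2 :=
        div_mul_cancel₀ _ (by linarith)
      rw [hsum]
      linarith
    have hss : (𝒦.filter fun k => ∑ e ∈ k.1, ℓ e = k.2) ⊂
        𝒦.filter fun k => ∑ e ∈ k.1, (ℓ e + t * d e) = k.2 := by
      refine (ssubset_iff_of_subset fun k hk => ?_).2
        ⟨k₀, mem_filter.2 ⟨hk₀, hnew⟩, fun hk => ?_⟩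
      · rw [mem_filter] at hk ⊢
        exact ⟨hk.1, by rw [hsum, hd k hk.1 hk.2, mul_zero, add_zero, hk.2]⟩
      · exact hr₀.ne (hd k₀ hk₀ (mem_filter.1 hk).2)
    have hcard := card_lt_card hss
    have hle := card_filter_le 𝒦 fun k => ∑ e ∈ k.1, (ℓ e + t * d e) = k.2
    refine absurd (ih _ ?_ (fun e => ℓ e + t * d e) (fun k hk => ?_) ?_ rfl) ?_
    · omega
    · rw [hsum]
      rcases le_or_gt 0 (∑ e ∈ k.1, d e) with h | h
      · linarith [hℓ k hk, mul_nonneg ht0 h]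
      · have h1 := hmin k (mem_filter.2 ⟨hk, h⟩)
        rw [le_div_iff₀ (by linarith)] at h1
        linarith
    · rw [hsum]
      linarith [mul_nonneg ht0 (neg_nonneg.2 hs)]
    · rintro ⟨ℓ', h1, h2, h3⟩
      obtain ⟨d', hd', e, he, hne⟩ := hcon ℓ' h1 h2
      exact hne (h3 d' hd' e he)

/-- In a weighted multigraph without Kuratowski minors in which all circuits have weight at least
two, the total defect is at most the number of vertices minus two. -/
theorem sum_one_sub_le [Fintype V] (F : Finset E) (g : E → V × V) (ℓ : E → ℝ)
    (h0 : ∀ e ∈ F, 0 ≤ ℓ e) (h2 : ∀ D ⊆ F, D.Nonempty → bdry g D = 0 → 2 ≤ ∑ e ∈ D, ℓ e)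
    (hcyc : ¬ Acyc g F) (hK33 : ¬ HasMinor (Lnk g F) (completeBipartiteGraph (Fin 3) (Fin 3)))
    (hK5 : ¬ HasMinor (Lnk g F) (completeGraph (Fin 5))) :
    ∑ e ∈ F, (1 - ℓ e) ≤ (verts g F).card - 2 := by
  classical
  induction hn : F.card using Nat.strong_induction_on generalizing F g ℓ with
  | _ n ih =>
  by_contra! hviol
  have hsub : ∀ ℓ : E → ℝ, ∀ S : Finset E, ∑ e ∈ S, (1 - ℓ e) = S.card - ∑ e ∈ S, ℓ e :=
    fun ℓ S => by rw [sum_sub_distrib]; simp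
  -- pass to an extreme point
  obtain ⟨ℓ', hf, hv, hext⟩ := exists_extreme_point (F := F)
    (𝒦 := (F.image fun e => (({e} : Finset E), (0 : ℝ))) ∪
      ((F.powerset.filter fun D => D.Nonempty ∧ bdry g D = 0).image fun D => (D, (2 : ℝ))))
    (c := F.card - (verts g F).card + 2)
    (fun e he => mem_union_left _ (mem_image_of_mem _ he)) ℓ
    (fun k hk => by
      rcases mem_union.1 hk with hk | hk
      · obtain ⟨e, he, rfl⟩ := mem_image.1 hk
        simpa using h0 e he
      · obtain ⟨D, hD, rfl⟩ := mem_image.1 hk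
        rw [mem_filter, mem_powerset] at hD
        exact h2 D hD.1 hD.2.1 hD.2.2)
    (by rw [hsub] at hviol; linarith)
  clear hviol h0 h2
  replace hv : (verts g F).card - 2 < ∑ e ∈ F, (1 - ℓ' e) := by rw [hsub]; linarith
  clear ℓ
  rename' ℓ' => ℓ
  have h0 : ∀ e ∈ F, 0 ≤ ℓ e := fun e he => by
    simpa using hf ({e}, 0) (mem_union_left _ (mem_image_of_mem _ he))
  have h2 : ∀ D ⊆ F, D.Nonempty → bdry g D = 0 → 2 ≤ ∑ e ∈ D, ℓ e := fun D hD hne hb =>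
    hf (D, 2) (mem_union_right _ (mem_image_of_mem (fun D => (D, (2 : ℝ)))
      (mem_filter.2 ⟨mem_powerset.2 hD, hne, hb⟩)))
  obtain ⟨D₀, hD₀, hb₀, hne₀⟩ : ∃ D ⊆ F, bdry g D = 0 ∧ D.Nonempty := by
    by_contra! hcon
    exact hcyc fun D hD hb => hcon D hD hb
  have hadj5 : ∀ u : Fin 5, ∃ w, (completeGraph (Fin 5)).Adj u w := fun u => ⟨u + 1, by
    revert u; simp⟩
  have hadj33 : ∀ u : Fin 3 ⊕ Fin 3, ∃ w, (completeBipartiteGraph (Fin 3) (Fin 3)).Adj u w := by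
    rintro (i | i)
    exacts [⟨.inr 0, by simp⟩, ⟨.inl 0, by simp⟩]
  by_cases hzero : ∃ e ∈ F, ℓ e = 0
  · -- contraction
    obtain ⟨e, he, hℓe⟩ := hzero
    have hxy : (g e).1 ≠ (g e).2 := by
      intro hne
      have := h2 {e} (singleton_subset_iff.2 he) (singleton_nonempty e)
        (by rw [bdry_singleton, hne, add_self_vec])
      rw [sum_singleton, hℓe] at this
      norm_num at this
    have hes : F.erase e ⊆ F := erase_subset _ _
    have := ih _ (by rw [← hn]; exact card_erase_lt_of_mem he) (F.erase e)
      (mergeEnds g (g e).1 (g e).2) ℓ (fun f hf => h0 f (hes hf)) ?_ ?_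
      (fun h => hK33 (h.of_mergeEnds hadj33 he)) (fun h => hK5 (h.of_mergeEnds hadj5 he)) rfl
    · have hc : ((verts (mergeEnds g (g e).1 (g e).2) (F.erase e)).card : ℝ) + 1 ≤
          (verts g F).card := by exact_mod_cast card_verts_mergeEnds hxy he
      rw [← add_sum_erase _ _ he, hℓe] at hv
      linarith
    · intro D hD hne hb
      have heD : e ∉ D := fun h => by simpa using hD h
      rcases bdry_of_mergeEnds hxy heD hb with hb | hb
      · exact h2 D (hD.trans hes) hne hb
      · have := h2 _ (insert_subset he (hD.trans hes)) (insert_nonempty _ _) hb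
        rwa [sum_insert heD, hℓe, zero_add] at this
    · intro hac
      have := hac (D₀.erase e) (erase_subset_erase _ hD₀) (bdry_mergeEnds_erase hxy hb₀)
      have h3 := h2 D₀ hD₀ hne₀ hb₀
      by_cases heD : e ∈ D₀
      · rw [← add_sum_erase _ _ heD, hℓe, this, sum_empty] at h3
        norm_num at h3
      · rw [erase_eq_of_notMem heD] at this
        exact hne₀.ne_empty this
  by_cases hone : ∃ e ∈ F, 1 ≤ ℓ e
  · -- deletion
    obtain ⟨e, he, hℓe⟩ := hone
    have hes : F.erase e ⊆ F := erase_subset _ _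
    have hce : ((F.erase e).card : ℝ) + 1 = F.card := by
      exact_mod_cast card_erase_add_one he
    have hve : ((verts g (F.erase e)).card : ℝ) ≤ (verts g F).card := by
      exact_mod_cast card_le_card (verts_mono hes)
    by_cases hac : Acyc g (F.erase e)
    · have h3 := h2 D₀ hD₀ hne₀ hb₀
      have h4 : ∑ e ∈ D₀, ℓ e ≤ ∑ e ∈ F, ℓ e :=
        sum_le_sum_of_subset_of_nonneg hD₀ fun e he _ => h0 e he
      rw [hsub] at hv
      rcases (F.erase e).eq_empty_or_nonempty with hem | hne
      · rw [hem, card_empty] at hce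
        have h5 : 0 < (verts g F).card := card_pos.2 ⟨_, mem_verts.2 ⟨e, he, .inl rfl⟩⟩
        have h6 : (1 : ℝ) ≤ (verts g F).card := by exact_mod_cast h5
        push_cast at hce
        linarith
      · have h5 : ((F.erase e).card : ℝ) + 1 ≤ (verts g (F.erase e)).card := by
          exact_mod_cast hac.card_lt hne
        linarith
    · have mono : ∀ a b, Lnk g (F.erase e) a b → Lnk g F a b := fun _ _ h => h.mono hes
      have := ih _ (by rw [← hn]; exact card_erase_lt_of_mem he) (F.erase e) g ℓ
        (fun f hf => h0 f (hes hf)) (fun D hD => h2 D (hD.trans hes)) hac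
        (fun h => hK33 (h.mono mono)) (fun h => hK5 (h.mono mono)) rfl
      rw [← add_sum_erase _ _ he] at hv
      linarith
  push Not at hzero hone
  have hpos : ∀ e ∈ F, 0 < ℓ e := fun e he => (h0 e he).lt_of_ne' (hzero e he)
  have hext' : ∀ d : E → ℝ, (∀ D, Tight g F ℓ D → ∑ e ∈ D, d e = 0) → ∀ e ∈ F, d e = 0 := by
    refine fun d hd => hext d fun k hk hkt => ?_
    rcases mem_union.1 hk with hk | hk
    · obtain ⟨e, he, rfl⟩ := mem_image.1 hk
      simp only [sum_singleton] at hkt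
      exact absurd hkt (hzero e he)
    · obtain ⟨D, hD, rfl⟩ := mem_image.1 hk
      rw [mem_filter, mem_powerset] at hD
      exact hd D ⟨hD.1, hD.2.1, hD.2.2, hkt⟩
  have hcrit : Critical g F ℓ := by
    refine ⟨hpos, hone, h2, fun C hC A hA hAne hBne => ?_, fun e he f hf hef => ?_⟩
    · by_contra! hcon
      set B := (F \ C) \ A with hB
      have hBF : B ⊆ F := sdiff_subset.trans sdiff_subset
      have hAF : A ⊆ F := hA.trans sdiff_subset
      have hCA : Disjoint C A := disjoint_left.2 fun x hx hx' => (mem_sdiff.1 (hA hx')).2 hx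
      have hCB : Disjoint C B :=
        disjoint_left.2 fun x hx hx' => (mem_sdiff.1 (mem_sdiff.1 hx').1).2 hx
      have hF : ∀ S : E → ℝ, ∑ e ∈ F, S e = ∑ e ∈ C, S e + (∑ e ∈ A, S e + ∑ e ∈ B, S e) := by
        intro S
        rw [← sum_sdiff hC.sub, ← sum_sdiff hA]
        ring
      have hFV : verts g F = verts g (C ∪ A) ∪ verts g (C ∪ B) := by
        rw [← verts_union]
        congr 1
        ext x
        simp only [hB, mem_union, mem_sdiff]
        have := @hC.sub x
        have := @hAF x
        grind
      have side : ∀ A B : Finset E, A ⊆ F → Disjoint C A → B.Nonempty → B ⊆ F → Disjoint C B →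
          Disjoint A B → ∑ e ∈ C, (1 - ℓ e) + ∑ e ∈ A, (1 - ℓ e) ≤
            (verts g (C ∪ A)).card - 2 := by
        intro A B hA hCA ⟨b, hb⟩ hBF hCB hAB
        have hs : C ∪ A ⊆ F := union_subset hC.sub hA
        have hlt : (C ∪ A).card < n := by
          rw [← hn]
          refine card_lt_card ((ssubset_iff_of_subset hs).2 ⟨b, hBF hb, fun h => ?_⟩)
          exact (mem_union.1 h).elim (fun h => disjoint_left.1 hCB h hb)
            fun h => disjoint_left.1 hAB h hb
        have mono : ∀ a b, Lnk g (C ∪ A) a b → Lnk g F a b := fun _ _ h => h.mono hs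
        rw [← sum_union hCA]
        exact ih _ hlt (C ∪ A) g ℓ (fun f hf => h0 f (hs hf)) (fun D hD => h2 D (hD.trans hs))
          (fun h => hC.nonempty.ne_empty (h C subset_union_left hC.bdry_eq))
          (fun h => hK33 (h.mono mono)) (fun h => hK5 (h.mono mono)) rfl
      have sA := side A B hAF hCA hBne hBF hCB disjoint_sdiff
      have sB := side B A hBF hCB hAne hAF hCA disjoint_sdiff.symm
      have hcap : verts g (C ∪ A) ∩ verts g (C ∪ B) ⊆ verts g C := by
        intro v hv
        rw [verts_union, verts_union] at hv
        simp only [mem_inter, mem_union] at hv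
        have := hcon v
        tauto
      have c1 : ((verts g F).card : ℝ) + (verts g (C ∪ A) ∩ verts g (C ∪ B)).card =
          (verts g (C ∪ A)).card + (verts g (C ∪ B)).card := by
        rw [hFV]
        exact_mod_cast card_union_add_card_inter _ _
      have c2 : ((verts g (C ∪ A) ∩ verts g (C ∪ B)).card : ℝ) ≤ C.card := by
        exact_mod_cast (card_le_card hcap).trans (card_verts_le hC.bdry_eq)
      rw [hF] at hv
      have c3 := hsub ℓ C
      rw [hC.weight] at c3
      linarith
    · by_contra! hcon
      have := hext' (fun x => (if x = e then 1 else 0) - (if x = f then 1 else 0)) (fun D hD => by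
        rw [sum_sub_distrib, sum_ite_eq', sum_ite_eq']
        simp [hcon D hD]) e he
      simp [hef] at this
  -- some edge lies in three tight sets
  set 𝒯 := F.powerset.filter fun D => Tight g F ℓ D with h𝒯
  have hmem : ∀ D, D ∈ 𝒯 ↔ Tight g F ℓ D := fun D => by
    rw [h𝒯, mem_filter, mem_powerset]
    exact ⟨fun h => h.2, fun h => ⟨h.sub, h⟩⟩
  have hFT : F.card ≤ 𝒯.card := by
    let ext (d : F → ℝ) (e : E) : ℝ := if h : e ∈ F then d ⟨e, h⟩ else 0
    let L : (F → ℝ) →ₗ[ℝ] (𝒯 → ℝ) :=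
      { toFun := fun d D => ∑ e ∈ (D : Finset E), ext d e
        map_add' := fun d d' => by
          funext D
          rw [Pi.add_apply, ← sum_add_distrib]
          exact sum_congr rfl fun e _ => by simp only [ext]; split_ifs <;> simp
        map_smul' := fun c d => by
          funext D
          rw [Pi.smul_apply, smul_sum]
          exact sum_congr rfl fun e _ => by simp only [ext]; split_ifs <;> simp }
    have hL : Function.Injective L := by
      rw [← LinearMap.ker_eq_bot, LinearMap.ker_eq_bot']
      intro d hd
      have := hext' (ext d) fun D hD => congrFun hd ⟨D, (hmem D).2 hD⟩
      funext e
      simpa [ext] using this e e.2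
    simpa using LinearMap.finrank_le_finrank_of_injective hL
  obtain ⟨e, he, h3⟩ : ∃ e ∈ F, 2 < (𝒯.filter fun D => e ∈ D).card := by
    by_contra! hcon
    have k1 : ∀ D ∈ 𝒯, 3 ≤ D.card := by
      intro D hD
      have hT := (hmem D).1 hD
      have : ∑ e ∈ D, ℓ e < ∑ e ∈ D, (1 : ℝ) :=
        sum_lt_sum_of_nonempty hT.nonempty fun e he => hone e (hT.sub he)
      rw [hT.weight, sum_const, nsmul_eq_mul, mul_one] at this
      exact_mod_cast this
    have k2 : ∑ D ∈ 𝒯, D.card = ∑ e ∈ F, (𝒯.filter fun D => e ∈ D).card := by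
      have : ∀ D ∈ 𝒯, D.card = ∑ e ∈ F, if e ∈ D then 1 else 0 := by
        intro D hD
        rw [← card_filter, filter_mem_eq_inter, inter_eq_right.2 ((hmem D).1 hD).sub]
      rw [sum_congr rfl this, sum_comm]
      exact sum_congr rfl fun e _ => (card_filter _ _).symm
    have k3 := card_nsmul_le_sum 𝒯 _ 3 k1
    have k4 := sum_le_card_nsmul F _ 2 hcon
    have k5 : 0 < F.card := card_pos.2 (hne₀.mono hD₀)
    rw [smul_eq_mul] at k3 k4
    rw [k2] at k3
    omega
  obtain ⟨C₁, m1, C₂, m2, C₃, m3, h12, h13, h23⟩ := two_lt_card.1 h3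
  rw [mem_filter, hmem] at m1 m2 m3
  refine hK5 (hcrit.hasMinor_of_three (C := ![C₁, C₂, C₃]) ?_ ?_ (e := e) ?_ hK33)
  · intro i
    fin_cases i
    exacts [m1.1, m2.1, m3.1]
  · exact injective_vec_three h12 h13 h23
  · intro i
    fin_cases i
    exacts [m1.2, m2.2, m3.2]

end Weights

section Subdivisions

open Relation

variable {V U ι : Type*} {G : SimpleGraph V} {A B L S T : Set V} {a b c z : V}

/-- `L` is a connected set hanging off `c` and containing `a`, or `L` is empty and `a = c`. -/
def IsLeg (G : SimpleGraph V) (c : V) (L : Set V) (a : V) : Prop :=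
  (L = ∅ ∧ a = c) ∨ (c ∉ L ∧ a ∈ L ∧ ConnOn G.Adj L ∧ Linked G.Adj {c} L)

lemma adj_symm' : ∀ a b, G.Adj a b → G.Adj b a := fun _ _ h => h.symm

lemma ConnOn.union_of_mem {r : V → V → Prop} (hA : ConnOn r A) (hB : ConnOn r B) (ha : a ∈ A)
    (hb : a ∈ B) : ConnOn r (A ∪ B) := by
  have wA : ∀ p ∈ A, ∀ q ∈ A, ReflTransGen (Within r (A ∪ B)) p q := fun p hp q hq =>
    reach_mono (Within.mono (fun _ _ => id) Set.subset_union_left) (hA p hp q hq)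
  have wB : ∀ p ∈ B, ∀ q ∈ B, ReflTransGen (Within r (A ∪ B)) p q := fun p hp q hq =>
    reach_mono (Within.mono (fun _ _ => id) Set.subset_union_right) (hB p hp q hq)
  rintro p (hp | hp) q (hq | hq)
  exacts [wA p hp q hq, (wA p hp a ha).trans (wB a hb q hq),
    (wB p hp a hb).trans (wA a ha q hq), wB p hp q hq]

lemma IsLeg.notMem (h : IsLeg G c L a) : c ∉ L := by
  rcases h with ⟨rfl, -⟩ | h
  exacts [id, h.1]

lemma IsLeg.mem (h : IsLeg G c L a) : a ∈ insert c L := by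
  rcases h with ⟨-, rfl⟩ | h
  exacts [Set.mem_insert _ _, .inr h.2.1]

lemma IsLeg.conn (h : IsLeg G c L a) : ConnOn G.Adj (insert c L) := by
  rcases h with ⟨rfl, -⟩ | ⟨-, -, h1, h2⟩
  · rw [insert_empty_eq]
    exact connOn_singleton
  · exact connOn_singleton.union adj_symm' h1 h2

/-- A connected set contains a leg from any of its points to the first point met in `T`. -/
lemma ConnOn.exists_leg (hB : ConnOn G.Adj B) (hT : T ⊆ B) (hne : T.Nonempty) (ha : a ∈ B) :
    ∃ z ∈ T, ∃ P ⊆ B \ T, IsLeg G z P a := by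
  obtain ⟨t, ht⟩ := hne
  induction hB a ha t (hT ht) using ReflTransGen.head_induction_on with
  | refl => exact ⟨t, ht, ∅, Set.empty_subset _, .inl ⟨rfl, rfl⟩⟩
  | @head a a' hs _ ih =>
    by_cases haT : a ∈ T
    · exact ⟨a, haT, ∅, Set.empty_subset _, .inl ⟨rfl, rfl⟩⟩
    obtain ⟨z, hz, P, hP, hleg⟩ := ih hs.2.2
    have hsub : insert a P ⊆ B \ T := Set.insert_subset ⟨hs.2.1, haT⟩ hP
    refine ⟨z, hz, insert a P, hsub, .inr ⟨fun h => (hsub h).2 hz, .inl rfl, ?_⟩⟩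
    rcases hleg with ⟨rfl, rfl⟩ | ⟨-, h1, h2, h3⟩
    · rw [insert_empty_eq]
      exact ⟨connOn_singleton, a', rfl, a, rfl, hs.1.symm⟩
    · exact ⟨connOn_singleton.union adj_symm' h2 ⟨a, rfl, a', h1, hs.1⟩,
        h3.mono_sets subset_rfl (Set.subset_insert _ _)⟩

/-- Three points of a connected set are joined by a tripod inside the set. -/
lemma ConnOn.exists_tripod [Finite V] (hB : ConnOn G.Adj B) {a : Fin 3 → V} (ha : ∀ i, a i ∈ B) :
    ∃ c ∈ B, ∃ L : Fin 3 → Set V, (∀ i, L i ⊆ B) ∧ (∀ i j, i ≠ j → Disjoint (L i) (L j)) ∧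
      ∀ i, IsLeg G c (L i) (a i) := by
  obtain ⟨T, ⟨hTB, h0, h1, hT⟩, hmin⟩ := Set.Finite.exists_minimal
    (s := {T : Set V | T ⊆ B ∧ a 0 ∈ T ∧ a 1 ∈ T ∧ ConnOn G.Adj T}) (Set.toFinite _)
    ⟨B, subset_rfl, ha 0, ha 1, hB⟩
  obtain ⟨c, hz, P, hP, hleg⟩ := hB.exists_leg hTB ⟨_, h0⟩ (ha 2)
  have leg : ∀ {x}, x ∈ T → ∃ P ⊆ T \ {c}, IsLeg G c P x := fun hx => by
    obtain ⟨z, hzc, h⟩ := hT.exists_leg (Set.singleton_subset_iff.2 hz) ⟨c, rfl⟩ hx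
    rwa [Set.mem_singleton_iff.1 hzc] at h
  obtain ⟨P₀, hP₀, hleg₀⟩ := leg h0
  obtain ⟨P₁, hP₁, hleg₁⟩ := leg h1
  have d01 : Disjoint P₀ P₁ := by
    refine Set.disjoint_left.2 fun v hv hv' => ?_
    rcases hleg₀ with ⟨rfl, -⟩ | ⟨hc, m0, c0, -⟩
    · exact hv
    rcases hleg₁ with ⟨rfl, -⟩ | ⟨hc', m1, c1, -⟩
    · exact hv'
    have hs : P₀ ∪ P₁ ⊆ T := Set.union_subset (hP₀.trans Set.sdiff_subset)
      (hP₁.trans Set.sdiff_subset)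
    have := hmin ⟨hs.trans hTB, .inl m0, .inr m1, c0.union_of_mem c1 hv hv'⟩ hs hz
    exact this.elim hc hc'
  have dP : ∀ {S}, S ⊆ T \ {c} → Disjoint S P := fun hS =>
    Set.disjoint_left.2 fun v hv hv' => (hP hv').2 (hS hv).1
  refine ⟨c, hTB hz, ![P₀, P₁, P], ?_, ?_, ?_⟩
  · intro i
    fin_cases i
    exacts [(hP₀.trans Set.sdiff_subset).trans hTB, (hP₁.trans Set.sdiff_subset).trans hTB,
      hP.trans Set.sdiff_subset]
  · intro i j hij
    fin_cases i <;> fin_cases j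
    exacts [absurd rfl hij, d01, dP hP₀, d01.symm, absurd rfl hij, dP hP₁, (dP hP₀).symm,
      (dP hP₁).symm, absurd rfl hij]
  · intro i
    fin_cases i
    exacts [hleg₀, hleg₁, hleg]

/-- Four points of a connected set are joined by a spider, or the set splits into two linked
connected parts containing two of the points each. -/
lemma ConnOn.exists_spider_or_split [Finite V] (hB : ConnOn G.Adj B) {a : Fin 4 → V}
    (ha : ∀ i, a i ∈ B) :
    (∃ c ∈ B, ∃ L : Fin 4 → Set V, (∀ i, L i ⊆ B) ∧ (∀ i j, i ≠ j → Disjoint (L i) (L j)) ∧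
      ∀ i, IsLeg G c (L i) (a i)) ∨
    ∃ i : Fin 3, ∃ B₁ ⊆ B, ∃ B₂ ⊆ B, ConnOn G.Adj B₁ ∧ ConnOn G.Adj B₂ ∧ Disjoint B₁ B₂ ∧
      Linked G.Adj B₁ B₂ ∧ a i.castSucc ∈ B₁ ∧ a (Fin.last 3) ∈ B₁ ∧
      ∀ j, j ≠ i → a j.castSucc ∈ B₂ := by
  obtain ⟨c, hc, L, hLB, hLd, hleg⟩ := hB.exists_tripod (a := fun i => a i.castSucc)
    fun i => ha _
  have hTB : insert c (⋃ i, L i) ⊆ B := Set.insert_subset hc (Set.iUnion_subset hLB)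
  obtain ⟨z, hz, P, hP, hlegz⟩ := hB.exists_leg hTB ⟨c, .inl rfl⟩ (ha (Fin.last 3))
  have hPL : ∀ i, Disjoint (L i) P := fun i => Set.disjoint_left.2 fun v hv hv' =>
    (hP hv').2 (.inr (Set.mem_iUnion.2 ⟨i, hv⟩))
  rcases hz with rfl | hz
  · left
    refine ⟨z, hc, Fin.snoc (α := fun _ => Set V) L P, ?_, ?_, ?_⟩
    · intro i
      refine Fin.lastCases ?_ (fun i => ?_) i
      · rw [Fin.snoc_last]
        exact hP.trans Set.sdiff_subset
      · rw [Fin.snoc_castSucc]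
        exact hLB i
    · intro i j
      refine Fin.lastCases ?_ (fun i => ?_) i <;> refine Fin.lastCases ?_ (fun j => ?_) j <;>
        intro hij
      · exact absurd rfl hij
      · rw [Fin.snoc_last, Fin.snoc_castSucc]
        exact (hPL j).symm
      · rw [Fin.snoc_last, Fin.snoc_castSucc]
        exact hPL i
      · rw [Fin.snoc_castSucc, Fin.snoc_castSucc]
        exact hLd i j fun h => hij (h ▸ rfl)
    · intro i
      refine Fin.lastCases ?_ (fun i => ?_) i
      · rw [Fin.snoc_last]
        exact hlegz
      · rw [Fin.snoc_castSucc]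
        exact hleg i
  · right
    obtain ⟨i, hi⟩ := Set.mem_iUnion.1 hz
    have hne : i ≠ i + 1 ∧ i ≠ i + 2 := by
      have : ∀ i : Fin 3, i ≠ i + 1 ∧ i ≠ i + 2 := by decide
      exact this i
    have hcov : ∀ j, j ≠ i → j = i + 1 ∨ j = i + 2 := by
      have : ∀ i j : Fin 3, j ≠ i → j = i + 1 ∨ j = i + 2 := by decide
      exact this i
    rcases hleg i with ⟨h0, -⟩ | ⟨h1, h2, h3, h4⟩
    · rw [h0] at hi
      exact hi.elim
    have hcP : c ∉ P := fun h => (hP h).2 (.inl rfl)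
    refine ⟨i, L i ∪ insert z P, ?_, insert c (L (i + 1)) ∪ insert c (L (i + 2)), ?_,
      h3.union_of_mem hlegz.conn hi (.inl rfl),
      (hleg _).conn.union_of_mem (hleg _).conn (.inl rfl) (.inl rfl), ?_, ?_, .inl h2,
      .inr hlegz.mem, ?_⟩
    · exact Set.union_subset (hLB i)
        (Set.insert_subset (hLB i hi) (hP.trans Set.sdiff_subset))
    · exact Set.union_subset (Set.insert_subset hc (hLB _)) (Set.insert_subset hc (hLB _))
    · have hr : ∀ v ∈ L i ∪ insert z P, v ∈ L i ∨ v ∈ P := by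
        rintro v (hv | rfl | hv)
        exacts [.inl hv, .inl hi, .inr hv]
      have key : ∀ j, i ≠ j → ∀ v ∈ L i ∪ insert z P, v ∉ insert c (L j) := by
        rintro j hij v hv (rfl | hv')
        · exact (hr v hv).elim h1 hcP
        · exact (hr v hv).elim (fun h => Set.disjoint_left.1 (hLd i j hij) h hv')
            fun h => Set.disjoint_left.1 (hPL j) hv' h
      exact Set.disjoint_left.2 fun v hv hv' =>
        hv'.elim (key _ hne.1 v hv) (key _ hne.2 v hv)
    · exact (h4.symm adj_symm').mono_sets Set.subset_union_left
        (Set.singleton_subset_iff.2 (.inl (.inl rfl)))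
    · intro j hj
      rcases hcov j hj with rfl | rfl
      exacts [.inl (hleg _).mem, .inr (hleg _).mem]

lemma exists_walk_of_reach (ha : a ∈ S) (h : ReflTransGen (Within G.Adj S) a b) :
    ∃ p : G.Walk a b, ∀ x ∈ p.support, x ∈ S := by
  induction h with
  | refl => exact ⟨.nil, by simpa using ha⟩
  | tail _ h ih =>
    obtain ⟨p, hp⟩ := ih
    refine ⟨p.concat h.1, fun x hx => ?_⟩
    rw [Walk.support_concat, List.mem_append, List.mem_singleton] at hx
    rcases hx with hx | rfl
    exacts [hp x hx, h.2.2]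

/-- Disjoint spiders with adjacent feet form a subdivision. -/
lemma containsSubdivision_of_legs {H : SimpleGraph U} {B : U → Set V}
    (hB : ∀ u w, u ≠ w → Disjoint (B u) (B w)) {c : U → V} (hc : ∀ u, c u ∈ B u)
    {nb : U → ι → U}
    (hnb : ∀ u w, H.Adj u w → ∃ i, nb u i = w) {L : U → ι → Set V} (hL : ∀ u i, L u i ⊆ B u)
    (hd : ∀ u i j, i ≠ j → Disjoint (L u i) (L u j)) {att : U → U → V}
    (hatt : ∀ u w, H.Adj u w → G.Adj (att u w) (att w u))
    (hleg : ∀ u i, IsLeg G (c u) (L u i) (att u (nb u i))) : ContainsSubdivision G H := by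
  classical
  have eqB : ∀ {u w x}, x ∈ B u → x ∈ B w → u = w := fun {u w x} h1 h2 => by
    by_contra h
    exact Set.disjoint_left.1 (hB u w h) h1 h2
  have path : ∀ u w, H.Adj u w → ∃ p : G.Walk (c u) (c w), p.IsPath ∧ ∀ x ∈ p.support,
      x = c u ∨ x = c w ∨ (∃ i, nb u i = w ∧ x ∈ L u i) ∨ ∃ i, nb w i = u ∧ x ∈ L w i := by
    intro u w huw
    obtain ⟨i, rfl⟩ := hnb u w huw
    obtain ⟨j, hj⟩ := hnb _ u huw.symm
    have hlw := hleg (nb u i) j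
    rw [hj] at hlw
    obtain ⟨p, hp⟩ := exists_walk_of_reach (.inl rfl)
      ((hleg u i).conn _ (.inl rfl) _ (hleg u i).mem)
    obtain ⟨q, hq⟩ := exists_walk_of_reach (.inl rfl)
      (hlw.conn _ (.inl rfl) _ hlw.mem)
    refine ⟨(p.append (.cons (hatt _ _ huw) q.reverse)).bypass, Walk.bypass_isPath _,
      fun x hx => ?_⟩
    have hx := Walk.support_bypass_subset_support _ hx
    rw [Walk.mem_support_append_iff, Walk.support_cons, List.mem_cons, Walk.support_reverse,
      List.mem_reverse] at hx
    have hpq : x ∈ p.support ∨ x ∈ q.support := by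
      rcases hx with hx | rfl | hx
      exacts [.inl hx, .inl p.end_mem_support, .inr hx]
    rcases hpq with hx | hx
    · exact (hp x hx).imp_right fun h => .inr (.inl ⟨i, rfl, h⟩)
    · exact (hq x hx).elim (fun h => .inr (.inl h)) fun h => .inr (.inr (.inr ⟨j, hj, h⟩))
  choose P hPp hPs using path
  have leg_eq : ∀ {u i u' i' x}, x ∈ L u i → x ∈ L u' i' → u = u' ∧ nb u i = nb u' i' := by
    intro u i u' i' x h1 h2
    obtain rfl := eqB (hL u i h1) (hL u' i' h2)
    refine ⟨rfl, ?_⟩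
    by_contra h
    exact Set.disjoint_left.1 (hd u i i' fun h' => h (h' ▸ rfl)) h1 h2
  have hcL : ∀ u v i, c v ∉ L u i := by
    intro u v i h
    obtain rfl := eqB (hc v) (hL u i h)
    exact (hleg v i).notMem h
  refine ⟨c, fun u w h => eqB (hc u) (h ▸ hc w), fun u w h => P u w h, fun u w h => hPp u w h,
    ?_, ?_⟩
  · rintro u w h x hx ⟨v, rfl⟩
    rcases hPs u w h _ hx with h1 | h1 | ⟨i, -, h1⟩ | ⟨i, -, h1⟩
    exacts [.inl h1, .inr h1, (hcL _ _ _ h1).elim, (hcL _ _ _ h1).elim]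
  · intro u w h u' w' h' hne x hx hx'
    by_contra hr
    have e : ∀ v, x ≠ c v := fun v hv => hr ⟨v, hv.symm⟩
    have h1 := ((hPs u w h x hx).resolve_left (e _)).resolve_left (e _)
    have h2 := ((hPs u' w' h' x hx').resolve_left (e _)).resolve_left (e _)
    apply hne
    rcases h1 with ⟨i, rfl, h1⟩ | ⟨i, rfl, h1⟩ <;> rcases h2 with ⟨j, rfl, h2⟩ | ⟨j, rfl, h2⟩ <;>
      obtain ⟨e1, e2⟩ := leg_eq h1 h2 <;> rw [e2, e1]
    · exact Sym2.eq_swap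
    · exact Sym2.eq_swap

/-- In a model one can pick the linking edges symmetrically. -/
lemma IsModel.exists_attachments [Encodable U] {H : SimpleGraph U} {B : U → Set V}
    (h : IsModel G.Adj H B) : ∃ att : U → U → V, (∀ u w, att u w ∈ B u) ∧
      ∀ u w, H.Adj u w → G.Adj (att u w) (att w u) := by
  have : ∀ u w, ∃ p ∈ B u, ∃ q ∈ B w, H.Adj u w → G.Adj p q := by
    intro u w
    by_cases huw : H.Adj u w
    · obtain ⟨p, hp, q, hq, hpq⟩ := h.linked u w huw
      exact ⟨p, hp, q, hq, fun _ => hpq⟩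
    · obtain ⟨p, hp⟩ := h.nonempty u
      obtain ⟨q, hq⟩ := h.nonempty w
      exact ⟨p, hp, q, hq, fun h => absurd h huw⟩
  choose p hp q hq hpq using this
  refine ⟨fun u w => if Encodable.encode u < Encodable.encode w then p u w else q w u,
    fun u w => ?_, fun u w huw => ?_⟩
  · dsimp only
    split_ifs
    exacts [hp u w, hq w u]
  · have hne := Encodable.encode_injective.ne huw.ne
    dsimp only
    rcases hne.lt_or_gt with hlt | hlt
    · rw [if_pos hlt, if_neg hlt.not_gt]
      exact hpq u w huw
    · rw [if_neg hlt.not_gt, if_pos hlt]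
      exact (hpq w u huw.symm).symm

theorem HasMinor.containsSubdivision_K33 [Finite V]
    (h : HasMinor G.Adj (completeBipartiteGraph (Fin 3) (Fin 3))) :
    ContainsSubdivision G (completeBipartiteGraph (Fin 3) (Fin 3)) := by
  obtain ⟨B, hB⟩ := h
  obtain ⟨att, hatt, hadj⟩ := hB.exists_attachments
  let nb : Fin 3 ⊕ Fin 3 → Fin 3 → Fin 3 ⊕ Fin 3 := Sum.elim (fun _ => .inr) (fun _ => .inl)
  choose c hc L hL hd hleg using fun u => (hB.conn u).exists_tripod (a := fun i => att u (nb u i))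
    fun i => hatt _ _
  refine containsSubdivision_of_legs hB.disj hc (nb := nb) ?_ hL hd hadj hleg
  · rintro (i | i) (j | j) h
    · simp at h
    · exact ⟨j, rfl⟩
    · exact ⟨j, rfl⟩
    · simp at h

theorem HasMinor.containsSubdivision_K5 [Finite V] (h : HasMinor G.Adj (completeGraph (Fin 5)))
    (hK33 : ¬ HasMinor G.Adj (completeBipartiteGraph (Fin 3) (Fin 3))) :
    ContainsSubdivision G (completeGraph (Fin 5)) := by
  obtain ⟨B, hB⟩ := h
  obtain ⟨att, hatt, hadj⟩ := hB.exists_attachments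
  have spider : ∀ u, ∃ c ∈ B u, ∃ L : Fin 4 → Set V, (∀ i, L i ⊆ B u) ∧
      (∀ i j, i ≠ j → Disjoint (L i) (L j)) ∧ ∀ i, IsLeg G c (L i) (att u (u.succAbove i)) := by
    intro u
    refine ((hB.conn u).exists_spider_or_split fun i => hatt u (u.succAbove i)).resolve_right ?_
    rintro ⟨i, B₁, hB₁, B₂, hB₂, c1, c2, d12, l12, mi, ml, mj⟩
    apply hK33
    have hne : i + 1 ≠ i ∧ i + 2 ≠ i ∧ i + 1 ≠ i + 2 := by
      have : ∀ i : Fin 3, i + 1 ≠ i ∧ i + 2 ≠ i ∧ i + 1 ≠ i + 2 := by decide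
      exact this i
    set w : Fin 4 → Fin 5 := u.succAbove with hw
    have uw : ∀ k, u ≠ w k := fun k => (Fin.succAbove_ne u k).symm
    have ww : ∀ k l, k ≠ l → w k ≠ w l := fun k l h => Fin.succAbove_right_injective.ne h
    have cc : ∀ {k l : Fin 3}, k ≠ l → w k.castSucc ≠ w l.castSucc := fun h =>
      ww _ _ ((Fin.castSucc_injective 3).ne h)
    have cl : ∀ k : Fin 3, w k.castSucc ≠ w (Fin.last 3) := fun k => ww _ _ (Fin.castSucc_ne_last k)
    have D : ∀ {k l : Fin 5}, k ≠ l → Disjoint (B k) (B l) := fun h => hB.disj _ _ h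
    have Lk : ∀ {k l : Fin 5}, k ≠ l → Linked G.Adj (B k) (B l) := fun h => hB.linked _ _ h
    have D1 : ∀ k, Disjoint B₁ (B (w k)) := fun k => (D (uw k)).mono_left hB₁
    have D2 : ∀ k, Disjoint B₂ (B (w k)) := fun k => (D (uw k)).mono_left hB₂
    have A : ∀ {S : Set V} k, att u (w k) ∈ S → Linked G.Adj S (B (w k)) := fun k h =>
      ⟨_, h, _, hatt _ _, hadj _ _ (uw k)⟩
    refine hasMinor_K33 adj_symm' (A := ![B₁, B (w (i + 1).castSucc), B (w (i + 2).castSucc)])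
      (B := ![B₂, B (w i.castSucc), B (w (Fin.last 3))]) ?_ ?_ ?_ ?_ ?_ ?_ ?_ ?_
    · intro k
      fin_cases k
      exacts [⟨_, mi⟩, hB.nonempty _, hB.nonempty _]
    · intro k
      fin_cases k
      exacts [⟨_, mj _ hne.1⟩, hB.nonempty _, hB.nonempty _]
    · intro k
      fin_cases k
      exacts [c1, hB.conn _, hB.conn _]
    · intro k
      fin_cases k
      exacts [c2, hB.conn _, hB.conn _]
    · intro k l hkl
      fin_cases k <;> fin_cases l
      exacts [absurd rfl hkl, D1 _, D1 _, (D1 _).symm, absurd rfl hkl, D (cc hne.2.2),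
        (D1 _).symm, D (cc hne.2.2.symm), absurd rfl hkl]
    · intro k l hkl
      fin_cases k <;> fin_cases l
      exacts [absurd rfl hkl, D2 _, D2 _, (D2 _).symm, absurd rfl hkl, D (cl _),
        (D2 _).symm, D (cl _).symm, absurd rfl hkl]
    · intro k l
      fin_cases k <;> fin_cases l
      exacts [d12, D1 _, D1 _, (D2 _).symm, D (cc hne.1), D (cl _), (D2 _).symm,
        D (cc hne.2.1), D (cl _)]
    · intro k l
      fin_cases k <;> fin_cases l
      exacts [l12, A _ mi, A _ ml, (A _ (mj _ hne.1)).symm adj_symm', Lk (cc hne.1), Lk (cl _),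
        (A _ (mj _ hne.2.1)).symm adj_symm', Lk (cc hne.2.1), Lk (cl _)]
  choose c hc L hL hd hleg using spider
  refine containsSubdivision_of_legs hB.disj hc (nb := fun u => u.succAbove)
    (fun u w h => ?_) hL hd hadj hleg
  exact Fin.exists_succAbove_eq h.symm

end Subdivisions

section Reduction

variable {V : Type*} [Fintype V] [DecidableEq V] {G : SimpleGraph V}

/-- A set `M` of edges (to be given weight two) and a set `X` of edges (to be given weight one)
which together edge Roman dominate the subgraph induced by `U`, at cost at most `6/7 · |U|`. -/
def HasLightCover (G : SimpleGraph V) (U : Finset V) : Prop :=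
  ∃ M X : Finset (Sym2 V), (∀ e ∈ M, e ∈ G.edgeSet) ∧ (∀ e ∈ X, e ∈ G.edgeSet) ∧
    (∀ a ∈ U, ∀ b ∈ U, G.Adj a b → s(a, b) ∈ X ∨ ∃ e ∈ M, a ∈ e ∨ b ∈ e) ∧
    7 * (2 * #M + #X) ≤ 6 * #U

lemma HasLightCover.edgeRomanNumber_le (h : HasLightCover G univ) :
    7 * edgeRomanNumber V G ≤ 6 * Fintype.card V := by
  obtain ⟨M, X, hM, hX, hcov, hcard⟩ := h
  let f : Sym2 V → ℕ := fun e => if e ∈ M then 2 else if e ∈ X then 1 else 0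
  have hf : EdgeRDF G f := by
    refine ⟨fun e => ?_, fun e he => ?_, fun e he h0 => ?_⟩
    · dsimp only [f]
      split_ifs <;> omega
    · dsimp only [f]
      rw [if_neg fun h => he (hM e h), if_neg fun h => he (hX e h)]
    · have hf0 : e ∉ M ∧ e ∉ X := by
        dsimp only [f] at h0
        split_ifs at h0 with h1 h2
        exact ⟨h1, h2⟩
      induction e with
      | _ a b =>
      obtain ⟨e', he', hab⟩ := (hcov a (mem_univ _) b (mem_univ _) he).resolve_left hf0.2
      refine ⟨e', hM e' he', if_pos he', fun h => hf0.1 (h ▸ he'), ?_⟩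
      rcases hab with h | h
      exacts [⟨a, Sym2.mem_mk_left a b, h⟩, ⟨b, Sym2.mem_mk_right a b, h⟩]
  have hle : edgeRomanNumber V G ≤ ∑ e, f e := Nat.sInf_le ⟨f, hf, rfl⟩
  have hsum : ∑ e, f e ≤ 2 * #M + #X := by
    calc ∑ e, f e ≤ ∑ e, ((if e ∈ M then 2 else 0) + if e ∈ X then 1 else 0) := by
          refine sum_le_sum fun e _ => ?_
          dsimp only [f]
          split_ifs <;> omega
      _ = 2 * #M + #X := by simp [sum_add_distrib, mul_comm]
  rw [card_univ] at hcard
  omega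

/-- A set of pairwise disjoint edges of `G`, inside `U`, each of them meeting `N`. -/
structure IsMatchingAt (G : SimpleGraph V) (U N : Finset V) (M : Finset (Sym2 V)) : Prop where
  edge : ∀ e ∈ M, e ∈ G.edgeSet
  inside : ∀ e ∈ M, ∀ x ∈ e, x ∈ U
  meets : ∀ e ∈ M, ∃ x ∈ e, x ∈ N
  disj : ∀ e ∈ M, ∀ e' ∈ M, ∀ x ∈ e, x ∈ e' → e = e'

lemma IsMatchingAt.insert {U N : Finset V} {M : Finset (Sym2 V)} (h : IsMatchingAt G U N M)
    {a b : V} (hab : G.Adj a b) (ha : a ∈ U) (hb : b ∈ U) (haN : a ∈ N)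
    (haM : ∀ e ∈ M, a ∉ e) (hbM : ∀ e ∈ M, b ∉ e) : IsMatchingAt G U N (insert s(a, b) M) := by
  refine ⟨?_, ?_, ?_, ?_⟩
  · simp only [mem_insert, forall_eq_or_imp]
    exact ⟨hab, h.edge⟩
  · simp only [mem_insert, forall_eq_or_imp, Sym2.mem_iff, forall_eq]
    exact ⟨⟨ha, hb⟩, h.inside⟩
  · simp only [mem_insert, forall_eq_or_imp]
    exact ⟨⟨a, Sym2.mem_mk_left a b, haN⟩, h.meets⟩
  · have key : ∀ e ∈ M, ∀ x ∈ s(a, b), x ∉ e := by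
      simp only [Sym2.mem_iff, forall_eq_or_imp, forall_eq]
      exact fun e he => ⟨haM e he, hbM e he⟩
    intro e he e' he' x hx hx'
    rcases mem_insert.1 he with rfl | he <;> rcases mem_insert.1 he' with rfl | he'
    exacts [rfl, (key _ he' x hx hx').elim, (key _ he x hx' hx).elim, h.disj e he e' he' x hx hx']

lemma IsMatchingAt.card_biUnion_filter {U N : Finset V} {M : Finset (Sym2 V)}
    (h : IsMatchingAt G U N M) (p : V → Prop) [DecidablePred p] :
    #((M.biUnion Sym2.toFinset).filter p) = ∑ e ∈ M, #(e.toFinset.filter p) := by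
  rw [filter_biUnion, card_biUnion]
  intro e he e' he' hne
  rw [Function.onFun, Finset.disjoint_left]
  intro x hx hx'
  simp only [mem_filter, Sym2.mem_toFinset] at hx hx'
  exact hne (h.disj e he e' he' x hx.1 hx'.1)

lemma IsMatchingAt.card_biUnion {U N : Finset V} {M : Finset (Sym2 V)}
    (h : IsMatchingAt G U N M) : #(M.biUnion Sym2.toFinset) = 2 * #M := by
  have := h.card_biUnion_filter fun _ => True
  simp only [filter_true] at this
  rw [this, sum_congr rfl fun e he =>
    Sym2.card_toFinset_of_not_isDiag e (G.not_isDiag_of_mem_edgeSet (h.edge e he))]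
  simp [mul_comm]

/-- A vertex whose neighbourhood has a large matching relative to its size is reducible. -/
lemma hasLightCover_of_matching {U N : Finset V} {v : V} (hv : v ∈ U)
    (hN : ∀ x, x ∈ N ↔ x ∈ U ∧ G.Adj v x) {M₀ : Finset (Sym2 V)}
    (hM₀ : IsMatchingAt G (U.erase v) N M₀) (hM₀N : ∀ e ∈ M₀, ∀ x ∈ e, x ∈ N)
    (hcard : #N ≤ #M₀ + 3) (ih : ∀ U' ⊂ U, HasLightCover G U') : HasLightCover G U := by
  obtain ⟨M, ⟨hM₀M, hM⟩, hmax⟩ := Set.Finite.exists_maximal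
    (s := {M | M₀ ⊆ M ∧ IsMatchingAt G (U.erase v) N M}) (Set.toFinite _) ⟨M₀, subset_rfl, hM₀⟩
  set S := M.biUnion Sym2.toFinset with hS
  have mS : ∀ {x}, x ∈ S ↔ ∃ e ∈ M, x ∈ e := by simp [hS]
  have hSU : S ⊆ U.erase v := fun x hx => by
    obtain ⟨e, he, hx⟩ := mS.1 hx
    exact hM.inside e he x hx
  have hvN : v ∉ N := fun h => ((hN v).1 h).2.ne rfl
  have hNU : N ⊆ U.erase v := fun x hx => mem_erase.2 ⟨fun h => hvN (h ▸ hx), ((hN x).1 hx).1⟩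
  have hNS : #M + #M₀ ≤ #(S.filter (· ∈ N)) := by
    have h0 : #M₀ = ∑ e ∈ M, if e ∈ M₀ then 1 else 0 := by
      rw [sum_boole, filter_mem_eq_inter, inter_eq_right.2 hM₀M, Nat.cast_id]
    rw [hM.card_biUnion_filter, h0, card_eq_sum_ones, ← sum_add_distrib]
    refine sum_le_sum fun e he => ?_
    split_ifs with heM
    · rw [filter_true_of_mem fun x hx => hM₀N e heM x (Sym2.mem_toFinset.1 hx),
        Sym2.card_toFinset_of_not_isDiag e (G.not_isDiag_of_mem_edgeSet (hM.edge e he))]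
    · obtain ⟨x, hx, hxN⟩ := hM.meets e he
      exact card_pos.2 ⟨x, mem_filter.2 ⟨Sym2.mem_toFinset.2 hx, hxN⟩⟩
  set W := N \ S with hW
  have hWc : #W + #(S.filter (· ∈ N)) = #N := by
    rw [filter_mem_eq_inter, inter_comm, hW, card_sdiff_add_card_inter]
  have hSc : #S = 2 * #M := hM.card_biUnion
  have hvR : v ∉ W ∪ S := fun h => (mem_union.1 h).elim (fun h => hvN (mem_sdiff.1 h).1)
    fun h => (mem_erase.1 (hSU h)).1 rfl
  have hRU : insert v (W ∪ S) ⊆ U := insert_subset hv (union_subset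
    ((sdiff_subset.trans hNU).trans (erase_subset _ _)) (hSU.trans (erase_subset _ _)))
  have hRc : #(insert v (W ∪ S)) = #W + #S + 1 := by
    rw [card_insert_of_notMem hvR, card_union_of_disjoint sdiff_disjoint]
  obtain ⟨M₁, X₁, h1, h2, h3, h4⟩ := ih (U \ insert v (W ∪ S))
    (sdiff_ssubset hRU ⟨v, mem_insert_self _ _⟩)
  have key : ∀ a ∈ U, ∀ b ∈ U, G.Adj a b → a ∈ insert v W → a ∉ S → b ∉ S →
      s(a, b) ∈ W.image fun x => s(v, x) := by
    intro a ha b hb hab haR haS hbS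
    rcases mem_insert.1 haR with rfl | haW
    · exact mem_image_of_mem _ (mem_sdiff.2 ⟨(hN b).2 ⟨hb, hab⟩, hbS⟩)
    by_cases hbv : b = v
    · subst hbv
      rw [Sym2.eq_swap]
      exact mem_image_of_mem _ haW
    have haN := (mem_sdiff.1 haW).1
    have hins := hM.insert hab (hNU haN) (mem_erase.2 ⟨hbv, hb⟩) haN
      (fun e he hx => haS (mS.2 ⟨e, he, hx⟩)) (fun e he hx => hbS (mS.2 ⟨e, he, hx⟩))
    have := hmax ⟨hM₀M.trans (Finset.subset_insert _ _), hins⟩ (Finset.subset_insert _ _)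
      (mem_insert_self _ _)
    exact (haS (mS.2 ⟨_, this, Sym2.mem_mk_left a b⟩)).elim
  refine ⟨M ∪ M₁, W.image (fun x => s(v, x)) ∪ X₁, ?_, ?_, ?_, ?_⟩
  · exact fun e he => (mem_union.1 he).elim (hM.edge e) (h1 e)
  · intro e he
    rcases mem_union.1 he with he | he
    · obtain ⟨x, hx, rfl⟩ := mem_image.1 he
      exact ((hN x).1 (mem_sdiff.1 hx).1).2
    · exact h2 e he
  · intro a ha b hb hab
    by_cases haS : a ∈ S
    · obtain ⟨e, he, hx⟩ := mS.1 haS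
      exact .inr ⟨e, mem_union_left _ he, .inl hx⟩
    by_cases hbS : b ∈ S
    · obtain ⟨e, he, hx⟩ := mS.1 hbS
      exact .inr ⟨e, mem_union_left _ he, .inr hx⟩
    by_cases haR : a ∈ insert v W
    · exact .inl (mem_union_left _ (key a ha b hb hab haR haS hbS))
    by_cases hbR : b ∈ insert v W
    · rw [Sym2.eq_swap]
      exact .inl (mem_union_left _ (key b hb a ha hab.symm hbR hbS haS))
    have mem : ∀ x ∈ U, x ∉ S → x ∉ insert v W → x ∈ U \ insert v (W ∪ S) := by
      intro x hx hxS hxR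
      rw [← insert_union]
      exact mem_sdiff.2 ⟨hx, fun h => (mem_union.1 h).elim hxR hxS⟩
    rcases h3 a (mem a ha haS haR) b (mem b hb hbS hbR) hab with h | ⟨e, he, h⟩
    exacts [.inl (mem_union_right _ h), .inr ⟨e, mem_union_right _ he, h⟩]
  · have c1 := card_union_le M M₁
    have c2 := card_union_le (W.image fun x => s(v, x)) X₁
    have c3 := card_image_le (s := W) (f := fun x => s(v, x))
    have c4 := card_sdiff_add_card_eq_card hRU
    omega

/-- Weights on a neighbourhood `N` of an irreducible vertex. -/
lemma exists_halfWeight {N : Finset V} (h4 : 4 ≤ #N)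
    (hN4 : #N = 4 → ∀ x ∈ N, ∀ y ∈ N, ¬ G.Adj x y)
    (hN5 : #N = 5 → ∀ a ∈ N, ∀ b ∈ N, ∀ c ∈ N, ∀ d ∈ N, G.Adj a b → G.Adj c d →
      a = c ∨ a = d ∨ b = c ∨ b = d) :
    ∃ h : V → ℝ, (∀ x, 0 ≤ h x) ∧ (∀ x ∈ N, ∀ y ∈ N, G.Adj x y → 1 / 3 ≤ h x + h y) ∧
      2 * ∑ x ∈ N, h x ≤ #N - 4 := by
  classical
  rcases h4.eq_or_lt with h4 | h4
  · refine ⟨0, fun _ => le_rfl, fun x hx y hy hxy => (hN4 h4.symm x hx y hy hxy).elim, ?_⟩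
    simp [← h4]
  rcases (Nat.succ_le_of_lt h4).eq_or_lt with h5 | h5
  · specialize hN5 h5.symm
    have hc : (#N : ℝ) = 5 := by exact_mod_cast h5.symm
    by_cases hstar : ∃ c, ∀ x ∈ N, ∀ y ∈ N, G.Adj x y → x = c ∨ y = c
    · obtain ⟨c, hc'⟩ := hstar
      refine ⟨fun x => if x = c then 1 / 3 else 0, fun x => by positivity,
        fun x hx y hy hxy => ?_, ?_⟩
      · have : ∀ z, (0 : ℝ) ≤ if z = c then 1 / 3 else 0 := fun z => by positivity
        rcases hc' x hx y hy hxy with rfl | rfl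
        · simpa using this y
        · simpa using this x
      · rw [sum_ite_eq', hc]
        split_ifs <;> norm_num
    · push Not at hstar
      obtain ⟨o, -⟩ := card_pos.1 (show 0 < #N by omega)
      obtain ⟨a, ha, b, hb, hab, -⟩ := hstar o
      have far : ∀ a ∈ N, ∀ b ∈ N, G.Adj a b → ∃ c ∈ N, G.Adj b c ∧ c ≠ a := by
        intro a ha b hb hab
        obtain ⟨x, hx, y, hy, hxy, hxa, hya⟩ := hstar a
        rcases hN5 a ha b hb x hx y hy hab hxy with h | h | rfl | rfl
        exacts [(hxa h.symm).elim, (hya h.symm).elim, ⟨y, hy, hxy, hya⟩, ⟨x, hx, hxy.symm, hxa⟩]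
      obtain ⟨c, hc₁, hbc, hca⟩ := far a ha b hb hab
      obtain ⟨c', hc', hac', hcb'⟩ := far b hb a ha hab.symm
      have hcc : c' = c := by
        rcases hN5 b hb c hc₁ a ha c' hc' hbc hac' with h | h | h | h
        exacts [(hab.ne h.symm).elim, (hcb' h.symm).elim, (hca h).elim, h.symm]
      subst hcc
      have meet : ∀ x ∈ N, ∀ y ∈ N, G.Adj x y →
          x ∈ ({a, b, c'} : Finset V) ∧ y ∈ ({a, b, c'} : Finset V) := by
        intro x hx y hy hxy
        have e1 := hN5 x hx y hy a ha b hb hxy hab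
        have e2 := hN5 x hx y hy a ha c' hc' hxy hac'
        have e3 := hN5 x hx y hy b hb c' hc' hxy hbc
        have hne := hab.ne
        simp only [mem_insert, mem_singleton]
        clear hN5 hstar far
        grind
      refine ⟨fun x => if x ∈ ({a, b, c'} : Finset V) then 1 / 6 else 0, fun x => by positivity,
        fun x hx y hy hxy => ?_, ?_⟩
      · obtain ⟨h1, h2⟩ := meet x hx y hy hxy
        dsimp only
        rw [if_pos h1, if_pos h2]
        norm_num
      · have hle : (#(N ∩ {a, b, c'}) : ℝ) ≤ 3 := by
          exact_mod_cast (card_le_card inter_subset_right).trans card_le_three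
        rw [sum_ite_mem, sum_const, nsmul_eq_mul, hc]
        linarith
  · refine ⟨fun _ => 1 / 6, fun _ => by norm_num, fun _ _ _ _ _ => by norm_num, ?_⟩
    have : (6 : ℝ) ≤ #N := by exact_mod_cast h5
    rw [sum_const, nsmul_eq_mul]
    linarith

lemma exists_halfWeight_of_irreducible {U : Finset V} (ih : ∀ U' ⊂ U, HasLightCover G U')
    (hU : ¬ HasLightCover G U) {N : Finset V} {v : V} (hv : v ∈ U)
    (hN : ∀ x, x ∈ N ↔ x ∈ U ∧ G.Adj v x) :
    ∃ h : V → ℝ, (∀ x, 0 ≤ h x) ∧ (∀ x ∈ N, ∀ y ∈ N, G.Adj x y → 1 / 3 ≤ h x + h y) ∧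
      2 * ∑ x ∈ N, h x ≤ #N - 4 := by
  have irred : ∀ M₀, IsMatchingAt G (U.erase v) N M₀ → (∀ e ∈ M₀, ∀ x ∈ e, x ∈ N) →
      #M₀ + 3 < #N := fun M₀ h1 h2 =>
    not_le.1 fun h3 => hU (hasLightCover_of_matching hv hN h1 h2 h3 ih)
  have hNU : ∀ x ∈ N, x ∈ U.erase v := fun x hx =>
    mem_erase.2 ⟨((hN x).1 hx).2.ne', ((hN x).1 hx).1⟩
  have m0 : IsMatchingAt G (U.erase v) N ∅ := by constructor <;> simp
  have m1 : ∀ {a b}, a ∈ N → b ∈ N → G.Adj a b →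
      IsMatchingAt G (U.erase v) N (insert s(a, b) ∅) := fun {a b} ha hb hab =>
    m0.insert hab (hNU a ha) (hNU b hb) ha (by simp) (by simp)
  refine exists_halfWeight ?_ ?_ ?_
  · have := irred ∅ m0 (by simp)
    rw [card_empty] at this
    omega
  · intro h4 a ha b hb hab
    have := irred _ (m1 ha hb hab) (by simp [ha, hb])
    rw [h4, insert_empty_eq, card_singleton] at this
    omega
  · intro h5 a ha b hb c hc d hd hab hcd
    by_contra! hne
    have := irred _ ((m1 hc hd hcd).insert hab (hNU a ha) (hNU b hb) ha
      (by simp [hne.1, hne.2.1]) (by simp [hne.2.2.1, hne.2.2.2])) (by simp [ha, hb, hc, hd])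
    rw [h5, card_insert_of_notMem (by simp [hne.1, hne.2.1]), insert_empty_eq,
      card_singleton] at this
    omega

end Reduction

section Discharging

variable {V : Type*} [DecidableEq V]

/-- Every even set of edges of a simple graph either contains four edges or is a triangle, so an
edge weighting that is heavy on triangles is heavy on all even sets. -/
lemma two_le_sum_of_bdry {G : SimpleGraph V} {g : Sym2 V → V × V}
    (hg : ∀ e, e = s((g e).1, (g e).2)) {D : Finset (Sym2 V)}
    (hD : ∀ e ∈ D, e ∈ G.edgeSet) (hne : D.Nonempty) (hb : bdry g D = 0)
    {w : V → V → ℝ} (hw : ∀ u v, 1 / 2 ≤ w u v) (hws : ∀ u v, w u v = w v u)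
    (htri : ∀ a b c, s(a, b) ∈ D → s(a, c) ∈ D → s(b, c) ∈ D →
      2 ≤ w a b + w a c + w b c) : 2 ≤ ∑ e ∈ D, w (g e).1 (g e).2 := by
  have hinc : ∀ {e v}, Inc g e v ↔ v ∈ e := fun {e v} => by
    conv_rhs => rw [hg e]
    simp only [Inc, Sym2.mem_iff, eq_comm]
  have hval : ∀ a b, w (g s(a, b)).1 (g s(a, b)).2 = w a b := by
    intro a b
    rcases Sym2.eq_iff.1 (hg s(a, b)) with ⟨h1, h2⟩ | ⟨h1, h2⟩
    · rw [← h1, ← h2]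
    · rw [← h1, ← h2, hws]
  have second : ∀ {a b}, s(a, b) ∈ D → ∃ c, s(a, c) ∈ D ∧ c ≠ b ∧ c ≠ a := by
    intro a b hab
    have hadj : G.Adj (g s(a, b)).1 (g s(a, b)).2 := by
      have := hD _ hab
      rwa [hg s(a, b)] at this
    obtain ⟨f, hf, hfe, hfa⟩ := exists_second_edge hb hab hadj.ne (hinc.2 (Sym2.mem_mk_left a b))
    obtain ⟨c, rfl⟩ := Sym2.mem_iff_exists.1 (hinc.1 hfa)
    exact ⟨c, hf, fun h => hfe (h ▸ rfl), (G.ne_of_adj (hD _ hf)).symm⟩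
  have hnn : ∀ e ∈ D, 0 ≤ w (g e).1 (g e).2 := fun e _ =>
    (by norm_num : (0:ℝ) ≤ 1 / 2).trans (hw _ _)
  obtain ⟨e, he⟩ := hne
  induction e with
  | _ a b =>
  have hab : a ≠ b := G.ne_of_adj (hD _ he)
  obtain ⟨c, hac, hcb, hca⟩ := second he
  obtain ⟨d, hbd, hda, hdb⟩ := second (Sym2.eq_swap ▸ he : s(b, a) ∈ D)
  obtain ⟨x, hcx, hxa, hxc⟩ := second (Sym2.eq_swap ▸ hac : s(c, a) ∈ D)
  by_cases hdc : d = c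
  · subst hdc
    have hsub : ({s(a, b), s(a, d), s(b, d)} : Finset (Sym2 V)) ⊆ D := by
      simp [insert_subset_iff, he, hac, hbd]
    have := sum_le_sum_of_subset_of_nonneg hsub fun e he _ => hnn e he
    rw [sum_insert (by simp; grind), sum_insert (by simp; grind), sum_singleton, hval, hval,
      hval] at this
    linarith [htri a b d he hac hbd]
  · have hsub : ({s(a, b), s(a, c), s(b, d), s(c, x)} : Finset (Sym2 V)) ⊆ D := by
      simp [insert_subset_iff, he, hac, hbd, hcx]
    have := sum_le_sum_of_subset_of_nonneg hsub fun e he _ => hnn e he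
    rw [sum_insert (by simp; grind), sum_insert (by simp; grind), sum_insert (by simp; grind),
      sum_singleton, hval, hval, hval, hval] at this
    linarith [hw a b, hw a c, hw b d, hw c x]

/-- Summing over edges is summing over ordered pairs of adjacent vertices. -/
lemma sum_edges_eq {g : Sym2 V → V × V} (hg : ∀ e, e = s((g e).1, (g e).2))
    {P : Finset (V × V)} (hP : ∀ p ∈ P, p.1 ≠ p.2 ∧ p.swap ∈ P) (φ : V × V → ℝ) :
    ∑ p ∈ P, φ p = ∑ e ∈ P.image (fun p => s(p.1, p.2)), (φ (g e) + φ (g e).swap) := by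
  rw [← sum_fiberwise_of_maps_to fun p hp => mem_image_of_mem (fun p => s(p.1, p.2)) hp]
  refine sum_congr rfl fun e he => ?_
  obtain ⟨p, hp, hpe⟩ := mem_image.1 he
  have hcases : g e = p ∨ g e = p.swap := by
    have := hg e
    rw [← hpe] at this
    rcases Sym2.eq_iff.1 this with ⟨h1, h2⟩ | ⟨h1, h2⟩
    · rw [hpe] at h1 h2
      exact .inl (Prod.ext h1.symm h2.symm)
    · rw [hpe] at h1 h2
      exact .inr (Prod.ext h2.symm h1.symm)
  have hmem : g e ∈ P ∧ (g e).swap ∈ P ∧ (g e).1 ≠ (g e).2 := by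
    rcases hcases with h | h <;> rw [h]
    · exact ⟨hp, (hP p hp).2, (hP p hp).1⟩
    · exact ⟨(hP p hp).2, by simpa using hp, (hP p hp).1.symm⟩
  have hfib : P.filter (fun p => s(p.1, p.2) = e) = {g e, (g e).swap} := by
    ext q
    simp only [mem_filter, mem_insert, mem_singleton]
    constructor
    · rintro ⟨-, hq⟩
      rw [hg e] at hq
      rcases Sym2.eq_iff.1 hq with ⟨h1, h2⟩ | ⟨h1, h2⟩
      exacts [.inl (Prod.ext h1 h2), .inr (Prod.ext h1 h2)]
    · rintro (rfl | rfl)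
      · exact ⟨hmem.1, (hg e).symm⟩
      · exact ⟨hmem.2.1, by rw [Prod.fst_swap, Prod.snd_swap, Sym2.eq_swap]; exact (hg e).symm⟩
  rw [hfib, sum_pair fun h => hmem.2.2 (congrArg Prod.fst h)]

variable [Fintype V] {G : SimpleGraph V}

lemma hasLightCover (hK5 : ¬ HasMinor G.Adj (completeGraph (Fin 5)))
    (hK33 : ¬ HasMinor G.Adj (completeBipartiteGraph (Fin 3) (Fin 3))) (U : Finset V) :
    HasLightCover G U := by
  classical
  induction U using Finset.strongInduction with
  | _ U ih =>
  rcases U.eq_empty_or_nonempty with rfl | hUne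
  · exact ⟨∅, ∅, by simp, by simp, by simp, by simp⟩
  by_contra hU
  let N : V → Finset V := fun v => U.filter (G.Adj v)
  have hN : ∀ v x, x ∈ N v ↔ x ∈ U ∧ G.Adj v x := fun v x => mem_filter
  have hex : ∀ v, ∃ h : V → ℝ, (∀ x, 0 ≤ h x) ∧ (v ∈ U →
      (∀ x ∈ N v, ∀ y ∈ N v, G.Adj x y → 1 / 3 ≤ h x + h y) ∧
      2 * ∑ x ∈ N v, h x ≤ #(N v) - 4) := by
    intro v
    by_cases hv : v ∈ U
    · obtain ⟨h, h0, h1⟩ := exists_halfWeight_of_irreducible ih hU hv (hN v)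
      exact ⟨h, h0, fun _ => h1⟩
    · exact ⟨0, fun _ => le_rfl, fun h => (hv h).elim⟩
  choose h h0 h1 using hex
  let P : Finset (V × V) := (U ×ˢ U).filter fun p => G.Adj p.1 p.2
  have mP : ∀ {a b}, (a, b) ∈ P ↔ a ∈ U ∧ b ∈ U ∧ G.Adj a b := by simp [P, and_assoc]
  set F := P.image fun p => s(p.1, p.2) with hF
  have mF : ∀ {a b}, s(a, b) ∈ F → a ∈ U ∧ b ∈ U ∧ G.Adj a b := by
    intro a b hab
    obtain ⟨⟨x, y⟩, hp, hpe⟩ := mem_image.1 hab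
    obtain ⟨hx, hy, hxy⟩ := mP.1 hp
    rcases Sym2.eq_iff.1 hpe with ⟨rfl, rfl⟩ | ⟨rfl, rfl⟩
    exacts [⟨hx, hy, hxy⟩, ⟨hy, hx, hxy.symm⟩]
  obtain ⟨g, hg⟩ : ∃ g : Sym2 V → V × V, ∀ e, e = s((g e).1, (g e).2) :=
    ⟨Quot.out, fun e => (Quot.out_eq e).symm⟩
  have hgF : ∀ e ∈ F, (g e).1 ∈ U ∧ (g e).2 ∈ U ∧ G.Adj (g e).1 (g e).2 := fun e he =>
    mF (hg e ▸ he)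
  have hFG : ∀ e ∈ F, e ∈ G.edgeSet := fun e he => by
    rw [hg e]
    exact (hgF e he).2.2
  let w : V → V → ℝ := fun u v => (1 + h u v + h v u) / 2
  have hw : ∀ u v, 1 / 2 ≤ w u v := fun u v => by
    dsimp only [w]
    linarith [h0 u v, h0 v u]
  have hws : ∀ u v, w u v = w v u := fun u v => by
    dsimp only [w]
    ring
  have hsum : (#U : ℝ) ≤ ∑ e ∈ F, (1 - w (g e).1 (g e).2) := by
    have e1 : ∑ e ∈ F, (1 - w (g e).1 (g e).2) = ∑ p ∈ P, (1 / 4 - h p.1 p.2 / 2) := by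
      rw [sum_edges_eq hg (fun p hp => ?_)]
      · refine sum_congr rfl fun e _ => ?_
        simp only [w, Prod.fst_swap, Prod.snd_swap]
        ring
      · obtain ⟨x, y⟩ := p
        obtain ⟨hx, hy, hxy⟩ := mP.1 hp
        exact ⟨hxy.ne, mP.2 ⟨hy, hx, hxy.symm⟩⟩
    rw [e1, sum_filter, sum_product, ← nsmul_one, ← sum_const]
    refine sum_le_sum fun v hv => ?_
    rw [← sum_filter]
    change 1 ≤ ∑ x ∈ N v, (1 / 4 - h v x / 2)
    rw [sum_sub_distrib, sum_const, nsmul_eq_mul, ← sum_div]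
    linarith [(h1 v hv).2]
  have hvF : (#(verts g F) : ℝ) ≤ #U := by
    refine Nat.cast_le.2 (card_le_card fun v hv => ?_)
    obtain ⟨e, he, hv⟩ := mem_verts.1 hv
    rcases hv with rfl | rfl
    exacts [(hgF e he).1, (hgF e he).2.1]
  have hlnk : ∀ a b, Lnk g F a b → G.Adj a b := by
    rintro a b ⟨e, he, h | h⟩ <;> have := (hgF e he).2.2 <;> rw [h] at this
    exacts [this, this.symm]
  have hUpos : (0 : ℝ) < #U := Nat.cast_pos.2 hUne.card_pos
  by_cases hac : Acyc g F
  · have hFne : F.Nonempty := by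
      rw [nonempty_iff_ne_empty]
      intro h
      rw [h, sum_empty] at hsum
      linarith
    have hlt : (#F : ℝ) + 1 ≤ #(verts g F) := by exact_mod_cast hac.card_lt hFne
    have : ∑ e ∈ F, (1 - w (g e).1 (g e).2) ≤ ∑ e ∈ F, 1 :=
      sum_le_sum fun e _ => by linarith [hw (g e).1 (g e).2]
    rw [sum_const, nsmul_one] at this
    linarith
  · have := sum_one_sub_le F g (fun e => w (g e).1 (g e).2)
      (fun e _ => by linarith [hw (g e).1 (g e).2])
      (fun D hD hne hb => two_le_sum_of_bdry hg (fun e he => hFG e (hD he)) hne hb hw hws ?_) hac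
      (fun h => hK33 (h.mono hlnk)) fun h => hK5 (h.mono hlnk)
    · linarith
    · intro a b c hab hac hbc
      obtain ⟨ha, hb, hab⟩ := mF (hD hab)
      obtain ⟨-, hc, hac⟩ := mF (hD hac)
      obtain ⟨-, -, hbc⟩ := mF (hD hbc)
      have ta := (h1 a ha).1 b ((hN _ _).2 ⟨hb, hab⟩) c ((hN _ _).2 ⟨hc, hac⟩) hbc
      have tb := (h1 b hb).1 a ((hN _ _).2 ⟨ha, hab.symm⟩) c ((hN _ _).2 ⟨hc, hbc⟩) hac
      have tc := (h1 c hc).1 a ((hN _ _).2 ⟨ha, hac.symm⟩) b ((hN _ _).2 ⟨hb, hbc.symm⟩) hab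
      dsimp only [w]
      linarith

end Discharging

/-- If `G` is a planar graph on `n` vertices (planarity taken in the Kuratowski form:
`G` contains no subgraph isomorphic to a subdivision of `K₅` or of `K_{3,3}`), then
`γ'_R(G) ≤ (6/7)·n`. -/
theorem edgeRomanNumber_le_of_planar {V : Type*} [Fintype V] [DecidableEq V]
    (G : SimpleGraph V)
    (hK5 : ¬ ContainsSubdivision G (completeGraph (Fin 5)))
    (hK33 : ¬ ContainsSubdivision G (completeBipartiteGraph (Fin 3) (Fin 3))) :
    (edgeRomanNumber V G : ℝ) ≤ 6 / 7 * Fintype.card V := by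
  have h33 : ¬ HasMinor G.Adj (completeBipartiteGraph (Fin 3) (Fin 3)) := fun h =>
    hK33 h.containsSubdivision_K33
  have h5 : ¬ HasMinor G.Adj (completeGraph (Fin 5)) := fun h =>
    hK5 (h.containsSubdivision_K5 h33)
  have h : (7 * edgeRomanNumber V G : ℝ) ≤ 6 * Fintype.card V := by
    exact_mod_cast (hasLightCover h5 h33 univ).edgeRomanNumber_le
  linarith
end
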